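/- For every n ≥ 2, the holomorph Hol(B_n) of the braid group B_n admits a faithful finite-dimensional linear representation over a field of characteristic zero; that is, there exist a positive integer m and an injective group homomorphism Hol(B_n) → GL_m(ℂ). -/

import Mathlib

open scoped MatrixGroups

/-- The braid relations on `n` generators `σ_0, …, σ_{n-1}`:
`σ_i σ_{i+1} σ_i = σ_{i+1} σ_i σ_{i+1}` and `σ_i σ_j = σ_j σ_i` for `|i - j| ≥ 2`. -/
def braidRels (n : ℕ) : Set (FreeGroup (Fin n)) :=
  {r | (∃ i j : Fin n, (i : ℕ) + 1 = (j : ℕ) ∧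
          r = FreeGroup.of i * FreeGroup.of j * FreeGroup.of i *
              (FreeGroup.of j * FreeGroup.of i * FreeGroup.of j)⁻¹) ∨
       (∃ i j : Fin n, (i : ℕ) + 2 ≤ (j : ℕ) ∧
          r = FreeGroup.of i * FreeGroup.of j * (FreeGroup.of j * FreeGroup.of i)⁻¹)}

/-- The braid group `B_n` on `n` strings, presented with generators
`σ_1, …, σ_{n-1}` and the braid relations. -/
abbrev BraidGroup (n : ℕ) := PresentedGroup (braidRels (n - 1))

namespace BraidHol

/-- The braid group with `k` standard generators. -/
abbrev Br (k : ℕ) := PresentedGroup (braidRels k)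

/-- The standard generators, extended by `1` outside the range. -/
def sg (k i : ℕ) : Br k := if h : i < k then PresentedGroup.of ⟨i, h⟩ else 1

lemma sg_of_lt {k i : ℕ} (h : i < k) : sg k i = PresentedGroup.of ⟨i, h⟩ := dif_pos h

lemma sg_of_le {k i : ℕ} (h : k ≤ i) : sg k i = 1 := dif_neg (by omega)

lemma sg_braid {k i : ℕ} (h : i + 1 < k) :
    sg k i * sg k (i + 1) * sg k i = sg k (i + 1) * sg k i * sg k (i + 1) := by
  rw [sg_of_lt h, sg_of_lt (show i < k by omega), ← mul_inv_eq_one]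
  exact PresentedGroup.one_of_mem (rels := braidRels k)
    (Or.inl ⟨⟨i, by omega⟩, ⟨i + 1, h⟩, rfl, rfl⟩)

lemma sg_comm {k i j : ℕ} (h : i + 2 ≤ j) : Commute (sg k i) (sg k j) := by
  by_cases hj : j < k
  · rw [sg_of_lt hj, sg_of_lt (show i < k by omega)]
    rw [Commute, SemiconjBy, ← mul_inv_eq_one]
    exact PresentedGroup.one_of_mem (rels := braidRels k)
      (Or.inr ⟨⟨i, by omega⟩, ⟨j, hj⟩, h, rfl⟩)
  · rw [sg_of_le (not_lt.mp hj)]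
    exact Commute.one_right _

lemma sg_comm' {k i j : ℕ} (h : i + 2 ≤ j ∨ j + 2 ≤ i) : Commute (sg k i) (sg k j) :=
  h.elim sg_comm fun h => (sg_comm h).symm

/-- The family `f` satisfies the braid relations on `k` generators. -/
structure IsBraided {M : Type*} [Mul M] (k : ℕ) (f : ℕ → M) : Prop where
  braid : ∀ i, i + 1 < k → f i * f (i + 1) * f i = f (i + 1) * f i * f (i + 1)
  comm : ∀ i j, i + 2 ≤ j → j < k → f i * f j = f j * f i

lemma isBraided_sg (k : ℕ) : IsBraided k (sg k) :=
  ⟨fun _ h => sg_braid h, fun _ _ h _ => sg_comm h⟩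

section lift
variable {k : ℕ}

/-- The homomorphism out of the braid group given by a braided family. -/
def Br.lift {G : Type*} [Group G] (f : ℕ → G) (hf : IsBraided k f) : Br k →* G :=
  PresentedGroup.toGroup (f := fun i : Fin k => f i) (by
    rintro r (⟨i, j, h, rfl⟩ | ⟨i, j, h, rfl⟩)
    · have := hf.braid i (by omega)
      rw [h] at this
      simp only [map_mul, map_inv, FreeGroup.lift_apply_of]
      rw [mul_inv_eq_one, this]
    · simp only [map_mul, map_inv, FreeGroup.lift_apply_of]
      rw [mul_inv_eq_one, hf.comm i j h j.2])

@[simp] lemma Br.lift_sg {G : Type*} [Group G] (f : ℕ → G) (hf : IsBraided k f) {i : ℕ} (h : i < k) :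
    Br.lift f hf (sg k i) = f i := by
  rw [sg_of_lt h, Br.lift, PresentedGroup.toGroup.of]

lemma Br.closure_sg : Subgroup.closure {g : Br k | ∃ i < k, g = sg k i} = ⊤ := by
  rw [← top_le_iff, ← PresentedGroup.closure_range_of (braidRels k), Subgroup.closure_le]
  rintro _ ⟨i, rfl⟩
  exact Subgroup.subset_closure ⟨i, i.2, (sg_of_lt i.2).symm⟩

lemma Br.mem_of_sg (H : Subgroup (Br k)) (h : ∀ i < k, sg k i ∈ H) (b : Br k) : b ∈ H := by
  have : (⊤ : Subgroup (Br k)) ≤ H := by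
    rw [← Br.closure_sg (k := k), Subgroup.closure_le]
    rintro _ ⟨i, hi, rfl⟩
    exact h i hi
  exact this trivial

lemma Br.hom_ext {G : Type*} [Group G] {φ ψ : Br k →* G} (h : ∀ i < k, φ (sg k i) = ψ (sg k i)) :
    φ = ψ := by
  refine PresentedGroup.ext fun i => ?_
  have := h i i.2
  rwa [sg_of_lt i.2] at this

/-- Induction on words in the generators and their inverses. -/
lemma Br.induction {p : Br k → Prop} (b : Br k) (one : p 1)
    (mul : ∀ i < k, ∀ c, p c → p (sg k i * c))
    (inv : ∀ i < k, ∀ c, p c → p ((sg k i)⁻¹ * c)) : p b := by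
  have hb : b ∈ Subgroup.closure {g : Br k | ∃ i < k, g = sg k i} := by
    rw [Br.closure_sg]; trivial
  induction hb using Subgroup.closure_induction_left with
  | one => exact one
  | mul_left x hx y _ ih => obtain ⟨i, hi, rfl⟩ := hx; exact mul i hi _ ih
  | inv_mul_cancel x hx y _ ih => obtain ⟨i, hi, rfl⟩ := hx; exact inv i hi _ ih

end lift

end BraidHol

namespace BraidHol

section LKB
variable {R : Type*} [CommRing R] (q t : R)

/-- The dual Lawrence–Krammer operator of the `k`-th generator. -/
def lk (k : ℕ) (f : ℕ → ℕ → R) : ℕ → ℕ → R := fun i j =>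
  if j ≤ i then f i j
  else if i = k then
    if j = k + 1 then t * q ^ 2 * f k (k + 1)
    else t * q * (q - 1) * f k (k + 1) + q * f (k + 1) j
  else if i = k + 1 then f k j + (1 - q) * f (k + 1) j
  else if k + 1 < i then f i j
  else if j < k then f i j
  else if j = k then (1 - q) * f i k + q * f i (k + 1)
  else if j = k + 1 then f i k + t * q ^ (k - i + 1) * (q - 1) * f k (k + 1)
  else f i j + t * q ^ (k - i) * (q - 1) ^ 2 * f k (k + 1)

section eval
variable (k : ℕ) (f : ℕ → ℕ → R) {i j : ℕ}

lemma lk_far (h : j ≤ i ∨ k + 1 < i ∨ j < k) : lk q t k f i j = f i j := by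
  unfold lk; split_ifs <;> first | omega | rfl

lemma lk_simple (h : i = k) (h' : j = k + 1) : lk q t k f i j = t * q ^ 2 * f i j := by
  subst h h'; simp [lk]

lemma lk_left (h : i = k) (h' : k + 1 < j) :
    lk q t k f i j = t * q * (q - 1) * f i (i + 1) + q * f (i + 1) j := by
  subst h; unfold lk; split_ifs <;> first | omega | rfl

lemma lk_left_succ (h : i = k + 1) (h' : k + 1 < j) :
    lk q t k f i j = f k j + (1 - q) * f i j := by
  subst h; unfold lk; split_ifs <;> first | omega | rfl

lemma lk_right (h : i < k) (h' : j = k) :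
    lk q t k f i j = (1 - q) * f i j + q * f i (j + 1) := by
  subst h'; unfold lk; split_ifs <;> first | omega | rfl

lemma lk_right_succ (h : i < k) (h' : j = k + 1) :
    lk q t k f i j = f i k + t * q ^ (k - i + 1) * (q - 1) * f k j := by
  subst h'; unfold lk; split_ifs <;> first | omega | rfl

lemma lk_around (h : i < k) (h' : k + 1 < j) :
    lk q t k f i j = f i j + t * q ^ (k - i) * (q - 1) ^ 2 * f k (k + 1) := by
  unfold lk; split_ifs <;> first | omega | rfl

end eval

lemma lk_braid (k : ℕ) (f : ℕ → ℕ → R) :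
    lk q t k (lk q t (k + 1) (lk q t k f)) = lk q t (k + 1) (lk q t k (lk q t (k + 1) f)) := by
  funext i j
  by_cases hij : j ≤ i ∨ k + 2 < i ∨ j < k
  · simp (disch := omega) only [lk_far]
  rcases lt_trichotomy i k with h | rfl | h
  · obtain ⟨d, rfl⟩ := Nat.exists_eq_add_of_lt h
    have e1 : i + d + 1 - i = d + 1 := by omega
    have e2 : i + d + 1 + 1 - i = d + 2 := by omega
    obtain ⟨e, rfl⟩ := Nat.exists_eq_add_of_le (show i + d + 1 ≤ j by omega)
    rcases e with _ | _ | _ | e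
    all_goals
      simp (disch := omega) only [lk_far, lk_simple, lk_left, lk_left_succ, lk_right,
        lk_right_succ, lk_around, Nat.add_zero, Nat.add_sub_cancel_left, zero_add, ← add_assoc, e1, e2]
      ring
  · obtain ⟨e, rfl⟩ := Nat.exists_eq_add_of_lt (show i < j by omega)
    rcases e with _ | _ | e
    all_goals
      simp (disch := omega) only [lk_far, lk_simple, lk_left, lk_left_succ, lk_right,
        lk_right_succ, lk_around, Nat.add_zero, Nat.add_sub_cancel_left, zero_add, ← add_assoc]
      ring
  · obtain ⟨d, rfl⟩ := Nat.exists_eq_add_of_lt h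
    obtain ⟨e, rfl⟩ := Nat.exists_eq_add_of_lt (show k + d + 1 < j by omega)
    obtain rfl | rfl : d = 0 ∨ d = 1 := by omega
    all_goals rcases e with _ | e
    all_goals
      simp (disch := omega) only [lk_far, lk_simple, lk_left, lk_left_succ,
        lk_right_succ, lk_around, Nat.add_zero, Nat.add_sub_cancel_left, ← add_assoc]
      ring

lemma lk_comm {k l : ℕ} (h : k + 2 ≤ l) (f : ℕ → ℕ → R) :
    lk q t k (lk q t l f) = lk q t l (lk q t k f) := by
  funext i j
  by_cases hij : j ≤ i
  · simp (disch := omega) only [lk_far]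
  obtain ⟨m, rfl⟩ := Nat.exists_eq_add_of_le h
  have e1 : k + 2 + m - k = m + 2 := by omega
  have e2 : k + 2 + m - (k + 1) = m + 1 := by omega
  have hi : i < k ∨ i = k ∨ i = k + 1 ∨ (k + 1 < i ∧ i < k + 2 + m) ∨ i = k + 2 + m ∨
    i = k + 2 + m + 1 ∨ k + 2 + m + 1 < i := by omega
  have hj : j < k ∨ j = k ∨ j = k + 1 ∨ (k + 1 < j ∧ j < k + 2 + m) ∨ j = k + 2 + m ∨
    j = k + 2 + m + 1 ∨ k + 2 + m + 1 < j := by omega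
  rcases hi with hi | rfl | rfl | hi | rfl | rfl | hi <;>
    rcases hj with hj | rfl | rfl | hj | rfl | rfl | hj <;> first
    | omega
    | (simp (disch := omega) only [lk_far, lk_simple, lk_left, lk_left_succ, lk_right,
        lk_right_succ, lk_around, e1, e2]
       done)
    | (simp (disch := omega) only [lk_far, lk_left, lk_left_succ, lk_right,
        lk_right_succ, lk_around, e1, e2]
       ring)

end LKB
end BraidHol

namespace BraidHol

section del
variable {M : Type*} [Monoid M]

/-- The product `f 0 * f 1 * ⋯ * f (m - 1)`. -/
def del (f : ℕ → M) : ℕ → M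
  | 0 => 1
  | m + 1 => del f m * f m

@[simp] lemma del_zero (f : ℕ → M) : del f 0 = 1 := rfl

lemma del_succ (f : ℕ → M) (m : ℕ) : del f (m + 1) = del f m * f m := rfl

lemma del_succ' (f : ℕ → M) (m : ℕ) : del f (m + 1) = f 0 * del (fun i => f (i + 1)) m := by
  induction m with
  | zero => simp [del]
  | succ m ih => rw [del_succ, ih, del_succ, mul_assoc]

lemma map_del {N : Type*} [Monoid N] (φ : M →* N) (f : ℕ → M) (m : ℕ) :
    φ (del f m) = del (fun i => φ (f i)) m := by
  induction m with
  | zero => simp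
  | succ m ih => simp [del_succ, ih]

lemma commute_del {f : ℕ → M} {m : ℕ} {c : M} (h : ∀ i < m, Commute c (f i)) :
    Commute c (del f m) := by
  induction m with
  | zero => exact Commute.one_right c
  | succ m ih => exact (ih fun i hi => h i (by omega)).mul_right (h m (by omega))

lemma IsBraided.del_mul {k : ℕ} {f : ℕ → M} (hf : IsBraided k f) {m i : ℕ} (hm : m ≤ k)
    (hi : i + 1 < m) : del f m * f i = f (i + 1) * del f m := by
  induction m with
  | zero => omega
  | succ m ih =>
    rcases Nat.lt_or_ge (i + 1) m with h | h
    · rw [del_succ, mul_assoc, ← hf.comm i m (by omega) (by omega), ← mul_assoc,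
        ih (by omega) h, mul_assoc]
    · obtain rfl : m = i + 1 := by omega
      have hc : Commute (f (i + 1)) (del f i) :=
        commute_del fun j hj => (hf.comm j (i + 1) (by omega) (by omega)).symm
      rw [del_succ, del_succ, mul_assoc, mul_assoc, ← mul_assoc (f i), hf.braid i (by omega),
        ← mul_assoc, ← mul_assoc, ← hc.eq]
      simp only [mul_assoc]

lemma IsBraided.del_pow_mul {k : ℕ} {f : ℕ → M} (hf : IsBraided k f) {m i j : ℕ} (hm : m ≤ k)
    (hi : i + j < m) : del f m ^ j * f i = f (i + j) * del f m ^ j := by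
  induction j with
  | zero => simp
  | succ j ih =>
    rw [pow_succ', mul_assoc, ih (by omega), ← mul_assoc, hf.del_mul hm (by omega), mul_assoc,
      add_assoc]

lemma IsBraided.del_sq_mul {k : ℕ} {f : ℕ → M} (hf : IsBraided k f) {m : ℕ} (hm : m < k) :
    del f (m + 1) ^ 2 * f m = f 0 * del f (m + 1) ^ 2 := by
  have h : del (fun i => f (i + 1)) m * del f (m + 1) = del f (m + 1) * del f m := by
    have : ∀ j ≤ m, del f (m + 1) * del f j = del (fun i => f (i + 1)) j * del f (m + 1) := by
      intro j
      induction j with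
      | zero => simp
      | succ j ih =>
        intro hj
        rw [del_succ f j, ← mul_assoc, ih (by omega), mul_assoc, hf.del_mul hm (by omega),
          del_succ (fun i => f (i + 1)), mul_assoc]
    exact (this m le_rfl).symm
  calc del f (m + 1) ^ 2 * f m = f 0 * (del (fun i => f (i + 1)) m * del f (m + 1)) * f m := by
        rw [pow_two]
        nth_rw 1 [del_succ' f m]
        simp only [mul_assoc]
    _ = f 0 * del f (m + 1) ^ 2 := by
        rw [h, pow_two]
        nth_rw 3 [del_succ f m]
        simp only [mul_assoc]

lemma IsBraided.commute_del_pow {G : Type*} [Group G] {k : ℕ} {f : ℕ → G} (hf : IsBraided k f)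
    {m i : ℕ} (hm : m ≤ k) (hi : i < m) : Commute (del f m ^ (m + 1)) (f i) := by
  obtain ⟨m, rfl⟩ : ∃ l, m = l + 1 := ⟨m - 1, by omega⟩
  set d := del f (m + 1) with hd
  have h1 : Commute (d ^ (m + 1 + 1)) (f m) := by
    have h2 := hf.del_pow_mul (i := 0) (j := m) hm (by omega)
    rw [zero_add] at h2
    show d ^ (m + 2) * f m = f m * d ^ (m + 2)
    rw [pow_add, mul_assoc, hf.del_sq_mul hm, ← mul_assoc, h2, mul_assoc]
  have h3 := hf.del_pow_mul (i := i) (j := m - i) hm (by omega)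
  rw [show i + (m - i) = m by omega, ← hd] at h3
  have h4 : f i = (d ^ (m - i))⁻¹ * f m * d ^ (m - i) := by
    rw [mul_assoc, ← h3, inv_mul_cancel_left]
  have h5 : Commute (d ^ (m + 1 + 1)) (d ^ (m - i)) := Commute.pow_pow_self _ _ _
  rw [h4]
  exact (h5.inv_right.mul_right h1).mul_right h5

end del

/-- The product of all the standard generators. -/
def dl (k : ℕ) : Br k := del (sg k) k

/-- The full twist. -/
def zz (k : ℕ) : Br k := dl k ^ (k + 1)

lemma zz_commute (k : ℕ) (b : Br k) : Commute (zz k) b := by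
  have := Br.mem_of_sg (Subgroup.centralizer {zz k})
    (fun i hi => Subgroup.mem_centralizer_singleton_iff.2
      ((isBraided_sg k).commute_del_pow le_rfl hi).symm.eq) b
  exact (Subgroup.mem_centralizer_singleton_iff.1 this).symm

/-- The submonoid of positive braids. -/
def wd (n : ℕ) (w : List ℕ) : Br n := (w.map (sg n)).prod

@[simp] lemma wd_nil (n : ℕ) : wd n [] = 1 := rfl

@[simp] lemma wd_cons (n a : ℕ) (w : List ℕ) : wd n (a :: w) = sg n a * wd n w := by simp [wd]

lemma wd_append (n : ℕ) (v w : List ℕ) : wd n (v ++ w) = wd n v * wd n w := by simp [wd]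

/-- `b` is a product of standard generators. -/
def IsPos {n : ℕ} (b : Br n) : Prop := ∃ w : List ℕ, (∀ a ∈ w, a < n) ∧ b = wd n w

lemma IsPos.one {n : ℕ} : IsPos (1 : Br n) := ⟨[], by simp, rfl⟩

lemma IsPos.mul {n : ℕ} {b c : Br n} : IsPos b → IsPos c → IsPos (b * c) := by
  rintro ⟨v, hv, rfl⟩ ⟨w, hw, rfl⟩
  refine ⟨v ++ w, fun a ha => ?_, (wd_append n v w).symm⟩
  rcases List.mem_append.1 ha with h | h
  exacts [hv a h, hw a h]

lemma IsPos.sg {n i : ℕ} (h : i < n) : IsPos (sg n i) := ⟨[i], by simpa using h, by simp⟩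

lemma IsPos.pow {n : ℕ} {b : Br n} (hb : IsPos b) (m : ℕ) : IsPos (b ^ m) := by
  induction m with
  | zero => simpa using IsPos.one
  | succ m ih => rw [pow_succ]; exact ih.mul hb

lemma IsPos.del {n m : ℕ} {f : ℕ → Br n} (h : ∀ i < m, IsPos (f i)) : IsPos (del f m) := by
  induction m with
  | zero => exact IsPos.one
  | succ m ih => exact (ih fun i hi => h i (by omega)).mul (h m (by omega))

lemma isPos_dl (k : ℕ) : IsPos (dl k) := IsPos.del fun _ hi => IsPos.sg hi

lemma zz_eq_sg_mul {k i : ℕ} (hi : i < k) : ∃ b : Br k, IsPos b ∧ zz k = sg k i * b := by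
  obtain ⟨m, rfl⟩ : ∃ l, k = l + 1 := ⟨k - 1, by omega⟩
  set a := BraidHol.del (fun i => sg (m + 1) (i + 1)) m with ha
  have hd : dl (m + 1) = sg (m + 1) 0 * a := del_succ' _ _
  refine ⟨dl (m + 1) ^ i * a * dl (m + 1) ^ (m + 1 - i), ?_, ?_⟩
  · exact (((isPos_dl _).pow _).mul (IsPos.del fun i hi => IsPos.sg (by omega))).mul
      ((isPos_dl _).pow _)
  · have h := (isBraided_sg (m + 1)).del_pow_mul (i := 0) (j := i) le_rfl (by omega)
    rw [zero_add] at h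
    change dl (m + 1) ^ i * _ = _ * dl (m + 1) ^ i at h
    have : zz (m + 1) = dl (m + 1) ^ i * dl (m + 1) * dl (m + 1) ^ (m + 1 - i) := by
      rw [zz, ← pow_succ, ← pow_add]; congr 1; omega
    rw [this]
    nth_rw 2 [hd]
    rw [← mul_assoc, h]
    simp only [mul_assoc]

lemma exists_zz_pow_mul_isPos {n : ℕ} (b : Br n) : ∃ N : ℕ, IsPos (zz n ^ N * b) := by
  induction b using Br.induction with
  | one => exact ⟨0, by simpa using IsPos.one⟩
  | mul i hi c ih =>
    obtain ⟨N, h⟩ := ih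
    refine ⟨N, ?_⟩
    rw [← mul_assoc, ((zz_commute n (sg n i)).pow_left N).eq, mul_assoc]
    exact (IsPos.sg hi).mul h
  | inv i hi c ih =>
    obtain ⟨N, h⟩ := ih
    obtain ⟨p, hp, hz⟩ := zz_eq_sg_mul hi
    refine ⟨N + 1, ?_⟩
    have : zz n ^ (N + 1) * ((sg n i)⁻¹ * c) = p * (zz n ^ N * c) := by
      rw [pow_succ', mul_assoc, ← mul_assoc _ _ c, ((zz_commute n (sg n i)⁻¹).pow_left N).eq]
      rw [show p = (sg n i)⁻¹ * zz n by rw [hz]; group]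
      rw [← mul_assoc, ← mul_assoc, (zz_commute n (sg n i)⁻¹).eq]
      simp only [mul_assoc]
    rw [this]
    exact hp.mul h

end BraidHol

namespace BraidHol
open Polynomial

section words
variable {R : Type*} [CommRing R] (q t : R)

/-- The operator of a positive word. -/
def lkw (w : List ℕ) (f : ℕ → ℕ → R) : ℕ → ℕ → R := w.foldr (lk q t) f

@[simp] lemma lkw_nil (f : ℕ → ℕ → R) : lkw q t [] f = f := rfl

@[simp] lemma lkw_cons (a : ℕ) (w : List ℕ) (f : ℕ → ℕ → R) :
    lkw q t (a :: w) f = lk q t a (lkw q t w f) := rfl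

lemma map_lk {S : Type*} [CommRing S] (φ : R →+* S) (k : ℕ) (f : ℕ → ℕ → R) :
    lk (φ q) (φ t) k (fun i j => φ (f i j)) = fun i j => φ (lk q t k f i j) := by
  funext i j
  unfold lk
  split_ifs <;> simp

lemma map_lkw {S : Type*} [CommRing S] (φ : R →+* S) (w : List ℕ) (f : ℕ → ℕ → R) :
    lkw (φ q) (φ t) w (fun i j => φ (f i j)) = fun i j => φ (lkw q t w f i j) := by
  induction w with
  | nil => rfl
  | cons a w ih => rw [lkw_cons, ih, map_lk, lkw_cons]

end words

/-- Two words agree both in the braid group and as specialised operators. -/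
def WEq (n : ℕ) (v w : List ℕ) : Prop :=
  wd n v = wd n w ∧ ∀ f, lkw (1 / 2 : ℚ) 0 v f = lkw (1 / 2 : ℚ) 0 w f

lemma WEq.trans {n : ℕ} {u v w : List ℕ} (h : WEq n u v) (h' : WEq n v w) : WEq n u w :=
  ⟨h.1.trans h'.1, fun f => (h.2 f).trans (h'.2 f)⟩

lemma WEq.cons {n : ℕ} {v w : List ℕ} (a : ℕ) (h : WEq n v w) : WEq n (a :: v) (a :: w) :=
  ⟨by rw [wd_cons, wd_cons, h.1], fun f => by rw [lkw_cons, lkw_cons, h.2]⟩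

lemma WEq.braid {n a : ℕ} (h : a + 1 < n) (w : List ℕ) :
    WEq n (a :: (a + 1) :: a :: w) ((a + 1) :: a :: (a + 1) :: w) :=
  ⟨by simp only [wd_cons, ← mul_assoc]; rw [sg_braid h], fun f => lk_braid _ _ _ _⟩

lemma WEq.comm {n a b : ℕ} (h : a + 2 ≤ b ∨ b + 2 ≤ a) (w : List ℕ) :
    WEq n (a :: b :: w) (b :: a :: w) :=
  ⟨by simp only [wd_cons, ← mul_assoc]; rw [(sg_comm' h).eq], fun f => by
    rcases h with h | h
    exacts [lk_comm _ _ h _, (lk_comm _ _ h _).symm]⟩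

lemma WEq.symm {n : ℕ} {u v : List ℕ} (h : WEq n u v) : WEq n v u :=
  ⟨h.1.symm, fun f => (h.2 f).symm⟩

lemma lk_nonneg (k : ℕ) {f : ℕ → ℕ → ℚ} (hf : ∀ i j, 0 ≤ f i j) (i j : ℕ) :
    0 ≤ lk (1 / 2 : ℚ) 0 k f i j := by
  unfold lk
  split_ifs <;> norm_num <;>
    linarith [hf i j, hf k j, hf (k + 1) j, hf i k, hf i (k + 1)]

lemma lkw_nonneg (w : List ℕ) (i j : ℕ) : 0 ≤ lkw (1 / 2 : ℚ) 0 w (fun _ _ => 1) i j := by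
  induction w generalizing i j with
  | nil => simp
  | cons a w ih => exact lk_nonneg a ih i j

/-- A word killing the simple coordinate `s` is left divisible by `s`. -/
lemma exists_left_divisor {n : ℕ} (l : ℕ) : ∀ (w : List ℕ), w.length = l → (∀ a ∈ w, a < n) →
    ∀ s < n, lkw (1 / 2 : ℚ) 0 w (fun _ _ => 1) s (s + 1) = 0 →
    ∃ v : List ℕ, v.length + 1 = l ∧ (∀ a ∈ v, a < n) ∧ WEq n w (s :: v) := by
  induction l using Nat.strong_induction_on with
  | _ l ih =>
  intro w hl hw s hs hz
  match w, hl with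
  | [], _ => simp at hz
  | r :: c, hl =>
    have hr : r < n := hw r (by simp)
    have hc : ∀ a ∈ c, a < n := fun a ha => hw a (by simp [ha])
    have hcl : c.length + 1 = l := by simpa using hl
    rw [lkw_cons] at hz
    have hn := lkw_nonneg c
    rcases (show r = s ∨ (r + 2 ≤ s ∨ s + 2 ≤ r) ∨ r = s + 1 ∨ s = r + 1 by omega) with
      rfl | h | rfl | rfl
    · exact ⟨c, hcl, hc, rfl, fun _ => rfl⟩
    · rw [lk_far _ _ _ _ (by omega)] at hz
      obtain ⟨d, hd, hd', e⟩ := ih c.length (by omega) c rfl hc s hs hz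
      refine ⟨r :: d, by simpa using by omega, ?_, (e.cons r).trans (WEq.comm h d)⟩
      simpa using ⟨hr, hd'⟩
    · rw [lk_right _ _ _ _ (by omega) rfl] at hz
      have h1 : lkw (1 / 2 : ℚ) 0 c (fun _ _ => 1) s (s + 1) = 0 := by
        linarith [hn s (s + 1), hn s (s + 1 + 1)]
      have h2 : lkw (1 / 2 : ℚ) 0 c (fun _ _ => 1) s (s + 1 + 1) = 0 := by
        linarith [hn s (s + 1), hn s (s + 1 + 1)]
      obtain ⟨d, hd, hd', e⟩ := ih c.length (by omega) c rfl hc s hs h1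
      rw [e.2, lkw_cons, lk_left _ _ _ _ rfl (by omega)] at h2
      obtain ⟨u, hu, hu', e'⟩ := ih d.length (by omega) d rfl hd' (s + 1) hr (by linarith)
      refine ⟨(s + 1) :: s :: u, by simpa using by omega, by simpa using ⟨hr, hs, hu'⟩, ?_⟩
      exact ((e.trans (e'.cons s)).cons (s + 1)).trans (WEq.braid hr u).symm
    · rw [lk_left_succ _ _ _ _ rfl (by omega)] at hz
      have h1 : lkw (1 / 2 : ℚ) 0 c (fun _ _ => 1) (r + 1) (r + 1 + 1) = 0 := by
        linarith [hn r (r + 1 + 1), hn (r + 1) (r + 1 + 1)]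
      have h2 : lkw (1 / 2 : ℚ) 0 c (fun _ _ => 1) r (r + 1 + 1) = 0 := by
        linarith [hn r (r + 1 + 1), hn (r + 1) (r + 1 + 1)]
      obtain ⟨d, hd, hd', e⟩ := ih c.length (by omega) c rfl hc (r + 1) hs h1
      rw [e.2, lkw_cons, lk_right_succ _ _ _ _ (by omega) rfl] at h2
      obtain ⟨u, hu, hu', e'⟩ := ih d.length (by omega) d rfl hd' r hr (by linarith)
      refine ⟨r :: (r + 1) :: u, by simpa using by omega, by simpa using ⟨hr, hs, hu'⟩, ?_⟩
      exact ((e.trans (e'.cons (r + 1))).cons r).trans (WEq.braid hs u)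

section linear
variable {F : Type*} [Field F] (q t : F) (N : ℕ)

/-- Extension by zero. -/
def extd (v : Fin N → Fin N → F) : ℕ → ℕ → F := fun a b =>
  if h : a < N ∧ b < N then v ⟨a, h.1⟩ ⟨b, h.2⟩ else 0

lemma lk_add (k : ℕ) (f g : ℕ → ℕ → F) : lk q t k (f + g) = lk q t k f + lk q t k g := by
  funext i j
  simp only [Pi.add_apply]
  unfold lk
  simp only [Pi.add_apply]
  split_ifs <;> ring

lemma lk_smul (k : ℕ) (c : F) (f : ℕ → ℕ → F) : lk q t k (c • f) = c • lk q t k f := by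
  funext i j
  simp only [Pi.smul_apply, smul_eq_mul]
  unfold lk
  simp only [Pi.smul_apply, smul_eq_mul]
  split_ifs <;> ring

/-- The `k`-th operator on the coordinates with indices below `N`. -/
def lkEnd (k : ℕ) : (Fin N → Fin N → F) →ₗ[F] (Fin N → Fin N → F) where
  toFun v i j := lk q t k (extd N v) i j
  map_add' v w := by
    have : extd N (v + w) = extd N v + extd N w := by
      funext a b; simp only [extd, Pi.add_apply]; split_ifs <;> simp
    funext i j
    rw [this, lk_add]; rfl
  map_smul' c v := by
    have : extd N (c • v) = c • extd N v := by
      funext a b; simp only [extd, Pi.smul_apply]; split_ifs <;> simp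
    funext i j
    rw [this, lk_smul]; rfl

/-- Restriction to the coordinates with indices below `N`. -/
def res (f : ℕ → ℕ → F) : Fin N → Fin N → F := fun i j => f i j

variable {N}

lemma lk_congr {k : ℕ} (hk : k + 1 < N) {f g : ℕ → ℕ → F}
    (h : ∀ i j, i < N → j < N → f i j = g i j) {i j : ℕ} (hi : i < N) (hj : j < N) :
    lk q t k f i j = lk q t k g i j := by
  unfold lk
  rw [h i j hi hj, h k (k + 1) (by omega) hk, h (k + 1) j hk hj, h k j (by omega) hj,
    h i k hi (by omega), h i (k + 1) hi hk]

lemma lkEnd_res {k : ℕ} (hk : k + 1 < N) (f : ℕ → ℕ → F) :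
    lkEnd q t N k (res N f) = res N (lk q t k f) := by
  funext i j
  exact lk_congr q t hk (fun a b ha hb => by simp [extd, ha, hb, res]) i.2 j.2

lemma exists_res (v : Fin N → Fin N → F) : ∃ f, res N f = v :=
  ⟨extd N v, by funext i j; simp [res, extd]⟩

variable {q t}

lemma lkEnd_injective {k : ℕ} (hk : k + 1 < N) (hq : q ≠ 0) (ht : t ≠ 0) :
    Function.Injective (lkEnd q t N k) := by
  rw [injective_iff_map_eq_zero]
  intro v hv
  obtain ⟨f, rfl⟩ := exists_res v
  rw [lkEnd_res q t hk] at hv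
  have h : ∀ i j, i < N → j < N → lk q t k f i j = 0 := fun i j hi hj =>
    congrFun (congrFun hv ⟨i, hi⟩) ⟨j, hj⟩
  have h0 : f k (k + 1) = 0 := by
    have := h k (k + 1) (by omega) hk
    rw [lk_simple _ _ _ _ rfl rfl] at this
    simpa [hq, ht] using this
  have hl : ∀ j, j < N → k + 1 < j → f (k + 1) j = 0 := fun j hj hkj => by
    have := h k j (by omega) hj
    rw [lk_left _ _ _ _ rfl hkj, h0] at this
    simpa [hq] using this
  have hr : ∀ i, i < k → f i k = 0 := fun i hi => by
    have := h i (k + 1) (by omega) hk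
    rw [lk_right_succ _ _ _ _ hi rfl, h0] at this
    simpa using this
  funext ⟨i, hi⟩ ⟨j, hj⟩
  show f i j = 0
  have hij := h i j hi hj
  rcases (show (j ≤ i ∨ k + 1 < i ∨ j < k) ∨ (i = k ∧ j = k + 1) ∨ (i = k ∧ k + 1 < j) ∨
    (i = k + 1 ∧ k + 1 < j) ∨ (i < k ∧ j = k) ∨ (i < k ∧ j = k + 1) ∨ (i < k ∧ k + 1 < j)
    by omega) with c | ⟨rfl, rfl⟩ | ⟨rfl, c⟩ | ⟨rfl, c⟩ | ⟨c, rfl⟩ | ⟨c, rfl⟩ | ⟨c, c'⟩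
  · rwa [lk_far _ _ _ _ c] at hij
  · exact h0
  · have := h (i + 1) j hk hj
    rw [lk_left_succ _ _ _ _ rfl c, hl j hj c] at this
    simpa using this
  · exact hl j hj c
  · exact hr i c
  · have := h i k hi (by omega)
    rw [lk_right _ _ _ _ c rfl, hr i c] at this
    simpa [hq] using this
  · rw [lk_around _ _ _ _ c c', h0] at hij
    simpa using hij

/-- The invertible operator of the `k`-th generator. -/
noncomputable def lkUnit (q t : F) (N k : ℕ) : (Module.End F (Fin N → Fin N → F))ˣ :=
  open Classical in
  if h : IsUnit (lkEnd q t N k) then h.unit else 1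

lemma lkUnit_val {k : ℕ} (hk : k + 1 < N) (hq : q ≠ 0) (ht : t ≠ 0) :
    (lkUnit q t N k : Module.End F (Fin N → Fin N → F)) = lkEnd q t N k := by
  have h : IsUnit (lkEnd q t N k) := by
    rw [Module.End.isUnit_iff]
    exact ⟨lkEnd_injective hk hq ht,
      LinearMap.injective_iff_surjective.1 (lkEnd_injective hk hq ht)⟩
  rw [lkUnit, dif_pos h, IsUnit.unit_spec]

lemma isBraided_lkUnit {n : ℕ} (hq : q ≠ 0) (ht : t ≠ 0) :
    IsBraided n (lkUnit q t (n + 1)) := by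
  constructor
  · intro i hi
    apply Units.ext
    simp only [Units.val_mul]
    rw [lkUnit_val (by omega) hq ht, lkUnit_val (by omega) hq ht]
    refine LinearMap.ext fun v => ?_
    obtain ⟨f, rfl⟩ := exists_res v
    simp (disch := omega) only [Module.End.mul_apply, lkEnd_res, lk_braid]
  · intro i j hij hj
    apply Units.ext
    simp only [Units.val_mul]
    rw [lkUnit_val (by omega) hq ht, lkUnit_val (by omega) hq ht]
    refine LinearMap.ext fun v => ?_
    obtain ⟨f, rfl⟩ := exists_res v
    simp (disch := omega) only [Module.End.mul_apply, lkEnd_res]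
    rw [lk_comm q t hij]

lemma lift_lkUnit_wd {n : ℕ} (hq : q ≠ 0) (ht : t ≠ 0) (w : List ℕ) (hw : ∀ a ∈ w, a < n)
    (f : ℕ → ℕ → F) :
    (Br.lift _ (isBraided_lkUnit (n := n) hq ht) (wd n w) : Module.End F _) (res (n + 1) f) =
      res (n + 1) (lkw q t w f) := by
  induction w with
  | nil => simp
  | cons a w ih =>
    have ha : a < n := hw a (by simp)
    rw [wd_cons, map_mul, Units.val_mul, Module.End.mul_apply, ih fun b hb => hw b (by simp [hb]),
      Br.lift_sg _ _ ha, lkUnit_val (by omega) hq ht, lkEnd_res _ _ (by omega), lkw_cons]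

end linear

lemma exists_transcendental : ∃ τ : ℂ, Transcendental ℚ τ := by
  by_contra! h
  refine not_countable_complex ((Algebraic.countable ℚ ℂ).mono fun x _ => ?_)
  simpa [Transcendental] using h x

/-- Braid groups are linear. -/
theorem exists_faithful_end (n : ℕ) : ∃ (ρ : Br n →* (Module.End ℂ (Fin (n+1) → Fin (n+1) → ℂ))ˣ),
    Function.Injective ρ := by
  obtain ⟨τ, hτ⟩ := exists_transcendental
  have ht : τ ≠ 0 := fun h => hτ (h ▸ isAlgebraic_zero)
  have hq : (1 / 2 : ℂ) ≠ 0 := by norm_num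
  set ρ := Br.lift _ (isBraided_lkUnit (n := n) hq ht) with hρ
  have key : ∀ (v w : List ℕ), (∀ a ∈ v, a < n) → (∀ a ∈ w, a < n) → ρ (wd n v) = ρ (wd n w) →
      ∀ s < n, lkw (1 / 2 : ℚ) 0 v (fun _ _ => 1) s (s + 1) =
        lkw (1 / 2 : ℚ) 0 w (fun _ _ => 1) s (s + 1) := by
    intro v w hv hw h s hs
    have e : lkw (1 / 2 : ℂ) τ v (fun _ _ => 1) s (s + 1) =
        lkw (1 / 2 : ℂ) τ w (fun _ _ => 1) s (s + 1) := by
      have h1 := lift_lkUnit_wd hq ht v hv (fun _ _ => 1)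
      rw [← hρ, h, hρ, lift_lkUnit_wd hq ht w hw] at h1
      exact (congrFun (congrFun h1 ⟨s, by omega⟩) ⟨s + 1, by omega⟩).symm
    have hP : ∀ u, lkw (1 / 2 : ℂ) τ u (fun _ _ => 1) s (s + 1) =
        aeval τ (lkw (C (1 / 2 : ℚ)) X u (fun _ _ => 1) s (s + 1)) := by
      intro u
      have := map_lkw (C (1 / 2 : ℚ)) X (aeval τ : ℚ[X] →ₐ[ℚ] ℂ).toRingHom u (fun _ _ => 1)
      simp only [AlgHom.toRingHom_eq_coe, RingHom.coe_coe, aeval_C, aeval_X, map_one] at this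
      rw [← congrFun (congrFun this s) (s + 1)]
      norm_num
    have h0 : ∀ u, lkw (1 / 2 : ℚ) 0 u (fun _ _ => 1) s (s + 1) =
        (lkw (C (1 / 2 : ℚ)) X u (fun _ _ => 1) s (s + 1)).eval 0 := by
      intro u
      have := map_lkw (C (1 / 2 : ℚ)) X (evalRingHom 0) u (fun _ _ => 1)
      simp only [coe_evalRingHom, eval_C, eval_X, eval_one] at this
      rw [this]
    rw [hP, hP] at e
    rw [h0, h0, (transcendental_iff_injective.1 hτ) e]
  have pos : ∀ (l : ℕ) (v w : List ℕ), v.length + w.length = l → (∀ a ∈ v, a < n) →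
      (∀ a ∈ w, a < n) → ρ (wd n v) = ρ (wd n w) → wd n v = wd n w := by
    intro l
    induction l using Nat.strong_induction_on with
    | _ l ih =>
    have main : ∀ (s : ℕ) (c w : List ℕ), (s :: c).length + w.length = l → (∀ a ∈ s :: c, a < n) →
      (∀ a ∈ w, a < n) → ρ (wd n (s :: c)) = ρ (wd n w) → wd n (s :: c) = wd n w := by
      intro s c w hl hv hw h
      have hs : s < n := hv s (by simp)
      have hz := key _ _ hv hw h s hs
      rw [lkw_cons, lk_simple _ _ _ _ rfl rfl, zero_mul, zero_mul] at hz
      obtain ⟨d, hd, hd', e⟩ := exists_left_divisor _ w rfl hw s hs hz.symm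
      rw [e.1, wd_cons, wd_cons, map_mul, map_mul] at h
      rw [e.1, wd_cons, wd_cons]
      congr 1
      simp only [List.length_cons] at hl
      exact ih (c.length + d.length) (by omega) c d rfl (fun a ha => hv a (by simp [ha])) hd'
        (mul_left_cancel h)
    intro v w hl hv hw h
    match v, w with
    | [], [] => rfl
    | s :: c, w => exact main s c w hl hv hw h
    | [], s :: c => exact (main s c [] (by simpa using hl) hw hv h.symm).symm
  refine ⟨ρ, (injective_iff_map_eq_one ρ).2 fun b hb => ?_⟩
  obtain ⟨N, w, hw, h⟩ := exists_zz_pow_mul_isPos b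
  obtain ⟨w', hw', h'⟩ := (show IsPos (zz n ^ N) from ((isPos_dl n).pow _).pow _)
  have := pos _ w w' rfl hw hw' (by rw [← h, ← h', map_mul, hb, mul_one])
  rwa [← h, ← h', mul_eq_left] at this

end BraidHol

namespace BraidHol

section holomorph
variable {G : Type*} [Group G]

/-- The holomorph of `G`. -/
abbrev Hol (G : Type*) [Group G] := G ⋊[MonoidHom.id (MulAut G)] MulAut G

/-- The affine action of the holomorph on `G`. -/
def affine (u : Hol G) (x : G) : G := u.left * u.right x

lemma affine_mul (u v : Hol G) (x : G) : affine (u * v) x = affine u (affine v x) := by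
  simp [affine, mul_assoc]

lemma affine_one (x : G) : affine (1 : Hol G) x = x := by simp [affine]

lemma eq_one_of_affine {u : Hol G} (h : ∀ x, affine u x = x) : u = 1 := by
  have h1 : u.left = 1 := by simpa [affine] using h 1
  refine SemidirectProduct.ext h1 (MulEquiv.ext fun x => ?_)
  simpa [affine, h1] using h x

/-- The permutation representation of the holomorph on functions. -/
def funRep (G : Type*) [Group G] : Hol G →* Module.End ℂ (G → ℂ) where
  toFun u := LinearMap.funLeft ℂ ℂ (affine u⁻¹)
  map_one' := by
    refine LinearMap.ext fun f => funext fun x => ?_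
    simp [LinearMap.funLeft_apply, affine_one]
  map_mul' u v := by
    refine LinearMap.ext fun f => funext fun x => ?_
    simp [LinearMap.funLeft_apply, affine_mul]

lemma funRep_apply (u : Hol G) (f : G → ℂ) (x : G) : funRep G u f x = f (affine u⁻¹ x) := rfl

variable {V : Type*} [AddCommGroup V] [Module ℂ V]
  (ρ : G →* Module.End ℂ V)

/-- The matrix coefficient of a linear form on endomorphisms. -/
def coeffMap : Module.Dual ℂ (Module.End ℂ V) →ₗ[ℂ] (G → ℂ) where
  toFun l := fun x => l (ρ x)
  map_add' _ _ := rfl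
  map_smul' _ _ := rfl

/-- The space of matrix coefficients. -/
def coeffs : Submodule ℂ (G → ℂ) := LinearMap.range (coeffMap ρ)

lemma mem_coeffs {f : G → ℂ} :
    f ∈ coeffs ρ ↔ ∃ l : Module.Dual ℂ (Module.End ℂ V), ∀ x, f x = l (ρ x) := by
  exact exists_congr fun l => ⟨fun h x => by rw [← h]; rfl, fun h => funext fun x => (h x).symm⟩

instance [FiniteDimensional ℂ V] : FiniteDimensional ℂ (coeffs ρ) := by unfold coeffs; infer_instance

lemma coeffs_translate {f : G → ℂ} (hf : f ∈ coeffs ρ) (g h : G) :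
    (fun x => f (g * x * h)) ∈ coeffs ρ := by
  obtain ⟨l, hl⟩ := (mem_coeffs ρ).1 hf
  refine (mem_coeffs ρ).2
    ⟨l ∘ₗ LinearMap.mulLeft ℂ (ρ g) ∘ₗ LinearMap.mulRight ℂ (ρ h), fun x => ?_⟩
  simp [hl, mul_assoc]

/-- The space of matrix coefficients of all the twists of `ρ`. -/
def twCoeffs : Submodule ℂ (G → ℂ) :=
  ⨆ φ : MulAut G, (coeffs ρ).map (LinearMap.funLeft ℂ ℂ φ)

lemma twCoeffs_finiteDimensional [FiniteDimensional ℂ V]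
    (hG : (MulAut.conj : G →* MulAut G).range.FiniteIndex) :
    FiniteDimensional ℂ (twCoeffs ρ) := by
  have : Finite (MulAut G ⧸ (MulAut.conj : G →* MulAut G).range) := inferInstance
  have h : twCoeffs ρ = ⨆ c : MulAut G ⧸ (MulAut.conj : G →* MulAut G).range,
      (coeffs ρ).map (LinearMap.funLeft ℂ ℂ c.out) := by
    refine le_antisymm (iSup_le fun φ => ?_) (iSup_le fun c => le_iSup_of_le c.out le_rfl)
    refine le_iSup_of_le (φ : MulAut G ⧸ (MulAut.conj : G →* MulAut G).range) ?_
    rintro _ ⟨f, hf, rfl⟩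
    set ψ := (φ : MulAut G ⧸ (MulAut.conj : G →* MulAut G).range).out with hψ
    obtain ⟨g, hg⟩ : ψ⁻¹ * φ ∈ (MulAut.conj : G →* MulAut G).range :=
      QuotientGroup.eq.1 (QuotientGroup.out_eq' _)
    have hφ : φ = ψ * MulAut.conj g := by rw [hg]; group
    refine ⟨_, coeffs_translate ρ hf (ψ g) (ψ g)⁻¹, ?_⟩
    funext x
    simp [LinearMap.funLeft_apply, hφ]
  rw [h]
  exact Submodule.finiteDimensional_iSup _

lemma funRep_twCoeffs (u : Hol G) {f : G → ℂ} (hf : f ∈ twCoeffs ρ) :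
    funRep G u f ∈ twCoeffs ρ := by
  suffices h : twCoeffs ρ ≤ (twCoeffs ρ).comap (funRep G u) from h hf
  refine iSup_le fun φ => ?_
  rintro _ ⟨f, hf, rfl⟩
  refine Submodule.mem_iSup_of_mem (φ * u⁻¹.right)
    ⟨_, coeffs_translate ρ hf (φ u⁻¹.left) 1, ?_⟩
  funext x
  simp only [LinearMap.funLeft_apply, funRep_apply, affine, map_mul, mul_one, MulAut.mul_apply]

/-- The holomorph acts on the space of matrix coefficients of all the twists. -/
def holRep : Hol G →* Module.End ℂ (twCoeffs ρ) where
  toFun u := (funRep G u).restrict fun _ => funRep_twCoeffs ρ u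
  map_one' := by ext; simp
  map_mul' u v := by
    refine LinearMap.ext fun f => Subtype.ext ?_
    simp

lemma holRep_injective (hρ : Function.Injective ρ) : Function.Injective (holRep ρ) := by
  rw [injective_iff_map_eq_one]
  intro u hu
  rw [← inv_eq_one]
  refine eq_one_of_affine fun x => hρ ?_
  rw [← sub_eq_zero, ← Module.forall_dual_apply_eq_zero_iff ℂ]
  intro l
  have hf : (fun x => l (ρ x)) ∈ twCoeffs ρ :=
    Submodule.mem_iSup_of_mem 1 ⟨_, (mem_coeffs ρ).2 ⟨l, fun _ => rfl⟩, rfl⟩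
  have := congrArg (fun T : Module.End ℂ (twCoeffs ρ) => (T ⟨_, hf⟩ : G → ℂ) x) hu
  rw [map_sub, sub_eq_zero]
  exact this

/-- If `G` is linear and `Out G` is finite, then the holomorph of `G` is linear. -/
theorem holomorph_linear [FiniteDimensional ℂ V]
    (hG : (MulAut.conj : G →* MulAut G).range.FiniteIndex)
    (hρ : Function.Injective ρ) :
    ∃ (m : ℕ) (_ : 0 < m) (r : Hol G →* GL (Fin m) ℂ), Function.Injective r := by
  have := twCoeffs_finiteDimensional ρ hG
  let b := Module.finBasis ℂ (twCoeffs ρ)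
  let r : Hol G →* GL (Fin (Module.finrank ℂ (twCoeffs ρ))) ℂ :=
    (Units.map ((LinearMap.toMatrixAlgEquiv b : _ →* _))).comp (holRep ρ).toHomUnits
  have hr : Function.Injective r := by
    intro u v h
    refine holRep_injective ρ hρ ?_
    have := congrArg Units.val h
    exact (LinearMap.toMatrixAlgEquiv b).injective this
  rcases Nat.eq_zero_or_pos (Module.finrank ℂ (twCoeffs ρ)) with h0 | h0
  · have : Subsingleton (Hol G) := by
      refine ⟨fun u v => holRep_injective ρ hρ ?_⟩
      have : Subsingleton (twCoeffs ρ) := Module.finrank_zero_iff.1 h0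
      exact Subsingleton.elim _ _
    exact ⟨1, one_pos, 1, fun u v _ => Subsingleton.elim u v⟩
  · exact ⟨_, h0, r, hr⟩

end holomorph
end BraidHol

namespace BraidHol

/-- The free group on `m` letters. -/
abbrev FG (m : ℕ) := FreeGroup (Fin m)

/-- The letters, extended by `1` outside the range. -/
def xg (m i : ℕ) : FG m := if h : i < m then FreeGroup.of ⟨i, h⟩ else 1

lemma xg_of_lt {m i : ℕ} (h : i < m) : xg m i = FreeGroup.of ⟨i, h⟩ := dif_pos h

section lift
variable {G : Type*} [Group G] {m : ℕ}

/-- The homomorphism given by the images of the letters. -/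
def FG.lift (m : ℕ) (f : ℕ → G) : FG m →* G := FreeGroup.lift fun i => f i

@[simp] lemma FG.lift_xg (f : ℕ → G) {i : ℕ} (h : i < m) : FG.lift m f (xg m i) = f i := by
  rw [xg_of_lt h, FG.lift, FreeGroup.lift_apply_of]

lemma FG.hom_ext {φ ψ : FG m →* G} (h : ∀ i < m, φ (xg m i) = ψ (xg m i)) : φ = ψ := by
  refine FreeGroup.ext_hom _ _ fun i => ?_
  have := h i i.2
  rwa [xg_of_lt i.2] at this

end lift

/-- The Artin endomorphism of the `i`-th generator. -/
def artFun (m i : ℕ) : FG m →* FG m := FG.lift m fun j =>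
  if j = i then xg m (i + 1)
  else if j = i + 1 then (xg m (i + 1))⁻¹ * xg m i * xg m (i + 1)
  else xg m j

/-- The inverse of the Artin endomorphism. -/
def artInv (m i : ℕ) : FG m →* FG m := FG.lift m fun j =>
  if j = i then xg m i * xg m (i + 1) * (xg m i)⁻¹
  else if j = i + 1 then xg m i
  else xg m j

lemma artFun_self {m i : ℕ} (h : i + 1 < m) : artFun m i (xg m i) = xg m (i + 1) := by
  rw [artFun, FG.lift_xg _ (by omega), if_pos rfl]

lemma artFun_succ {m i : ℕ} (h : i + 1 < m) :
    artFun m i (xg m (i + 1)) = (xg m (i + 1))⁻¹ * xg m i * xg m (i + 1) := by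
  rw [artFun, FG.lift_xg _ h, if_neg (by omega), if_pos rfl]

lemma artFun_of_ne {m i j : ℕ} (hj : j < m) (h : j ≠ i) (h' : j ≠ i + 1) :
    artFun m i (xg m j) = xg m j := by
  rw [artFun, FG.lift_xg _ hj, if_neg h, if_neg h']

lemma artInv_self {m i : ℕ} (h : i + 1 < m) :
    artInv m i (xg m i) = xg m i * xg m (i + 1) * (xg m i)⁻¹ := by
  rw [artInv, FG.lift_xg _ (by omega), if_pos rfl]

lemma artInv_succ {m i : ℕ} (h : i + 1 < m) : artInv m i (xg m (i + 1)) = xg m i := by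
  rw [artInv, FG.lift_xg _ h, if_neg (by omega), if_pos rfl]

lemma artInv_of_ne {m i j : ℕ} (hj : j < m) (h : j ≠ i) (hji : j ≠ i + 1) :
    artInv m i (xg m j) = xg m j := by
  rw [artInv, FG.lift_xg _ hj, if_neg h, if_neg hji]

/-- The Artin automorphism. -/
def artAut (m i : ℕ) : MulAut (FG m) :=
  if h : i + 1 < m then
    MonoidHom.toMulEquiv (artFun m i) (artInv m i)
      (FG.hom_ext fun j hj => by
        simp only [MonoidHom.comp_apply, MonoidHom.id_apply]
        rcases (show j = i ∨ j = i + 1 ∨ (j ≠ i ∧ j ≠ i + 1) by omega) with rfl | rfl | ⟨h1, h2⟩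
        · rw [artFun_self h, artInv_succ h]
        · rw [artFun_succ h, map_mul, map_mul, map_inv, artInv_succ h, artInv_self h]; group
        · rw [artFun_of_ne hj h1 h2, artInv_of_ne hj h1 h2])
      (FG.hom_ext fun j hj => by
        simp only [MonoidHom.comp_apply, MonoidHom.id_apply]
        rcases (show j = i ∨ j = i + 1 ∨ (j ≠ i ∧ j ≠ i + 1) by omega) with rfl | rfl | ⟨h1, h2⟩
        · rw [artInv_self h, map_mul, map_mul, map_inv, artFun_succ h, artFun_self h]; group
        · rw [artInv_succ h, artFun_self h]
        · rw [artInv_of_ne hj h1 h2, artFun_of_ne hj h1 h2])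
  else 1

lemma artAut_apply {m i : ℕ} (h : i + 1 < m) (f : FG m) : artAut m i f = artFun m i f := by
  rw [artAut, dif_pos h]; rfl

lemma FG.mulAut_ext {m : ℕ} {φ ψ : MulAut (FG m)} (h : ∀ i < m, φ (xg m i) = ψ (xg m i)) :
    φ = ψ :=
  MulEquiv.toMonoidHom_injective (FG.hom_ext h)

lemma isBraided_artAut (k : ℕ) : IsBraided k (artAut (k + 1)) := by
  constructor
  · intro i hi
    refine FG.mulAut_ext fun j hj => ?_
    simp (disch := omega) only [MulAut.mul_apply, artAut_apply]
    rcases (show j = i ∨ j = i + 1 ∨ j = i + 1 + 1 ∨ (j ≠ i ∧ j ≠ i + 1 ∧ j ≠ i + 1 + 1) by omega)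
      with rfl | rfl | rfl | ⟨h1, h2, h3⟩
    all_goals
      simp (disch := omega) only [artFun_self, artFun_succ, artFun_of_ne, map_mul, map_inv]
      try group
  · intro i l hil hl
    refine FG.mulAut_ext fun j hj => ?_
    simp (disch := omega) only [MulAut.mul_apply, artAut_apply]
    rcases (show j = i ∨ j = i + 1 ∨ j = l ∨ j = l + 1 ∨
      (j ≠ i ∧ j ≠ i + 1 ∧ j ≠ l ∧ j ≠ l + 1) by omega)
      with rfl | rfl | rfl | rfl | ⟨h1, h2, h3, h4⟩
    all_goals
      simp (disch := omega) only [artFun_self, artFun_succ, artFun_of_ne, map_mul, map_inv]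

/-- The Artin action of the braid group on the free group. -/
def art (k : ℕ) : Br k →* MulAut (FG (k + 1)) := Br.lift _ (isBraided_artAut k)

section art
variable {k i j : ℕ}

lemma art_sg (h : i < k) (f : FG (k + 1)) : art k (sg k i) f = artFun (k + 1) i f := by
  rw [art, Br.lift_sg _ _ h, artAut_apply (by omega)]

lemma art_self (h : i < k) : art k (sg k i) (xg (k + 1) i) = xg (k + 1) (i + 1) := by
  rw [art_sg h, artFun_self (by omega)]

lemma art_succ (h : i < k) : art k (sg k i) (xg (k + 1) (i + 1)) =
    (xg (k + 1) (i + 1))⁻¹ * xg (k + 1) i * xg (k + 1) (i + 1) := by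
  rw [art_sg h, artFun_succ (by omega)]

lemma art_of_ne (hi : i < k) (hj : j < k + 1) (h : j ≠ i) (h' : j ≠ i + 1) :
    art k (sg k i) (xg (k + 1) j) = xg (k + 1) j := by
  rw [art_sg hi, artFun_of_ne hj h h']

end art

/-- The semidirect product of the free group and the braid group. -/
abbrev Gam (k : ℕ) := FG (k + 1) ⋊[art k] Br k

/-- The image of a letter. -/
def gx (k i : ℕ) : Gam k := SemidirectProduct.inl (xg (k + 1) i)

/-- The image of a standard generator. -/
def gs (k i : ℕ) : Gam k := SemidirectProduct.inr (sg k i)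

section Gam
variable {k : ℕ}

lemma inr_mul_inl (b : Br k) (f : FG (k + 1)) :
    (SemidirectProduct.inr b * SemidirectProduct.inl f : Gam k) =
      SemidirectProduct.inl (art k b f) * SemidirectProduct.inr b := by
  rw [SemidirectProduct.inl_aut]; simp

lemma gs_mul_gx {i : ℕ} (h : i < k) : gs k i * gx k i = gx k (i + 1) * gs k i := by
  rw [gs, gx, inr_mul_inl, art_self h]; rfl

lemma gs_mul_gx_succ {i : ℕ} (h : i < k) :
    gs k i * gx k (i + 1) = (gx k (i + 1))⁻¹ * gx k i * gx k (i + 1) * gs k i := by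
  rw [gs, gx, inr_mul_inl, art_succ h]; simp [gx]

lemma gs_comm_gx {i j : ℕ} (hj : j < k + 1) (h : j ≠ i) (h' : j ≠ i + 1) :
    gs k i * gx k j = gx k j * gs k i := by
  by_cases hi : i < k
  · rw [gs, gx, inr_mul_inl, art_of_ne hi hj h h']
  · simp [gs, sg_of_le (not_lt.mp hi)]

lemma gs_braid {i : ℕ} (h : i + 1 < k) :
    gs k i * gs k (i + 1) * gs k i = gs k (i + 1) * gs k i * gs k (i + 1) := by
  simp only [gs, ← map_mul, sg_braid h]

lemma gs_comm {i j : ℕ} (h : i + 2 ≤ j) : gs k i * gs k j = gs k j * gs k i := by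
  simp only [gs, ← map_mul, (sg_comm h).eq]

lemma Gam.hom_ext {G : Type*} [Group G] {φ ψ : Gam k →* G} (hx : ∀ i < k + 1, φ (gx k i) = ψ (gx k i))
    (hs : ∀ i < k, φ (gs k i) = ψ (gs k i)) : φ = ψ :=
  SemidirectProduct.hom_ext (FG.hom_ext hx) (Br.hom_ext hs)

end Gam

lemma isBraided_swap (k : ℕ) : IsBraided k fun i => Equiv.swap i (i + 1) := by
  constructor
  · intro i _
    ext j
    simp only [Equiv.Perm.coe_mul, Function.comp_apply, Equiv.swap_apply_def]
    split_ifs <;> omega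
  · intro i l hil _
    ext j
    simp only [Equiv.Perm.coe_mul, Function.comp_apply, Equiv.swap_apply_def]
    split_ifs <;> omega

/-- The permutation of a braid. -/
def prm (k : ℕ) : Br k →* Equiv.Perm ℕ := Br.lift _ (isBraided_swap k)

lemma prm_sg {k i : ℕ} (h : i < k) : prm k (sg k i) = Equiv.swap i (i + 1) := Br.lift_sg _ _ h

lemma prm_sg_self {k i : ℕ} (h : i < k) : prm k (sg k i) i = i + 1 := by simp [prm_sg h]

lemma prm_sg_succ {k i : ℕ} (h : i < k) : prm k (sg k i) (i + 1) = i := by simp [prm_sg h]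

lemma prm_sg_of_ne {k i j : ℕ} (h : i < k) (h1 : j ≠ i) (h2 : j ≠ i + 1) :
    prm k (sg k i) j = j := by
  rw [prm_sg h, Equiv.swap_apply_of_ne_of_ne h1 h2]

lemma prm_le {k : ℕ} (b : Br k) {i : ℕ} : i ≤ k → prm k b i ≤ k := by
  induction b using Br.induction generalizing i with
  | one => simp
  | mul j hj c ih =>
    intro hi
    have := ih hi
    rw [map_mul, Equiv.Perm.mul_apply, prm_sg hj, Equiv.swap_apply_def]
    split_ifs <;> omega
  | inv j hj c ih =>
    intro hi
    have := ih hi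
    rw [map_mul, Equiv.Perm.mul_apply, map_inv, prm_sg hj, Equiv.swap_inv, Equiv.swap_apply_def]
    split_ifs <;> omega

lemma prm_of_gt {k : ℕ} (b : Br k) {i : ℕ} (hi : k < i) : prm k b i = i := by
  induction b using Br.induction with
  | one => simp
  | mul j hj c ih =>
    rw [map_mul, Equiv.Perm.mul_apply, ih, prm_sg_of_ne hj (by omega) (by omega)]
  | inv j hj c ih =>
    rw [map_mul, Equiv.Perm.mul_apply, ih, map_inv, prm_sg hj, Equiv.swap_inv,
      Equiv.swap_apply_of_ne_of_ne (by omega) (by omega)]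

/-- The values of the strand cocycle on the generators. -/
def cocGen (k j i : ℕ) : Gam k :=
  if k + 1 < i then 1 else if i < j then gs k (j - 1) else if i = j then 1
  else if i = j + 1 then gx k j else gs k j

section cocGen
variable {k j i : ℕ}

lemma cocGen_gt (h : k + 1 < i) : cocGen k j i = 1 := if_pos h

lemma cocGen_lt (h : i < j) (h' : j ≤ k + 1) : cocGen k j i = gs k (j - 1) := by
  unfold cocGen; split_ifs <;> first | omega | rfl

lemma cocGen_self (h : j ≤ k + 1) : cocGen k j j = 1 := by
  unfold cocGen; split_ifs <;> first | omega | rfl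

lemma cocGen_succ (h : j ≤ k) : cocGen k j (j + 1) = gx k j := by
  unfold cocGen; split_ifs <;> first | omega | rfl

lemma cocGen_above (h : j + 1 < i) (h' : i ≤ k + 1) : cocGen k j i = gs k j := by
  unfold cocGen; split_ifs <;> first | omega | rfl

end cocGen

/-- The permutation of `Gam k × ℕ` of a generator. -/
def cocPerm (k j : ℕ) : Equiv.Perm (Gam k × ℕ) where
  toFun p := (cocGen k j p.2 * p.1, Equiv.swap j (j + 1) p.2)
  invFun p := ((cocGen k j (Equiv.swap j (j + 1) p.2))⁻¹ * p.1, Equiv.swap j (j + 1) p.2)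
  left_inv p := by simp
  right_inv p := by simp

lemma cocPerm_apply (k j : ℕ) (γ : Gam k) (i : ℕ) :
    cocPerm k j (γ, i) = (cocGen k j i * γ, Equiv.swap j (j + 1) i) := rfl

lemma isBraided_cocPerm (k : ℕ) : IsBraided (k + 1) (cocPerm k) := by
  constructor
  · intro j hj
    refine Equiv.ext fun ⟨γ, i⟩ => ?_
    simp only [Equiv.Perm.mul_apply, cocPerm_apply]
    refine Prod.ext ?_ (Equiv.congr_fun ((isBraided_swap (k + 1)).braid j hj) i)
    rcases (show k + 1 < i ∨ (i ≤ k + 1 ∧ (i < j ∨ i = j ∨ i = j + 1 ∨ i = j + 1 + 1 ∨ j + 2 < i))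
      by omega) with h | ⟨hi, h | rfl | rfl | rfl | h⟩
    · simp (disch := omega) only [Equiv.swap_apply_of_ne_of_ne, cocGen_gt]
    · obtain ⟨d, rfl⟩ : ∃ d, j = d + 1 := ⟨j - 1, by omega⟩
      simp (disch := omega) only [Equiv.swap_apply_of_ne_of_ne, cocGen_lt, ← mul_assoc,
        Nat.add_sub_cancel, gs_braid]
    · simp (disch := omega) only [Equiv.swap_apply_of_ne_of_ne, cocGen_lt, cocGen_self, cocGen_above,
        Equiv.swap_apply_left, one_mul, Nat.add_sub_cancel]
    · simp (disch := omega) only [Equiv.swap_apply_of_ne_of_ne, cocGen_lt, cocGen_self, cocGen_above,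
        cocGen_succ, Equiv.swap_apply_left, Equiv.swap_apply_right, one_mul, Nat.add_sub_cancel]
      rw [← mul_assoc, gs_mul_gx (by omega), mul_assoc]
    · simp (disch := omega) only [Equiv.swap_apply_of_ne_of_ne, cocGen_lt, cocGen_above,
        cocGen_succ, Equiv.swap_apply_right, Nat.add_sub_cancel]
      simp only [← mul_assoc]
      rw [gs_mul_gx (by omega), mul_assoc (gx k (j + 1)), gs_mul_gx_succ (by omega)]
      group
    · simp (disch := omega) only [Equiv.swap_apply_of_ne_of_ne, cocGen_above, ← mul_assoc, gs_braid]
  · intro a b hab hb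
    refine Equiv.ext fun ⟨γ, i⟩ => ?_
    simp only [Equiv.Perm.mul_apply, cocPerm_apply]
    refine Prod.ext ?_ (Equiv.congr_fun ((isBraided_swap (k + 1)).comm a b hab hb) i)
    obtain ⟨d, rfl⟩ : ∃ d, b = d + 1 := ⟨b - 1, by omega⟩
    rcases (show k + 1 < i ∨ (i ≤ k + 1 ∧ (i < a ∨ i = a ∨ i = a + 1 ∨ (a + 1 < i ∧ i < d + 1) ∨
      i = d + 1 ∨ i = d + 1 + 1 ∨ d + 2 < i)) by omega) with
      h | ⟨hi, h | rfl | rfl | ⟨h, h'⟩ | rfl | rfl | h⟩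
    · simp (disch := omega) only [Equiv.swap_apply_of_ne_of_ne, cocGen_gt]
    · obtain ⟨e, rfl⟩ : ∃ d, a = d + 1 := ⟨a - 1, by omega⟩
      simp (disch := omega) only [Equiv.swap_apply_of_ne_of_ne, cocGen_lt, ← mul_assoc,
        Nat.add_sub_cancel]
      rw [gs_comm (by omega)]
    all_goals
      simp (disch := omega) only [Equiv.swap_apply_of_ne_of_ne, cocGen_lt, cocGen_self, cocGen_above,
        cocGen_succ, Equiv.swap_apply_left, Equiv.swap_apply_right, one_mul, Nat.add_sub_cancel,
        ← mul_assoc]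
    · rw [gs_comm_gx (by omega) (by omega) (by omega)]
    · rw [gs_comm (by omega)]
    · rw [gs_comm_gx (by omega) (by omega) (by omega)]
    · rw [gs_comm (by omega)]

/-- The action of the braid group on `Gam k × ℕ`. -/
def cocAct (k : ℕ) : Br (k + 1) →* Equiv.Perm (Gam k × ℕ) := Br.lift _ (isBraided_cocPerm k)

/-- The strand cocycle. -/
def coc (k : ℕ) (b : Br (k + 1)) (i : ℕ) : Gam k := (cocAct k b (1, i)).1

lemma cocAct_apply {k : ℕ} (b : Br (k + 1)) (γ : Gam k) (i : ℕ) :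
    cocAct k b (γ, i) = (coc k b i * γ, prm (k + 1) b i) := by
  have key : ∀ γ : Gam k, cocAct k b (γ, i) = ((cocAct k b (1, i)).1 * γ, prm (k + 1) b i) := by
    induction b using Br.induction with
    | one => intro γ; simp
    | mul j hj c ih =>
      intro γ
      rw [map_mul, map_mul, Equiv.Perm.mul_apply, Equiv.Perm.mul_apply, Equiv.Perm.mul_apply,
        ih γ, ih 1, cocAct, Br.lift_sg _ _ hj, cocPerm_apply, cocPerm_apply, prm_sg hj]
      simp [mul_assoc]
    | inv j hj c ih =>
      intro γ
      rw [map_mul, map_mul, Equiv.Perm.mul_apply, Equiv.Perm.mul_apply, Equiv.Perm.mul_apply,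
        ih γ, ih 1, cocAct, map_inv, map_inv, Br.lift_sg _ _ hj, prm_sg hj]
      simp [cocPerm, Equiv.Perm.inv_def, mul_assoc]
  exact key γ

lemma coc_mul {k : ℕ} (b c : Br (k + 1)) (i : ℕ) :
    coc k (b * c) i = coc k b (prm (k + 1) c i) * coc k c i := by
  rw [coc, map_mul, Equiv.Perm.mul_apply, cocAct_apply, cocAct_apply, mul_one]

@[simp] lemma coc_one {k i : ℕ} : coc k 1 i = 1 := by simp [coc]

lemma coc_sg {k i j : ℕ} (hj : j < k + 1) : coc k (sg (k + 1) j) i = cocGen k j i := by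
  rw [coc, cocAct, Br.lift_sg _ _ hj, cocPerm_apply, mul_one]

end BraidHol

namespace BraidHol

section groupId
variable {G : Type*} [Group G] {a b y : G}

lemma conj_sq_of_braid (h : a * b * a = b * a * b) : a⁻¹ * b ^ 2 * a = b * a ^ 2 * b⁻¹ := by
  have h1 : a⁻¹ * b * a = b * a * b⁻¹ := by
    rw [eq_mul_inv_iff_mul_eq, mul_assoc, mul_assoc, inv_mul_eq_iff_eq_mul]; simp only [← mul_assoc, h]
  calc a⁻¹ * b ^ 2 * a = (a⁻¹ * b * a) * (a⁻¹ * b * a) := by simp [pow_two, mul_assoc]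
    _ = b * a ^ 2 * b⁻¹ := by rw [h1]; simp [pow_two, mul_assoc]

lemma braid_conj (h : a * b * a = b * a * b) : b * a * b * a⁻¹ * b⁻¹ = a := by
  rw [mul_inv_eq_iff_eq_mul, mul_inv_eq_iff_eq_mul, ← h]

lemma sq_swap_step (h : a * b * a = b * a * b) (hay : Commute a y)
    (hy : (b * y) ^ 2 = (y * b) ^ 2) :
    (a * (b⁻¹ * y * b)) ^ 2 = ((b⁻¹ * y * b) * a) ^ 2 := by
  have h1 : b * a * b⁻¹ = a⁻¹ * b * a := by
    rw [mul_inv_eq_iff_eq_mul, mul_assoc, mul_assoc, eq_inv_mul_iff_mul_eq]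
    simp only [← mul_assoc, h]
  have h2 : a * b⁻¹ = b⁻¹ * (a⁻¹ * b * a) := by rw [← h1]; group
  have h3 : b * a = a⁻¹ * b * a * b := by rw [← h1]; group
  have e : b * y * b * y = y * b * y * b := by simpa [pow_two, mul_assoc] using hy
  have hay' : y * a = a * y := hay.eq.symm
  have hay'' : y * a⁻¹ = a⁻¹ * y := hay.inv_left.eq.symm
  calc (a * (b⁻¹ * y * b)) ^ 2 = (a * b⁻¹) * y * (b * a * b⁻¹) * y * b := by rw [pow_two]; group
    _ = b⁻¹ * a⁻¹ * b * (a * (y * a⁻¹) * b * (a * y)) * b := by rw [h2, h1]; group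
    _ = b⁻¹ * a⁻¹ * (b * y * b * y) * a * b := by rw [hay'', ← hay']; group
    _ = b⁻¹ * (a⁻¹ * y) * b * y * (b * a * b) := by rw [e]; group
    _ = b⁻¹ * y * a⁻¹ * b * (y * a) * b * a := by rw [← hay'', ← h]; group
    _ = b⁻¹ * y * (a⁻¹ * b * a) * y * b * a := by rw [hay']; group
    _ = _ := by rw [← h1, pow_two]; group

end groupId

/-- The image of the `(k-d)`-th letter in the braid group. -/
def xbAux (k : ℕ) : ℕ → Br (k + 1)
  | 0 => sg (k + 1) k ^ 2
  | d + 1 => (sg (k + 1) (k - (d + 1)))⁻¹ * xbAux k d * sg (k + 1) (k - (d + 1))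

/-- The image of the `j`-th letter in the braid group. -/
def xb (k j : ℕ) : Br (k + 1) := xbAux k (k - j)

/-- The coset representatives moving the last point. -/
def tbAux (k : ℕ) : ℕ → Br (k + 1)
  | 0 => 1
  | d + 1 => (sg (k + 1) (k - d))⁻¹ * tbAux k d

/-- The coset representatives. -/
def tb (k j : ℕ) : Br (k + 1) := tbAux k (k + 1 - j)

section xb
variable {k : ℕ}

lemma xb_last : xb k k = sg (k + 1) k ^ 2 := by simp [xb, xbAux]

lemma xb_eq {j : ℕ} (h : j < k) :
    xb k j = (sg (k + 1) j)⁻¹ * xb k (j + 1) * sg (k + 1) j := by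
  obtain ⟨d, rfl⟩ : ∃ d, k = j + 1 + d := ⟨k - (j + 1), by omega⟩
  rw [xb, xb, show j + 1 + d - j = d + 1 by omega, show j + 1 + d - (j + 1) = d by omega, xbAux,
    show j + 1 + d - (d + 1) = j by omega]

lemma tb_last : tb k (k + 1) = 1 := by simp [tb, tbAux]

lemma tb_eq {j : ℕ} (h : j ≤ k) : tb k j = (sg (k + 1) j)⁻¹ * tb k (j + 1) := by
  obtain ⟨d, rfl⟩ : ∃ d, k = j + d := ⟨k - j, by omega⟩
  rw [tb, tb, show j + d + 1 - j = d + 1 by omega, show j + d + 1 - (j + 1) = d by omega, tbAux,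
    show j + d - d = j by omega]

/-- Downward induction from `k`. -/
lemma down_induction {P : ℕ → Prop} (k : ℕ) (base : P k) (step : ∀ j < k, P (j + 1) → P j)
    {j : ℕ} (h : j ≤ k) : P j := by
  induction h using Nat.decreasingInduction with
  | of_succ j hj ih => exact step j hj ih
  | self => exact base

lemma sg_comm_xb_of_gt {i : ℕ} {j : ℕ} (hj : j ≤ k) (h : i + 1 < j) :
    Commute (sg (k + 1) i) (xb k j) := by
  revert h
  refine down_induction k (P := fun j => i + 1 < j → Commute (sg (k + 1) i) (xb k j)) ?_ ?_ hj
  · intro h; rw [xb_last]; exact (sg_comm (by omega)).pow_right 2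
  · intro j hj ih h
    rw [xb_eq hj]
    have h1 : Commute (sg (k + 1) i) (sg (k + 1) j) := sg_comm (by omega)
    exact (h1.inv_right.mul_right (ih (by omega))).mul_right h1

lemma sg_comm_xb_of_lt {i j : ℕ} (hi : i < k) (hj : j < i) :
    Commute (sg (k + 1) i) (xb k j) := by
  refine down_induction (i - 1) (P := fun j => Commute (sg (k + 1) i) (xb k j)) ?_ ?_
    (show j ≤ i - 1 by omega)
  · obtain ⟨d, rfl⟩ : ∃ d, i = d + 1 := ⟨i - 1, by omega⟩
    rw [Nat.add_sub_cancel, xb_eq (by omega), xb_eq (by omega)]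
    have hb := sg_braid (k := k + 1) (i := d) (by omega)
    have hc : Commute (sg (k + 1) d) (xb k (d + 1 + 1)) := sg_comm_xb_of_gt (by omega) (by omega)
    have e : sg (k + 1) (d + 1) * sg (k + 1) d * sg (k + 1) (d + 1) *
        (sg (k + 1) d)⁻¹ * (sg (k + 1) (d + 1))⁻¹ = sg (k + 1) d := braid_conj hb
    set a := sg (k + 1) d
    set b := sg (k + 1) (d + 1)
    set y := xb k (d + 1 + 1)
    have hc' : (b * a * b * a⁻¹ * b⁻¹) * y = y * (b * a * b * a⁻¹ * b⁻¹) := by rw [e]; exact hc.eq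
    have : (b * a * b) * (a⁻¹ * (b⁻¹ * y * b) * a) = y * (b * a * b) := by
      calc _ = (b * a * b * a⁻¹ * b⁻¹) * y * (b * a) := by group
        _ = _ := by rw [hc']; group
    change b * _ = _ * b
    have h2 : b = a⁻¹ * b⁻¹ * (b * a * b) := by group
    calc b * (a⁻¹ * (b⁻¹ * y * b) * a)
        = a⁻¹ * b⁻¹ * ((b * a * b) * (a⁻¹ * (b⁻¹ * y * b) * a)) := by group
      _ = _ := by rw [this]; group
  · intro j hj ih
    rw [xb_eq (by omega)]
    have h1 : Commute (sg (k + 1) i) (sg (k + 1) j) := (sg_comm (by omega)).symm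
    exact (h1.inv_right.mul_right ih).mul_right h1

lemma sg_xb_sq {i : ℕ} (hi : i < k) :
    (sg (k + 1) i * xb k (i + 1)) ^ 2 = (xb k (i + 1) * sg (k + 1) i) ^ 2 := by
  refine down_induction (k - 1) (P := fun i => (sg (k + 1) i * xb k (i + 1)) ^ 2 =
    (xb k (i + 1) * sg (k + 1) i) ^ 2) ?_ ?_ (show i ≤ k - 1 by omega)
  · obtain ⟨d, rfl⟩ : ∃ d, k = d + 1 := ⟨k - 1, by omega⟩
    rw [Nat.add_sub_cancel, xb_last]
    have hb := sg_braid (k := d + 1 + 1) (i := d) (by omega)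
    set a := sg (d + 1 + 1) d
    set b := sg (d + 1 + 1) (d + 1)
    calc (a * b ^ 2) ^ 2 = a * b * (b * a * b) * b := by simp only [pow_two]; group
      _ = a * b * (a * b * a) * b := by rw [hb]
      _ = (a * b * a) * (b * a * b) := by simp only [mul_assoc]
      _ = (b * a * b) * (a * b * a) := by rw [hb]
      _ = b * (a * b * a) * (b * a) := by simp only [mul_assoc]
      _ = _ := by rw [hb]; simp only [pow_two, mul_assoc]
  · intro i hi ih
    rw [xb_eq (show i + 1 < k by omega)]
    exact sq_swap_step (sg_braid (by omega)) (sg_comm_xb_of_gt (by omega) (by omega)) ih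

/-- The braid group acts on letters as conjugation does. -/
lemma lift_art {G : Type*} [Group G] (g : Br k →* G) (f : FG (k + 1) →* G)
    (H : ∀ i < k, ∀ j < k + 1,
      f (art k (sg k i) (xg (k + 1) j)) = g (sg k i) * f (xg (k + 1) j) * (g (sg k i))⁻¹)
    (b : Br k) : f.comp (art k b).toMonoidHom = (MulAut.conj (g b)).toMonoidHom.comp f := by
  have key : ∀ x, f (art k b x) = g b * f x * (g b)⁻¹ := by
    have base : ∀ i < k, ∀ x, f (art k (sg k i) x) = g (sg k i) * f x * (g (sg k i))⁻¹ := by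
      intro i hi x
      exact DFunLike.congr_fun (FG.hom_ext (φ := f.comp (art k (sg k i)).toMonoidHom)
        (ψ := (MulAut.conj (g (sg k i))).toMonoidHom.comp f) (H i hi)) x
    induction b using Br.induction with
    | one => simp
    | mul j hj c ih => intro x; rw [map_mul, MulAut.mul_apply, base j hj, ih, map_mul]; group
    | inv j hj c ih =>
      intro x
      have := base j hj ((art k (sg k j))⁻¹ (art k c x))
      rw [MulAut.apply_inv_self, ih] at this
      rw [map_mul, map_inv, MulAut.mul_apply, map_mul, map_inv]
      rw [eq_mul_inv_iff_mul_eq] at this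
      calc _ = (g (sg k j))⁻¹ * (g (sg k j) * f ((art k (sg k j))⁻¹ (art k c x)) *
              (g (sg k j))⁻¹) * g (sg k j) := by group
        _ = _ := by rw [← eq_mul_inv_iff_mul_eq.mpr this]; group
  exact MonoidHom.ext key

/-- The inclusion of the semidirect product in the braid group. -/
def iot (k : ℕ) : Gam k →* Br (k + 1) :=
  SemidirectProduct.lift (FG.lift (k + 1) (xb k))
    (Br.lift (k := k) (sg (k + 1))
      ⟨fun i h => (isBraided_sg (k + 1)).braid i (by omega),
        fun i j h h' => (isBraided_sg (k + 1)).comm i j h (by omega)⟩)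
    (by
      refine lift_art _ _ fun i hi j hj => ?_
      rw [Br.lift_sg _ _ hi, FG.lift_xg _ hj]
      rcases (show j = i ∨ j = i + 1 ∨ (j ≠ i ∧ j ≠ i + 1) by omega) with rfl | rfl | ⟨h1, h2⟩
      · rw [art_self hi, FG.lift_xg _ (by omega), xb_eq hi]; group
      · rw [art_succ hi, map_mul, map_mul, map_inv, FG.lift_xg _ (by omega),
          FG.lift_xg _ (by omega), xb_eq hi]
        have := sg_xb_sq hi
        set a := sg (k + 1) i
        set y := xb k (i + 1)
        have : a * y * a * y = y * a * y * a := by simpa [pow_two, mul_assoc] using this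
        rw [eq_mul_inv_iff_mul_eq]
        calc y⁻¹ * (a⁻¹ * y * a) * y * a = y⁻¹ * a⁻¹ * (y * a * y * a) := by group
          _ = _ := by rw [← this]; group
      · rw [art_of_ne hi hj h1 h2, FG.lift_xg _ hj, eq_mul_inv_iff_mul_eq]
        rcases (show i + 1 < j ∨ j < i by omega) with h | h
        · exact (sg_comm_xb_of_gt (by omega) h).eq.symm
        · exact (sg_comm_xb_of_lt hi h).eq.symm)

lemma iot_gx {j : ℕ} (h : j < k + 1) : iot k (gx k j) = xb k j := by
  rw [iot, gx, SemidirectProduct.lift_inl, FG.lift_xg _ h]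

lemma iot_gs {j : ℕ} (h : j < k) : iot k (gs k j) = sg (k + 1) j := by
  rw [iot, gs, SemidirectProduct.lift_inr, Br.lift_sg _ _ h]

lemma sg_comm_tb {i j : ℕ} (hi : i ≤ k + 1) (h : j + 2 ≤ i) :
    Commute (sg (k + 1) j) (tb k i) := by
  revert h
  refine down_induction (k + 1) (P := fun i => j + 2 ≤ i → Commute (sg (k + 1) j) (tb k i))
    ?_ ?_ hi
  · intro _; rw [tb_last]; exact Commute.one_right _
  · intro i hi ih h
    rw [tb_eq (by omega)]
    exact (sg_comm h).inv_right.mul_right (ih (by omega))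

lemma xb_eq_tb {j : ℕ} (h : j ≤ k) :
    xb k j = (tb k (j + 1))⁻¹ * sg (k + 1) j ^ 2 * tb k (j + 1) := by
  refine down_induction k (P := fun j => xb k j =
    (tb k (j + 1))⁻¹ * sg (k + 1) j ^ 2 * tb k (j + 1)) ?_ ?_ h
  · rw [tb_last, xb_last]; simp
  · intro j hj ih
    have hb := conj_sq_of_braid (sg_braid (k := k + 1) (i := j) (by omega))
    have h2 := sg_comm_tb (k := k) (i := j + 2) (j := j) (by omega) le_rfl
    rw [xb_eq hj, ih, tb_eq (show j + 1 ≤ k by omega)]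
    rw [show j + 1 + 1 = j + 2 from rfl] at *
    set a := sg (k + 1) j
    set b := sg (k + 1) (j + 1)
    set t := tb k (j + 2)
    calc a⁻¹ * (t⁻¹ * b ^ 2 * t) * a = a⁻¹ * t⁻¹ * b ^ 2 * (t * a) := by group
      _ = (a⁻¹ * t⁻¹) * b ^ 2 * a * t := by rw [h2.eq.symm]; group
      _ = t⁻¹ * (a⁻¹ * b ^ 2 * a) * t := by rw [h2.inv_left.inv_right.eq]; group
      _ = _ := by rw [hb]; group

lemma tb_conj_sg {i j : ℕ} (hj : j < k) (h : i ≤ j) :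
    (tb k i)⁻¹ * sg (k + 1) (j + 1) * tb k i = sg (k + 1) j := by
  refine down_induction j (P := fun i => (tb k i)⁻¹ * sg (k + 1) (j + 1) * tb k i = sg (k + 1) j)
    ?_ ?_ h
  · rw [tb_eq hj.le, tb_eq (by omega)]
    have hb := braid_conj (sg_braid (k := k + 1) (i := j) (by omega))
    have hc := (sg_comm_tb (k := k) (i := j + 1 + 1) (j := j) (by omega) le_rfl).eq
    set a := sg (k + 1) j
    set b := sg (k + 1) (j + 1)
    set t := tb k (j + 1 + 1)
    calc _ = t⁻¹ * (b * a * b * a⁻¹ * b⁻¹) * t := by group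
      _ = t⁻¹ * (a * t) := by rw [hb, mul_assoc]
      _ = a := by rw [hc]; group
  · intro i hi ih
    rw [tb_eq (by omega)]
    have hc := (sg_comm (k := k + 1) (i := i) (j := j + 1) (by omega)).eq
    calc _ = (tb k (i + 1))⁻¹ * (sg (k + 1) i * sg (k + 1) (j + 1)) *
          (sg (k + 1) i)⁻¹ * tb k (i + 1) := by group
      _ = _ := by rw [hc, ← ih]; group

lemma iot_coc_aux (b : Br (k + 1)) : ∀ i ≤ k + 1,
    tb k (prm (k + 1) b i) * iot k (coc k b i) = b * tb k i := by
  have base : ∀ j < k + 1, ∀ i ≤ k + 1, tb k (prm (k + 1) (sg (k + 1) j) i) *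
      iot k (coc k (sg (k + 1) j) i) = sg (k + 1) j * tb k i := by
    intro j hj i hi
    rw [coc_sg hj]
    rcases (show i < j ∨ i = j ∨ i = j + 1 ∨ j + 1 < i by omega) with h | rfl | rfl | h
    · obtain ⟨d, rfl⟩ : ∃ d, j = d + 1 := ⟨j - 1, by omega⟩
      rw [cocGen_lt h (by omega), prm_sg_of_ne hj (by omega) (by omega), Nat.add_sub_cancel,
        iot_gs (by omega), ← tb_conj_sg (i := i) (j := d) (by omega) (by omega)]
      group
    · rw [cocGen_self hi, prm_sg_self hj, tb_eq (j := i) (by omega)]; simp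
    · rw [cocGen_succ (by omega), prm_sg_succ hj, iot_gx hj, xb_eq_tb (by omega),
        tb_eq (by omega)]
      simp [pow_two, mul_assoc]
    · rw [cocGen_above h hi, prm_sg_of_ne hj (by omega) (by omega), iot_gs (by omega),
        (sg_comm_tb hi h).eq]
  induction b using Br.induction with
  | one => simp
  | mul j hj c ih =>
    intro i hi
    rw [coc_mul, map_mul, map_mul, Equiv.Perm.mul_apply, ← mul_assoc,
      base j hj _ (prm_le c hi), mul_assoc, ih i hi, mul_assoc]
  | inv j hj c ih =>
    intro i hi
    have h1 := base j hj (prm (k + 1) ((sg (k + 1) j)⁻¹ * c) i) (prm_le _ hi)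
    have h2 := coc_mul (sg (k + 1) j) ((sg (k + 1) j)⁻¹ * c) i
    rw [mul_inv_cancel_left] at h2
    rw [← Equiv.Perm.mul_apply, ← map_mul, mul_inv_cancel_left, ← eq_mul_inv_iff_mul_eq] at h1
    have h3 := ih i hi
    rw [h1, h2, map_mul (iot k)] at h3
    rw [mul_assoc, ← h3]
    simp only [mul_assoc, inv_mul_cancel_left]

/-- The stabilizer of the last point. -/
def stb (k : ℕ) : Subgroup (Br (k + 1)) where
  carrier := {b | prm (k + 1) b (k + 1) = k + 1}
  mul_mem' {a b} ha hb := by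
    simp only [Set.mem_ofPred_eq, map_mul, Equiv.Perm.mul_apply] at *; rw [hb, ha]
  one_mem' := by simp
  inv_mem' {a} ha := by
    simp only [Set.mem_ofPred_eq, map_inv] at *
    rw [Equiv.Perm.inv_eq_iff_eq, ha]

lemma mem_stb {b : Br (k + 1)} : b ∈ stb k ↔ prm (k + 1) b (k + 1) = k + 1 := Iff.rfl

lemma xb_mem_stb {j : ℕ} (h : j ≤ k) : xb k j ∈ stb k := by
  refine down_induction k (P := fun j => xb k j ∈ stb k) ?_ ?_ h
  · rw [xb_last, mem_stb, pow_two, map_mul, Equiv.Perm.mul_apply, prm_sg_succ (by omega),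
      prm_sg_self (by omega)]
  · intro j hj ih
    have : sg (k + 1) j ∈ stb k := prm_sg_of_ne (by omega) (by omega) (by omega)
    rw [xb_eq hj]
    exact mul_mem (mul_mem (inv_mem this) ih) this

lemma iot_mem (γ : Gam k) : iot k γ ∈ stb k := by
  have hx : ∀ f, iot k (SemidirectProduct.inl f) ∈ stb k := by
    intro f
    induction f using FreeGroup.induction_on with
    | C1 => simp
    | of i => have := iot_gx (k := k) i.2
              rw [gx, xg_of_lt i.2] at this
              erw [this]; exact xb_mem_stb (by omega)
    | inv_of i ih => rw [map_inv, map_inv]; exact inv_mem ih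
    | mul a b ha hb => rw [map_mul, map_mul]; exact mul_mem ha hb
  have hs : ∀ b, iot k (SemidirectProduct.inr b) ∈ stb k := by
    intro b
    refine Br.mem_of_sg ((stb k).comap ((iot k).comp SemidirectProduct.inr)) (fun i hi => ?_) b
    have := iot_gs hi
    rw [gs] at this
    rw [Subgroup.mem_comap, MonoidHom.comp_apply, this]
    exact prm_sg_of_ne (by omega) (by omega) (by omega)
  rw [← SemidirectProduct.inl_left_mul_inr_right γ, map_mul]
  exact mul_mem (hx _) (hs _)

/-- The restriction of the cocycle to the stabilizer. -/
def ret (k : ℕ) : stb k →* Gam k where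
  toFun b := coc k b (k + 1)
  map_one' := by simp
  map_mul' a b := by
    rw [Subgroup.coe_mul, coc_mul, mem_stb.mp b.2]

lemma ret_apply (b : stb k) : ret k b = coc k b (k + 1) := rfl

lemma iot_ret (b : stb k) : iot k (ret k b) = b := by
  have := iot_coc_aux (k := k) b (k + 1) le_rfl
  rwa [mem_stb.mp b.2, tb_last, one_mul, mul_one] at this

lemma coc_sg_last {j : ℕ} (h : j < k) : coc k (sg (k + 1) j) (k + 1) = gs k j := by
  rw [coc_sg (by omega), cocGen_above (by omega) le_rfl]

lemma ret_iot (γ : Gam k) : ret k ⟨iot k γ, iot_mem γ⟩ = γ := by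
  refine DFunLike.congr_fun (Gam.hom_ext (φ := (ret k).comp ((iot k).codRestrict _ iot_mem))
    (ψ := MonoidHom.id _) (fun i hi => ?_) (fun i hi => ?_)) γ
  · have e : ∀ γ b, iot k γ = b → ((ret k).comp ((iot k).codRestrict _ iot_mem)) γ =
      coc k b (k + 1) := by rintro γ _ rfl; rfl
    rw [e _ _ (iot_gx hi), MonoidHom.id_apply]
    refine down_induction k (P := fun i => coc k (xb k i) (k + 1) = gx k i) ?_ ?_
      (show i ≤ k by omega)
    · rw [xb_last, pow_two, coc_mul, prm_sg_succ (by omega), coc_sg (by omega), coc_sg (by omega),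
        cocGen_self (by omega), cocGen_succ le_rfl, one_mul]
    · intro j hj ih
      have hs : sg (k + 1) j ∈ stb k := prm_sg_of_ne (by omega) (by omega) (by omega)
      have hx := xb_mem_stb (k := k) (j := j + 1) (by omega)
      have e1 : (⟨xb k j, xb_mem_stb (by omega)⟩ : stb k) =
        (⟨_, hs⟩ : stb k)⁻¹ * ⟨_, hx⟩ * ⟨_, hs⟩ := Subtype.ext (xb_eq hj)
      have e2 := congrArg (ret k) e1
      rw [map_mul, map_mul, map_inv, ret_apply, ret_apply, ret_apply, coc_sg_last hj, ih] at e2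
      rw [e2, mul_assoc, inv_mul_eq_iff_eq_mul, gs_mul_gx hj]
  · have e : ∀ γ b, iot k γ = b → ((ret k).comp ((iot k).codRestrict _ iot_mem)) γ =
      coc k b (k + 1) := by rintro γ _ rfl; rfl
    rw [e _ _ (iot_gs hi), MonoidHom.id_apply, coc_sg_last hi]

lemma iot_injective : Function.Injective (iot k) := fun a b h => by
  rw [← ret_iot a, ← ret_iot b]; congr 1; exact Subtype.ext h

end xb
end BraidHol

namespace BraidHol

section delta
variable {k : ℕ}

lemma prm_del {m : ℕ} (hm : m ≤ k) :
    (∀ i < m, prm k (del (sg k) m) i = i + 1) ∧ prm k (del (sg k) m) m = 0 ∧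
    ∀ i, m < i → prm k (del (sg k) m) i = i := by
  induction m with
  | zero => simp
  | succ m ih =>
    obtain ⟨h1, h2, h3⟩ := ih (by omega)
    simp only [del_succ, map_mul, Equiv.Perm.mul_apply]
    refine ⟨fun i hi => ?_, ?_, fun i hi => ?_⟩
    · rcases (show i < m ∨ i = m by omega) with h | rfl
      · rw [prm_sg_of_ne (by omega) (by omega) (by omega), h1 i h]
      · rw [prm_sg_self (by omega), h3 _ (by omega)]
    · rw [prm_sg_succ (by omega), h2]
    · rw [prm_sg_of_ne (by omega) (by omega) (by omega), h3 i (by omega)]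

lemma coc_del {m : ℕ} (hm : m ≤ k + 1) :
    (∀ i < m, coc k (del (sg (k + 1)) m) i = del (gs k) (m - 1)) ∧
    coc k (del (sg (k + 1)) m) m = del (gx k) m ∧
    ∀ i, m < i → i ≤ k + 1 → coc k (del (sg (k + 1)) m) i = del (gs k) m := by
  induction m with
  | zero => simp
  | succ m ih =>
    obtain ⟨h1, h2, h3⟩ := ih (by omega)
    simp only [del_succ, coc_mul, Nat.add_sub_cancel]
    refine ⟨fun i hi => ?_, ?_, fun i hi hi' => ?_⟩
    · rcases (show i < m ∨ i = m by omega) with h | rfl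
      · rw [prm_sg_of_ne (by omega) (by omega) (by omega), h1 i h, coc_sg (by omega),
          cocGen_lt h (by omega)]
        obtain ⟨n, rfl⟩ : ∃ n, m = n + 1 := ⟨m - 1, by omega⟩
        rfl
      · rw [prm_sg_self (by omega), h3 _ (by omega) (by omega), coc_sg (by omega),
          cocGen_self (by omega), mul_one]
    · rw [prm_sg_succ (by omega), h2, coc_sg (by omega), cocGen_succ (by omega)]
    · rw [prm_sg_of_ne (by omega) (by omega) (by omega), h3 i (by omega) hi', coc_sg (by omega),
        cocGen_above hi hi']

lemma prm_dl_of_lt {i : ℕ} (h : i < k) : prm k (dl k) i = i + 1 := (prm_del le_rfl).1 i h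

lemma prm_dl_last : prm k (dl k) k = 0 := (prm_del le_rfl).2.1

lemma prm_dl_pow_zero {i : ℕ} (h : i ≤ k) : prm k (dl k ^ i) 0 = i := by
  induction i with
  | zero => simp
  | succ i ih => rw [pow_succ', map_mul, Equiv.Perm.mul_apply, ih (by omega), prm_dl_of_lt h]

lemma prm_zz : prm k (zz k) = 1 := by
  ext i
  rw [Equiv.Perm.one_apply]
  by_cases hi : i ≤ k
  · have h0 : prm k (zz k) 0 = 0 := by
      rw [zz, pow_succ', map_mul, Equiv.Perm.mul_apply, prm_dl_pow_zero le_rfl, prm_dl_last]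
    nth_rw 1 [← prm_dl_pow_zero hi]
    rw [← Equiv.Perm.mul_apply, ← map_mul, (zz_commute k _).eq, map_mul, Equiv.Perm.mul_apply, h0,
      prm_dl_pow_zero hi]
  · exact prm_of_gt _ (by omega)

/-- The product of the letters. -/
def xinf (k : ℕ) : FG (k + 1) := del (xg (k + 1)) (k + 1)

lemma coc_dl_pow {i : ℕ} (h : i ≤ k + 1) : coc k (dl (k + 1) ^ i) 0 = SemidirectProduct.inr (dl k ^ i) := by
  induction i with
  | zero => simp
  | succ i ih =>
    rw [pow_succ', coc_mul, prm_dl_pow_zero (by omega), ih (by omega), dl, (coc_del le_rfl).1 i (by omega),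
      pow_succ', map_mul, dl, map_del, map_pow]
    rfl

lemma coc_zz : coc k (zz (k + 1)) (k + 1) =
    SemidirectProduct.inr (zz k) * SemidirectProduct.inl (xinf k) := by
  have h : coc k (dl (k + 1)) (k + 1) = del (gx k) (k + 1) := (coc_del le_rfl).2.1
  rw [zz, pow_succ, coc_mul, prm_dl_last, coc_dl_pow le_rfl, h, xinf, map_del]
  rfl

lemma zz_mem_stb : zz (k + 1) ∈ stb k := by rw [mem_stb, prm_zz]; rfl

lemma iot_zz : iot k (SemidirectProduct.inr (zz k) * SemidirectProduct.inl (xinf k)) = zz (k + 1) := by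
  rw [← coc_zz]
  exact iot_ret ⟨_, zz_mem_stb⟩

end delta

/-- The exponent sum. -/
def esum (k : ℕ) : Br k →* Multiplicative ℤ :=
  Br.lift (fun _ => Multiplicative.ofAdd 1) ⟨fun _ _ => rfl, fun _ _ _ _ => rfl⟩

lemma esum_sg {k i : ℕ} (h : i < k) : esum k (sg k i) = Multiplicative.ofAdd 1 := Br.lift_sg _ _ h

lemma esum_zz (k : ℕ) : esum k (zz k) = Multiplicative.ofAdd ((k * (k + 1) : ℕ) : ℤ) := by
  have : ∀ m ≤ k, esum k (del (sg k) m) = Multiplicative.ofAdd (m : ℤ) := by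
    intro m hm
    induction m with
    | zero => simp
    | succ m ih => rw [del_succ, map_mul, ih (by omega), esum_sg (by omega), ← ofAdd_add]; simp
  rw [zz, dl, map_pow, this k le_rfl, ← ofAdd_nsmul]
  congr 1
  push_cast
  simp [mul_comm]

lemma zz_zpow_eq_one {k : ℕ} (hk : 1 ≤ k) {n : ℤ} (h : zz k ^ n = 1) : n = 0 := by
  have := congrArg (esum k) h
  rw [map_zpow, esum_zz, map_one, ← ofAdd_zsmul, ← ofAdd_zero] at this
  have := Multiplicative.ofAdd.injective this
  rw [smul_eq_mul, mul_eq_zero] at this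
  rcases this with h | h
  · exact h
  · have : k * (k + 1) = 0 := by exact_mod_cast h
    rcases Nat.mul_eq_zero.mp this with h | h <;> omega

/-- Indicator of the pair `{i, i+1}`. -/
def pairInd (i a b : ℕ) : ℤ := if (a = i ∧ b = i + 1) ∨ (a = i + 1 ∧ b = i) then 1 else 0

/-- The permutation of `ℤ × ℕ × ℕ` counting crossings. -/
def crsPerm (i : ℕ) : Equiv.Perm (ℤ × ℕ × ℕ) where
  toFun p := (pairInd i p.2.1 p.2.2 + p.1, Equiv.swap i (i + 1) p.2.1, Equiv.swap i (i + 1) p.2.2)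
  invFun p := (-pairInd i (Equiv.swap i (i + 1) p.2.1) (Equiv.swap i (i + 1) p.2.2) + p.1,
    Equiv.swap i (i + 1) p.2.1, Equiv.swap i (i + 1) p.2.2)
  left_inv p := by simp
  right_inv p := by simp

lemma crsPerm_apply (i : ℕ) (n : ℤ) (a b : ℕ) : crsPerm i (n, a, b) =
    (pairInd i a b + n, Equiv.swap i (i + 1) a, Equiv.swap i (i + 1) b) := rfl

lemma pairInd_swap {i l a b : ℕ} (h : i + 2 ≤ l ∨ l + 2 ≤ i) :
    pairInd i (Equiv.swap l (l + 1) a) (Equiv.swap l (l + 1) b) = pairInd i a b := by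
  have key : ∀ a c : ℕ, c = i ∨ c = i + 1 → (Equiv.swap l (l + 1) a = c ↔ a = c) := by
    intro a c hc
    rw [Equiv.swap_apply_eq_iff, Equiv.swap_apply_of_ne_of_ne (by omega) (by omega)]
  simp only [pairInd, key _ _ (Or.inl rfl), key _ _ (Or.inr rfl)]

lemma isBraided_crsPerm (k : ℕ) : IsBraided k crsPerm := by
  constructor
  · intro i _
    refine Equiv.ext fun ⟨n, a, b⟩ => ?_
    simp only [Equiv.Perm.mul_apply, crsPerm_apply]
    have hs := (isBraided_swap (i + 2)).braid i (by omega)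
    refine Prod.ext ?_ (Prod.ext (Equiv.congr_fun hs a) (Equiv.congr_fun hs b))
    have e1 : ¬ i = i + 1 + 1 := by omega
    have e2 : ¬ i + 1 + 1 = i := by omega
    rcases (show i = a ∨ i + 1 = a ∨ i + 1 + 1 = a ∨ (a ≠ i ∧ a ≠ i + 1 ∧ a ≠ i + 1 + 1) by omega)
      with rfl | rfl | rfl | ⟨h1, h2, h3⟩ <;>
    rcases (show i = b ∨ i + 1 = b ∨ i + 1 + 1 = b ∨ (b ≠ i ∧ b ≠ i + 1 ∧ b ≠ i + 1 + 1) by omega)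
      with rfl | rfl | rfl | ⟨h4, h5, h6⟩ <;>
    simp (disch := omega) [pairInd, Equiv.swap_apply_of_ne_of_ne, *]
  · intro i l hil _
    refine Equiv.ext fun ⟨n, a, b⟩ => ?_
    simp only [Equiv.Perm.mul_apply, crsPerm_apply]
    have hs := (isBraided_swap (l + 1)).comm i l hil (by omega)
    refine Prod.ext ?_ (Prod.ext (Equiv.congr_fun hs a) (Equiv.congr_fun hs b))
    simp only [pairInd_swap (Or.inl hil), pairInd_swap (Or.inr hil)]
    omega

/-- The action counting crossings. -/
def crsAct (k : ℕ) : Br k →* Equiv.Perm (ℤ × ℕ × ℕ) := Br.lift _ (isBraided_crsPerm k)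

/-- The signed number of crossings of the strands starting at `a` and `b`. -/
def crs (k : ℕ) (x : Br k) (a b : ℕ) : ℤ := (crsAct k x (0, a, b)).1

section crs
variable {k : ℕ}

lemma crsAct_apply (x : Br k) (n : ℤ) (a b : ℕ) :
    crsAct k x (n, a, b) = (crs k x a b + n, prm k x a, prm k x b) := by
  have key : ∀ n : ℤ, crsAct k x (n, a, b) = ((crsAct k x (0, a, b)).1 + n, prm k x a, prm k x b) := by
    induction x using Br.induction with
    | one => intro γ; simp
    | mul j hj c ih =>
      intro n
      rw [map_mul, map_mul, Equiv.Perm.mul_apply, Equiv.Perm.mul_apply, Equiv.Perm.mul_apply,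
        Equiv.Perm.mul_apply, ih n, ih 0, crsAct, Br.lift_sg _ _ hj, crsPerm_apply, crsPerm_apply,
        prm_sg hj]
      simp [add_assoc]
    | inv j hj c ih =>
      intro n
      rw [map_mul, map_mul, Equiv.Perm.mul_apply, Equiv.Perm.mul_apply, Equiv.Perm.mul_apply,
        Equiv.Perm.mul_apply, ih n, ih 0, crsAct, map_inv, map_inv, Br.lift_sg _ _ hj, prm_sg hj]
      simp [crsPerm, Equiv.Perm.inv_def, add_assoc]
  exact key n

lemma crs_mul (x y : Br k) (a b : ℕ) :
    crs k (x * y) a b = crs k x (prm k y a) (prm k y b) + crs k y a b := by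
  rw [crs, map_mul, Equiv.Perm.mul_apply, crsAct_apply, crsAct_apply, add_zero]

@[simp] lemma crs_one {a b : ℕ} : crs k 1 a b = 0 := by simp [crs]

lemma crs_sg {j a b : ℕ} (hj : j < k) : crs k (sg k j) a b = pairInd j a b := by
  rw [crs, crsAct, Br.lift_sg _ _ hj, crsPerm_apply, add_zero]

lemma crs_conj {x : Br k} (hx : prm k x = 1) (y : Br k) (a b : ℕ) :
    crs k (y * x * y⁻¹) a b = crs k x ((prm k y)⁻¹ a) ((prm k y)⁻¹ b) := by
  have h := crs_mul y y⁻¹ a b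
  rw [mul_inv_cancel, crs_one] at h
  rw [crs_mul, crs_mul, hx, map_inv, Equiv.Perm.one_apply, Equiv.Perm.one_apply]
  rw [map_inv] at h
  linarith

lemma crs_sg_sq {j a b : ℕ} (hj : j < k) : crs k (sg k j ^ 2) a b = 2 * pairInd j a b := by
  rw [pow_two, crs_mul, crs_sg hj, crs_sg hj, prm_sg hj, two_mul]
  congr 1
  simp only [pairInd, Equiv.swap_apply_def]
  split_ifs <;> omega

lemma prm_sg_sq {j : ℕ} (hj : j < k) : prm k (sg k j ^ 2) = 1 := by
  rw [map_pow, prm_sg hj, pow_two, Equiv.swap_mul_self]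

end crs

end BraidHol

namespace BraidHol

section crsmore
variable {k : ℕ}

lemma FG.mem_of_xg {m : ℕ} (H : Subgroup (FG m)) (h : ∀ i < m, xg m i ∈ H) (f : FG m) : f ∈ H := by
  induction f using FreeGroup.induction_on with
  | C1 => exact one_mem _
  | of i => have := h i i.2; rwa [xg_of_lt i.2] at this
  | inv_of i ih => exact inv_mem ih
  | mul x y hx hy => exact mul_mem hx hy

lemma prm_tb_of_lt {i j : ℕ} (hj : j ≤ k + 1) (h : i < j) : prm (k + 1) (tb k j) i = i := by
  revert h
  refine down_induction (k + 1) (P := fun j => i < j → prm (k + 1) (tb k j) i = i) ?_ ?_ hj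
  · intro _; rw [tb_last, map_one]; rfl
  · intro j hj ih h
    rw [tb_eq (by omega), map_mul, Equiv.Perm.mul_apply, ih (by omega), map_inv, prm_sg hj,
      Equiv.swap_inv, Equiv.swap_apply_of_ne_of_ne (by omega) (by omega)]

lemma prm_tb_last {j : ℕ} (hj : j ≤ k + 1) : prm (k + 1) (tb k j) (k + 1) = j := by
  refine down_induction (k + 1) (P := fun j => prm (k + 1) (tb k j) (k + 1) = j) ?_ ?_ hj
  · rw [tb_last, map_one]; rfl
  · intro j hj ih
    rw [tb_eq (by omega), map_mul, Equiv.Perm.mul_apply, ih, map_inv, prm_sg hj,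
      Equiv.swap_inv, Equiv.swap_apply_right]

lemma prm_xb {j : ℕ} (hj : j ≤ k) : prm (k + 1) (xb k j) = 1 := by
  rw [xb_eq_tb hj, map_mul, map_mul, prm_sg_sq (by omega), mul_one, ← map_mul, inv_mul_cancel,
    map_one]

lemma crs_xb {j : ℕ} (hj : j ≤ k) (a b : ℕ) : crs (k + 1) (xb k j) a b =
    2 * if (a = j ∧ b = k + 1) ∨ (a = k + 1 ∧ b = j) then 1 else 0 := by
  have h := crs_conj (prm_sg_sq (show j < k + 1 by omega)) (tb k (j + 1))⁻¹ a b
  rw [inv_inv, ← xb_eq_tb hj, crs_sg_sq (by omega), map_inv, inv_inv] at h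
  have h1 : ∀ a, prm (k + 1) (tb k (j + 1)) a = j ↔ a = j := fun a => by
    nth_rw 2 [← prm_tb_of_lt (k := k) (show j + 1 ≤ k + 1 by omega) (show j < j + 1 by omega)]
    exact (prm (k + 1) (tb k (j + 1))).injective.eq_iff
  have h2 : ∀ a, prm (k + 1) (tb k (j + 1)) a = j + 1 ↔ a = k + 1 := fun a => by
    nth_rw 2 [← prm_tb_last (k := k) (show j + 1 ≤ k + 1 by omega)]
    exact (prm (k + 1) (tb k (j + 1))).injective.eq_iff
  rw [h, pairInd]
  simp only [h1, h2]

lemma prm_iot (γ : Gam k) : prm (k + 1) (iot k γ) = prm k γ.right := by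
  have : (prm (k + 1)).comp (iot k) = (prm k).comp SemidirectProduct.rightHom := by
    refine Gam.hom_ext (fun i hi => ?_) (fun i hi => ?_)
    · simp only [MonoidHom.comp_apply]
      rw [iot_gx hi, prm_xb (by omega)]; simp [gx]
    · simp only [MonoidHom.comp_apply]
      rw [iot_gs hi, prm_sg (by omega)]; simp [gs, prm_sg hi]
  exact DFunLike.congr_fun this γ

lemma crs_inv (x : Br k) (a b : ℕ) :
    crs k x⁻¹ a b = - crs k x ((prm k x)⁻¹ a) ((prm k x)⁻¹ b) := by
  have h := crs_mul x x⁻¹ a b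
  rw [mul_inv_cancel, crs_one, map_inv] at h
  linarith

lemma prm_inv_le (b : Br k) {i : ℕ} (h : i ≤ k) : (prm k b)⁻¹ i ≤ k := by
  rw [← map_inv]; exact prm_le _ h

lemma crs_iot_inr (c : Br k) (a b : ℕ) :
    crs (k + 1) (iot k (SemidirectProduct.inr c)) a b = crs k c a b := by
  have hs : ∀ j < k, iot k (SemidirectProduct.inr (sg k j)) = sg (k + 1) j := fun j hj => iot_gs hj
  induction c using Br.induction generalizing a b with
  | one => simp
  | mul j hj c ih =>
    rw [map_mul, map_mul, crs_mul, crs_mul, ih, prm_iot, hs j hj, crs_sg (by omega), crs_sg hj]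
    rfl
  | inv j hj c ih =>
    rw [map_mul, map_mul, crs_mul, crs_mul, ih, prm_iot, map_inv, map_inv, hs j hj, crs_inv,
      crs_inv, crs_sg (by omega), crs_sg hj, prm_sg hj, prm_sg (by omega)]
    rfl

lemma crs_iot_inl (f : FG (k + 1)) {a b : ℕ} (ha : a ≤ k) (hb : b ≤ k) :
    crs (k + 1) (iot k (SemidirectProduct.inl f)) a b = 0 := by
  have hp : ∀ f, prm (k + 1) (iot k (SemidirectProduct.inl f)) = 1 := fun f => by
    rw [prm_iot]; simp
  let H : Subgroup (FG (k + 1)) :=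
    { carrier := {f | crs (k + 1) (iot k (SemidirectProduct.inl f)) a b = 0}
      one_mem' := by simp
      mul_mem' := fun {x y} hx hy => by
        simp only [Set.mem_ofPred_eq] at *
        rw [map_mul, map_mul, crs_mul, hp, hy]; simpa using hx
      inv_mem' := fun {x} hx => by
        simp only [Set.mem_ofPred_eq] at *
        rw [map_inv, map_inv, crs_inv, hp]; simpa using hx }
  refine FG.mem_of_xg H (fun i hi => ?_) f
  change crs (k + 1) (iot k (gx k i)) a b = 0
  rw [iot_gx hi, crs_xb (by omega), if_neg (by omega), mul_zero]

lemma crs_iot (γ : Gam k) {a b : ℕ} (ha : a ≤ k) (hb : b ≤ k) :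
    crs (k + 1) (iot k γ) a b = crs k γ.right a b := by
  nth_rw 1 [← SemidirectProduct.inl_left_mul_inr_right γ]
  rw [map_mul, crs_mul, crs_iot_inr, prm_iot]
  simp only [SemidirectProduct.right_inr]
  rw [crs_iot_inl _ (prm_le _ ha) (prm_le _ hb), zero_add]

lemma exists_prm_eq {a b : ℕ} (ha : a ≤ k) (hb : b ≤ k) (hab : a ≠ b) :
    ∃ β : Br k, prm k β 0 = a ∧ prm k β 1 = b := by
  have h1 : ∀ c, 1 ≤ c → c ≤ k → ∃ β : Br k, prm k β 0 = 0 ∧ prm k β 1 = c := by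
    intro c hc
    induction c, hc using Nat.le_induction with
    | base => exact fun _ => ⟨1, by simp⟩
    | succ c hc ih =>
      intro h
      obtain ⟨β, h1, h2⟩ := ih (by omega)
      refine ⟨sg k c * β, ?_, ?_⟩
      · rw [map_mul, Equiv.Perm.mul_apply, h1, prm_sg_of_ne (by omega) (by omega) (by omega)]
      · rw [map_mul, Equiv.Perm.mul_apply, h2, prm_sg_self (by omega)]
  obtain ⟨β, h2, h3⟩ := h1 ((prm k (dl k ^ a))⁻¹ b) (by
    rw [Nat.one_le_iff_ne_zero, Ne, Equiv.Perm.inv_eq_iff_eq, prm_dl_pow_zero ha]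
    exact fun h => hab h.symm) (prm_inv_le _ hb)
  refine ⟨dl k ^ a * β, ?_, ?_⟩
  · rw [map_mul, Equiv.Perm.mul_apply, h2, prm_dl_pow_zero ha]
  · rw [map_mul, Equiv.Perm.mul_apply, h3]; simp

lemma crs_zz {a b : ℕ} (ha : a ≤ k) (hb : b ≤ k) (hab : a ≠ b) :
    crs k (zz k) a b = crs k (zz k) 0 1 := by
  obtain ⟨β, rfl, rfl⟩ := exists_prm_eq ha hb hab
  have h := crs_conj prm_zz β (prm k β 0) (prm k β 1)
  rw [← (zz_commute k β).eq, mul_inv_cancel_right] at h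
  simpa using h

lemma crs_mul_zz_zpow (x : Br k) (n : ℤ) {a b : ℕ} (ha : a ≤ k) (hb : b ≤ k) (hab : a ≠ b) :
    crs k (x * zz k ^ n) a b = crs k x a b + n * crs k (zz k) 0 1 := by
  have h : ∀ n : ℕ, crs k (zz k ^ n) a b = n * crs k (zz k) 0 1 := by
    intro n
    induction n with
    | zero => simp
    | succ n ih => rw [pow_succ, crs_mul, prm_zz]; simp [ih, crs_zz ha hb hab]; ring
  rw [crs_mul, map_zpow, prm_zz, one_zpow, Equiv.Perm.one_apply, Equiv.Perm.one_apply]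
  congr 1
  obtain ⟨n, rfl | rfl⟩ := n.eq_nat_or_neg
  · simpa using h n
  · rw [zpow_neg, zpow_natCast, crs_inv, map_pow, prm_zz, one_pow]; simp [h]

lemma crs_symm (x : Br k) (a b : ℕ) : crs k x a b = crs k x b a := by
  have hs : ∀ j a b, pairInd j a b = pairInd j b a := fun j a b => by
    simp only [pairInd]; congr 1; exact propext ⟨by tauto, by tauto⟩
  induction x using Br.induction generalizing a b with
  | one => simp
  | mul j hj c ih => rw [crs_mul, crs_mul, ih, crs_sg hj, crs_sg hj, hs]
  | inv j hj c ih => rw [crs_mul, crs_mul, ih, crs_inv, crs_inv, crs_sg hj, crs_sg hj, hs]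

lemma sg_succ_conj {j : ℕ} (h : j + 1 < k) :
    sg k (j + 1) = (sg k j * sg k (j + 1)) * sg k j * (sg k j * sg k (j + 1))⁻¹ := by
  rw [eq_mul_inv_iff_mul_eq, sg_braid h]; group

lemma exists_sg_conj {j : ℕ} (h : j < k) : ∃ β, sg k j = β * sg k 0 * β⁻¹ := by
  induction j with
  | zero => exact ⟨1, by simp⟩
  | succ j ih =>
    obtain ⟨β, hβ⟩ := ih (by omega)
    refine ⟨sg k j * sg k (j + 1) * β, ?_⟩
    have e : ∀ c : Br k, c * β * sg k 0 * (c * β)⁻¹ = c * (β * sg k 0 * β⁻¹) * c⁻¹ := fun c => by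
      group
    rw [e, ← hβ]
    exact sg_succ_conj h

/-- Pure braids are generated by the conjugates of the square of the first generator. -/
lemma mem_of_prm_eq_one (H : Subgroup (Br k)) (hH : ∀ β, β * sg k 0 ^ 2 * β⁻¹ ∈ H) {x : Br k}
    (hx : prm k x = 1) : x ∈ H := by
  induction k with
  | zero => exact Br.mem_of_sg H (fun i hi => absurd hi (by omega)) x
  | succ k ih =>
    obtain ⟨γ, rfl⟩ : ∃ γ, iot k γ = x := ⟨_, iot_ret ⟨x, by rw [mem_stb, hx]; rfl⟩⟩
    have hj : ∀ j ≤ k, ∀ β, β * sg (k + 1) j ^ 2 * β⁻¹ ∈ H := by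
      intro j hj β
      obtain ⟨c, hc⟩ := exists_sg_conj (show j < k + 1 by omega)
      have := hH (β * c)
      rw [hc]
      convert this using 1
      simp [pow_two, mul_assoc]
    rw [← SemidirectProduct.inl_left_mul_inr_right γ, map_mul]
    rw [prm_iot] at hx
    refine mul_mem ?_ ?_
    · refine FG.mem_of_xg (H.comap ((iot k).comp SemidirectProduct.inl)) (fun i hi => ?_) _
      change iot k (gx k i) ∈ H
      rw [iot_gx hi, xb_eq_tb (by omega)]
      simpa using hj i (by omega) (tb k (i + 1))⁻¹
    · refine ih (H.comap ((iot k).comp SemidirectProduct.inr)) (fun β => ?_) hx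
      rcases Nat.eq_zero_or_pos k with rfl | hk
      · rw [sg_of_le le_rfl]; simp
      · have h0 : iot k (SemidirectProduct.inr (sg k 0)) = sg (k + 1) 0 := iot_gs hk
        simp only [Subgroup.mem_comap, MonoidHom.comp_apply, map_mul, map_pow, map_inv, h0]
        exact hH _

end crsmore

end BraidHol

namespace BraidHol

set_option linter.unusedSectionVars false

section alt
variable {α : Type*} [DecidableEq α] (c : α → Bool)

/-- The free factor on the letters of the given colour. -/
def KK (b : Bool) : Subgroup (FreeGroup α) := Subgroup.closure (FreeGroup.of '' {a | c a = b})

variable {c}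

lemma of_mem_KK (a : α) : FreeGroup.of a ∈ KK c (c a) := Subgroup.subset_closure ⟨a, rfl, rfl⟩

lemma color_of_mem_KK {b : Bool} {w : FreeGroup α} (hw : w ∈ KK c b) :
    ∀ l ∈ w.toWord, c l.1 = b := by
  induction hw using Subgroup.closure_induction with
  | mem x hx => obtain ⟨a, ha, rfl⟩ := hx; simpa using ha
  | one => simp
  | mul x y _ _ hx hy =>
    intro l hl
    have := (FreeGroup.toWord_mul_sublist x y).subset hl
    rw [List.mem_append] at this
    exact this.elim (hx l) (hy l)
  | inv x _ hx =>
    intro l hl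
    rw [FreeGroup.toWord_inv, FreeGroup.invRev, List.mem_reverse, List.mem_map] at hl
    obtain ⟨l', hl', rfl⟩ := hl
    exact hx l' hl'

variable (c) in
/-- Alternating lists of nontrivial elements of the two free factors. -/
def Alt (L : List (Bool × FreeGroup α)) : Prop :=
  L.IsChain (fun a b => a.1 ≠ b.1) ∧ ∀ a ∈ L, a.2 ∈ KK c a.1 ∧ a.2 ≠ 1

/-- The product of a list. -/
def prd (L : List (Bool × FreeGroup α)) : FreeGroup α := (L.map Prod.snd).prod

@[simp] lemma prd_nil : prd ([] : List (Bool × FreeGroup α)) = 1 := rfl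
@[simp] lemma prd_cons (a : Bool × FreeGroup α) (L) : prd (a :: L) = a.2 * prd L := by simp [prd]
@[simp] lemma prd_append (L M : List (Bool × FreeGroup α)) : prd (L ++ M) = prd L * prd M := by
  simp [prd]

lemma alt_nil : Alt c [] := ⟨List.isChain_nil, by simp⟩

lemma alt_append {L M : List (Bool × FreeGroup α)} : Alt c (L ++ M) ↔ Alt c L ∧ Alt c M ∧
    ∀ x ∈ L.getLast?, ∀ y ∈ M.head?, x.1 ≠ y.1 := by
  rw [Alt, Alt, Alt, List.isChain_append]
  simp only [List.mem_append]
  constructor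
  · rintro ⟨⟨h1, h2, h3⟩, h4⟩
    exact ⟨⟨h1, fun a ha => h4 a (Or.inl ha)⟩, ⟨h2, fun a ha => h4 a (Or.inr ha)⟩, h3⟩
  · rintro ⟨⟨h1, h4⟩, ⟨h2, h5⟩, h3⟩
    exact ⟨⟨h1, h2, h3⟩, fun a ha => ha.elim (h4 a) (h5 a)⟩

lemma alt_singleton {a : Bool × FreeGroup α} : Alt c [a] ↔ a.2 ∈ KK c a.1 ∧ a.2 ≠ 1 := by
  simp [Alt]

lemma alt_cons {a : Bool × FreeGroup α} {M : List (Bool × FreeGroup α)} :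
    Alt c (a :: M) ↔ (a.2 ∈ KK c a.1 ∧ a.2 ≠ 1) ∧ Alt c M ∧ ∀ y ∈ M.head?, a.1 ≠ y.1 := by
  rw [show a :: M = [a] ++ M from rfl, alt_append, alt_singleton]
  simp

lemma toWord_prd {L : List (Bool × FreeGroup α)} (h : Alt c L) :
    (prd L).toWord = (L.map fun a => a.2.toWord).flatten := by
  induction L with
  | nil => simp
  | cons a M ih =>
    obtain ⟨ha, hM, hc⟩ := alt_cons.mp h
    rw [prd_cons, FreeGroup.toWord_mul, List.map_cons, List.flatten_cons, ← ih hM]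
    apply FreeGroup.IsReduced.reduce_eq
    rw [FreeGroup.IsReduced, List.isChain_append]
    refine ⟨FreeGroup.isReduced_toWord, FreeGroup.isReduced_toWord, fun x hx y hy hxy => ?_⟩
    exfalso
    have h1 := color_of_mem_KK ha.1 x (List.mem_of_mem_getLast? hx)
    cases M with
    | nil => simp at hy
    | cons b N =>
      have hb := (alt_cons.mp hM).1
      have hne : b.2.toWord ≠ [] := by simpa using hb.2
      rw [ih hM, List.map_cons, List.flatten_cons, List.head?_append_of_ne_nil _ hne] at hy
      have h2 := color_of_mem_KK hb.1 y (List.mem_of_mem_head? hy)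
      exact hc b (by simp) (by rw [← h1, ← h2, hxy])

lemma norm_prd {L : List (Bool × FreeGroup α)} (h : Alt c L) :
    (prd L).norm = (L.map fun a => a.2.norm).sum := by
  rw [FreeGroup.norm, toWord_prd h, List.length_flatten, List.map_map]
  rfl

lemma exists_alt_mul {b : Bool} {g : FreeGroup α} (hg : g ∈ KK c b)
    {L : List (Bool × FreeGroup α)} (hL : Alt c L) : ∃ M, Alt c M ∧ prd M = g * prd L := by
  by_cases h1 : g = 1
  · exact ⟨L, hL, by simp [h1]⟩
  cases L with
  | nil => exact ⟨[(b, g)], alt_singleton.mpr ⟨hg, h1⟩, by simp⟩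
  | cons a L =>
    by_cases hab : b = a.1
    · subst hab
      obtain ⟨ha, hL', hc⟩ := alt_cons.mp hL
      by_cases h2 : g * a.2 = 1
      · exact ⟨L, hL', by rw [prd_cons, ← mul_assoc, h2, one_mul]⟩
      · exact ⟨(a.1, g * a.2) :: L, alt_cons.mpr ⟨⟨mul_mem hg ha.1, h2⟩, hL', hc⟩, by
          simp [mul_assoc]⟩
    · exact ⟨(b, g) :: a :: L, alt_cons.mpr ⟨⟨hg, h1⟩, hL, by simpa using hab⟩, by simp⟩

variable (c) in
lemma exists_alt (w : FreeGroup α) : ∃ L, Alt c L ∧ prd L = w := by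
  have key : ∀ w : FreeGroup α, ∀ L, Alt c L → ∃ M, Alt c M ∧ prd M = w * prd L := by
    intro w
    induction w using FreeGroup.induction_on with
    | C1 => exact fun L hL => ⟨L, hL, by simp⟩
    | of a => exact fun L hL => exists_alt_mul (of_mem_KK a) hL
    | inv_of a _ => exact fun L hL => exists_alt_mul (inv_mem (of_mem_KK a)) hL
    | mul x y hx hy =>
      intro L hL
      obtain ⟨M, hM, h1⟩ := hy L hL
      obtain ⟨N, hN, h2⟩ := hx M hM
      exact ⟨N, hN, by rw [h2, h1, mul_assoc]⟩
  simpa using key w [] alt_nil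

variable (c) in
/-- Stripping off the factors of the first colour at both ends. -/
lemma exists_strip (w : FreeGroup α) : ∃ s ∈ KK c true, ∃ t ∈ KK c true, ∃ L, Alt c L ∧
    (∀ y ∈ L.head?, y.1 = false) ∧ (∀ y ∈ L.getLast?, y.1 = false) ∧ w = s * prd L * t := by
  obtain ⟨L, hL, rfl⟩ := exists_alt c w
  have h1 : ∃ s ∈ KK c true, ∃ M, Alt c M ∧ (∀ y ∈ M.head?, y.1 = false) ∧ prd L = s * prd M := by
    cases L with
    | nil => exact ⟨1, one_mem _, [], alt_nil, by simp, by simp⟩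
    | cons a L =>
      obtain ⟨ha, hL', hc⟩ := alt_cons.mp hL
      rcases ha1 : a.1 with _ | _
      · exact ⟨1, one_mem _, a :: L, hL, by simpa using ha1, by simp⟩
      · rw [ha1] at ha hc
        exact ⟨a.2, ha.1, L, hL', fun y hy => by simpa using hc y hy, by simp⟩
  obtain ⟨s, hs, M, hM, hM1, hLM⟩ := h1
  have h2 : ∃ t ∈ KK c true, ∃ N, Alt c N ∧ (∀ y ∈ N.head?, y.1 = false) ∧
      (∀ y ∈ N.getLast?, y.1 = false) ∧ prd M = prd N * t := by
    rcases M.eq_nil_or_concat with rfl | ⟨N, a, rfl⟩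
    · exact ⟨1, one_mem _, [], alt_nil, by simp, by simp, by simp⟩
    · rw [List.concat_eq_append] at *
      obtain ⟨hN, ha, hc⟩ := alt_append.mp hM
      rw [alt_singleton] at ha
      rcases ha1 : a.1 with _ | _
      · exact ⟨1, one_mem _, N ++ [a], hM, hM1, by simpa using ha1, by simp⟩
      · rw [ha1] at ha
        refine ⟨a.2, ha.1, N, hN, fun y hy => hM1 y ?_, fun y hy => ?_, by simp⟩
        · rw [List.head?_append_of_ne_nil]
          · exact hy
          · rintro rfl; simp at hy
        · have := hc y hy a (by simp)
          rw [ha1] at this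
          simpa using this
  obtain ⟨t, ht, N, hN, h3, h4, h5⟩ := h2
  exact ⟨s, hs, t, ht, N, hN, h3, h4, by rw [hLM, h5, mul_assoc]⟩

lemma alt_conj {L : List (Bool × FreeGroup α)} (hL : Alt c L) (h1 : ∀ y ∈ L.head?, y.1 = false)
    (h2 : ∀ y ∈ L.getLast?, y.1 = false) (h3 : L ≠ []) {s t : FreeGroup α} (hs : s ∈ KK c true)
    (ht : t ∈ KK c true) : (s * prd L * t).norm = s.norm + (prd L).norm + t.norm := by
  have key : ∀ s ∈ KK c true, ∀ M, Alt c M → (∀ y ∈ M.head?, y.1 = false) →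
      (s * prd M).norm = s.norm + (prd M).norm := by
    intro s hs M hM h1
    by_cases h : s = 1
    · simp [h]
    · have : Alt c ((true, s) :: M) := alt_cons.mpr ⟨⟨hs, h⟩, hM, fun y hy => by simp [h1 y hy]⟩
      have h6 := norm_prd this
      rw [prd_cons] at h6
      rw [h6, norm_prd hM]; simp
  by_cases h : t = 1
  · rw [h]; simpa using key s hs L hL h1
  · have h5 : Alt c (L ++ [(true, t)]) := alt_append.mpr ⟨hL, alt_singleton.mpr ⟨ht, h⟩,
      fun x hx y hy => by
        simp only [List.head?_cons, Option.mem_def, Option.some.injEq] at hy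
        subst hy; simp [h2 x hx]⟩
    have h6 := key s hs _ h5 (by rw [List.head?_append_of_ne_nil _ h3]; exact h1)
    have h7 := norm_prd h5
    rw [prd_append] at h6 h7
    simp only [prd_cons, prd_nil, mul_one] at h6 h7
    rw [mul_assoc, h6, h7, norm_prd hL]
    simp [add_assoc]

/-- Up to conjugacy, alternating lists may be taken cyclically alternating. -/
lemma exists_conj_alt (w : FreeGroup α) : ∃ L, Alt c L ∧ IsConj w (prd L) ∧
    (L.length ≤ 1 ∨ ∀ x ∈ L.getLast?, ∀ y ∈ L.head?, x.1 ≠ y.1) := by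
  obtain ⟨L, hL, rfl⟩ := exists_alt c w
  induction hn : L.length using Nat.strong_induction_on generalizing L with
  | _ n ih =>
    subst hn
    cases L with
    | nil => exact ⟨[], alt_nil, IsConj.refl _, by simp⟩
    | cons a L =>
      rcases L.eq_nil_or_concat with rfl | ⟨M, b, rfl⟩
      · exact ⟨[a], hL, IsConj.refl _, by simp⟩
      · rw [List.concat_eq_append] at *
        by_cases hab : b.1 = a.1
        · obtain ⟨ha, hM', hc⟩ := alt_cons.mp hL
          obtain ⟨hM, hb, -⟩ := alt_append.mp hM'
          rw [alt_singleton] at hb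
          have hcM : ∀ y ∈ M.head?, a.1 ≠ y.1 := fun y hy => hc y (by
            rw [List.head?_append_of_ne_nil]
            · exact hy
            · rintro rfl; simp at hy)
          have hcj : IsConj (prd (a :: (M ++ [b]))) (b.2 * a.2 * prd M) := by
            rw [isConj_iff]
            exact ⟨b.2, by simp; group⟩
          by_cases h1 : b.2 * a.2 = 1
          · obtain ⟨N, hN, h2, h3⟩ := ih M.length (by simp) M hM rfl
            rw [h1, one_mul] at hcj
            exact ⟨N, hN, hcj.trans h2, h3⟩
          · obtain ⟨N, hN, h2, h3⟩ := ih (((a.1, b.2 * a.2) :: M).length) (by simp)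
              ((a.1, b.2 * a.2) :: M) (alt_cons.mpr ⟨⟨mul_mem (hab ▸ hb.1) ha.1, h1⟩, hM, hcM⟩) rfl
            exact ⟨N, hN, hcj.trans (by simpa using h2), h3⟩
        · exact ⟨_, hL, IsConj.refl _, Or.inr fun x hx y hy => by
            rw [← List.cons_append, List.getLast?_concat] at hx
            simp only [List.head?_cons, Option.mem_def, Option.some.injEq] at hx hy
            subst hx hy; exact hab⟩

lemma alt_replicate {L : List (Bool × FreeGroup α)} (hL : Alt c L)
    (h : ∀ x ∈ L.getLast?, ∀ y ∈ L.head?, x.1 ≠ y.1) (n : ℕ) :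
    ∃ M, Alt c M ∧ prd M = prd L ^ n ∧
      (M.map fun a => a.2.norm).sum = n * (L.map fun a => a.2.norm).sum ∧
      ∀ y ∈ M.head?, y ∈ L.head? := by
  induction n with
  | zero => exact ⟨[], alt_nil, by simp, by simp, by simp⟩
  | succ n ih =>
    obtain ⟨M, hM, h1, h2, h3⟩ := ih
    refine ⟨L ++ M, alt_append.mpr ⟨hL, hM, fun x hx y hy => h x hx y (h3 y hy)⟩, ?_, ?_, ?_⟩
    · rw [prd_append, h1, pow_succ']
    · rw [List.map_append, List.sum_append, h2]; ring
    · intro y hy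
      cases L with
      | nil =>
        have := h3 y (by simpa using hy)
        simp at this
      | cons a L => simpa using hy

lemma norm_pow_conj {L : List (Bool × FreeGroup α)} (hL : Alt c L)
    (h : ∀ x ∈ L.getLast?, ∀ y ∈ L.head?, x.1 ≠ y.1) {w : FreeGroup α} (hw : IsConj w (prd L)) :
    (prd L).norm ≤ w.norm := by
  obtain ⟨g, hg⟩ := isConj_iff.mp hw
  have key : ∀ n : ℕ, n * (prd L).norm ≤ 2 * g.norm + n * w.norm := by
    intro n
    obtain ⟨M, hM, h1, h2, -⟩ := alt_replicate hL h n
    have h3 := norm_prd hM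
    rw [h2, h1, ← norm_prd hL, ← hg, conj_pow] at h3
    rw [← hg, ← h3]
    have hp : (w ^ n).norm ≤ n * w.norm := by
      clear h3 h2 h1 hM
      induction n with
      | zero => simp
      | succ n ih => rw [pow_succ]; refine (FreeGroup.norm_mul_le _ _).trans ?_; linarith
    have h4 := FreeGroup.norm_mul_le (g * w ^ n) g⁻¹
    have h5 := FreeGroup.norm_mul_le g (w ^ n)
    rw [FreeGroup.norm_inv_eq] at h4
    linarith
  by_contra hlt
  push Not at hlt
  have := key (2 * g.norm + 1)
  nlinarith

lemma exists_eq_of_norm_le [Finite α] (f : ℕ → FreeGroup α) (C : ℕ) (h : ∀ n, (f n).norm ≤ C) :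
    ∃ p q, p < q ∧ f p = f q := by
  have hfin : {l : List (α × Bool) | l.length ≤ C}.Finite := List.finite_length_le _ _
  obtain ⟨p, q, hne, hpq⟩ := Set.Finite.exists_lt_map_eq_of_forall_mem (f := fun n => (f n).toWord)
    (fun n => h n) hfin
  exact ⟨p, q, hne, FreeGroup.toWord_injective hpq⟩

end alt
end BraidHol

namespace BraidHol

set_option linter.unusedSectionVars false

section alt
variable {α : Type*} [DecidableEq α] {c : α → Bool}

/-- The free factors are malnormal. -/
lemma mem_KK_of_conj {v w : FreeGroup α} (hv : v ∈ KK c true) (h1 : v ≠ 1)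
    (hw : w * v * w⁻¹ ∈ KK c true) : w ∈ KK c true := by
  obtain ⟨s, hs, t, ht, L, hL, h2, h3, rfl⟩ := exists_strip c w
  by_cases hn : L = []
  · subst hn; simpa using mul_mem hs ht
  exfalso
  have hk : s⁻¹ * (s * prd L * t * v * (s * prd L * t)⁻¹)⁻¹ * s ∈ KK c true :=
    mul_mem (mul_mem (inv_mem hs) (inv_mem hw)) hs
  have hl : t * v * t⁻¹ ∈ KK c true := mul_mem (mul_mem ht hv) (inv_mem ht)
  have h4 := alt_conj hL h2 h3 hn hk hl
  rw [show s⁻¹ * (s * prd L * t * v * (s * prd L * t)⁻¹)⁻¹ * s * prd L * (t * v * t⁻¹) = prd L by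
    group] at h4
  have h5 : (t * v * t⁻¹).norm = 0 := by omega
  rw [FreeGroup.norm_eq_zero] at h5
  apply h1
  have : v = t⁻¹ * (t * v * t⁻¹) * t := by group
  rw [this, h5]; group

lemma KK_single (a : α) : KK (fun x => decide (x = a)) true = Subgroup.zpowers (FreeGroup.of a) := by
  rw [KK, Subgroup.zpowers_eq_closure]
  simp

/-- `u` has the property that the centralizer of each of its powers consists of powers of `u`. -/
def SelfCent {G : Type*} [Group G] (u : G) : Prop :=
  ∀ q : ℕ, 0 < q → ∀ w, w * u ^ q = u ^ q * w → w ∈ Subgroup.zpowers u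

lemma pow_ne_one_of_free {u : FreeGroup α} (hu : u ≠ 1) {q : ℕ} (hq : 0 < q) : u ^ q ≠ 1 := by
  intro h
  exact hu ((pow_eq_one_iff_left hq.ne').mp h)

lemma selfCent_of (a : α) : SelfCent (FreeGroup.of a) := by
  intro q hq w h
  rw [← KK_single]
  apply mem_KK_of_conj (v := FreeGroup.of a ^ q)
  · rw [KK_single]; exact ⟨q, by simp⟩
  · exact pow_ne_one_of_free (by simp) hq
  · rw [h, mul_inv_cancel_right]
    rw [KK_single]; exact ⟨q, by simp⟩

lemma SelfCent.map {G H : Type*} [Group G] [Group H] (φ : G ≃* H) {u : G} (h : SelfCent u) :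
    SelfCent (φ u) := by
  intro q hq w hw
  obtain ⟨n, hn⟩ := h q hq (φ.symm w) (φ.injective (by simpa using hw))
  exact ⟨n, by simpa using congrArg φ hn⟩

variable (c) in
/-- Conjugation of the chunks of the first colour. -/
def cjc (v : FreeGroup α) (a : Bool × FreeGroup α) : Bool × FreeGroup α :=
  (a.1, if a.1 then v⁻¹ * a.2 * v else a.2)

lemma alt_cjc {v : FreeGroup α} (hv : v ∈ KK c true) {L : List (Bool × FreeGroup α)}
    (hL : Alt c L) : Alt c (L.map (cjc v)) := by
  refine ⟨?_, ?_⟩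
  · rw [List.isChain_map]; exact hL.1
  · intro a ha
    obtain ⟨⟨b, g⟩, hb, rfl⟩ := List.mem_map.mp ha
    have h2 := hL.2 _ hb
    rcases b with _ | _
    · simpa [cjc] using h2
    · refine ⟨?_, ?_⟩
      · simpa [cjc] using mul_mem (mul_mem (inv_mem hv) h2.1) hv
      · simp only [cjc, if_true]
        intro h3
        apply h2.2
        have : g = v * (v⁻¹ * g * v) * v⁻¹ := by group
        rw [this, h3]; group

section twist
variable {u : FreeGroup α} (hu : u ∈ KK c true) {τ : MulAut (FreeGroup α)}
  (h1 : ∀ g ∈ KK c true, τ g = u⁻¹ * g * u) (h0 : ∀ g ∈ KK c false, τ g = g)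
include hu h1 h0

lemma twist_pow_true (p : ℕ) {g : FreeGroup α} (hg : g ∈ KK c true) :
    (τ ^ p) g = (u ^ p)⁻¹ * g * u ^ p := by
  induction p with
  | zero => simp
  | succ p ih =>
    have hup := pow_mem hu p
    rw [pow_succ', MulAut.mul_apply, ih, h1 _ (mul_mem (mul_mem (inv_mem hup) hg) hup), pow_succ]
    group

lemma twist_pow_false (p : ℕ) {g : FreeGroup α} (hg : g ∈ KK c false) : (τ ^ p) g = g := by
  induction p with
  | zero => simp
  | succ p ih => rw [pow_succ', MulAut.mul_apply, ih, h0 _ hg]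

lemma twist_pow_prd (p : ℕ) {L : List (Bool × FreeGroup α)} (hL : Alt c L) :
    (τ ^ p) (prd L) = prd (L.map (cjc (u ^ p))) := by
  induction L with
  | nil => simp
  | cons a L ih =>
    obtain ⟨ha, hL', -⟩ := alt_cons.mp hL
    rw [prd_cons, map_mul, ih hL', List.map_cons, prd_cons]
    congr 1
    obtain ⟨b, g⟩ := a
    rcases b with _ | _
    · simpa [cjc] using twist_pow_false hu h1 h0 p ha.1
    · simpa [cjc] using twist_pow_true hu h1 h0 p ha.1

/-- If a partial conjugation preserves a conjugacy class, then the class meets a smaller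
subgroup. -/
theorem exists_conj_of_twist [Finite α] (hcu : SelfCent u) {b : FreeGroup α}
    (hb : IsConj b (τ b)) : ∃ b', IsConj b b' ∧
      (b' ∈ KK c true ∨ b' ∈ Subgroup.closure ({u} ∪ (KK c false : Set (FreeGroup α)))) := by
  obtain ⟨L, hL, hbL, hor⟩ := exists_conj_alt (c := c) b
  refine ⟨prd L, hbL, ?_⟩
  rcases hor with hlen | hcyc
  · match L, hlen with
    | [], _ => left; simp
    | [(true, g)], _ => left; simpa using (alt_singleton.mp hL).1
    | [(false, g)], _ =>
      right
      exact Subgroup.subset_closure (Or.inr (by simpa using (alt_singleton.mp hL).1))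
  right
  have hconj : ∀ p : ℕ, IsConj b ((τ ^ p) b) := by
    intro p
    induction p with
    | zero => exact IsConj.refl _
    | succ p ih =>
      have := hb.trans (MonoidHom.map_isConj τ.toMonoidHom ih)
      rw [pow_succ', MulAut.mul_apply]
      exact this
  have hbd : ∀ p : ℕ, ((L.map (cjc (u ^ p))).map fun a => a.2.norm).sum ≤ b.norm := by
    intro p
    have hA := alt_cjc (pow_mem hu p) hL
    rw [← norm_prd hA]
    refine norm_pow_conj hA ?_ ?_
    · intro x hx y hy
      rw [List.getLast?_map, Option.mem_def, Option.map_eq_some_iff] at hx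
      rw [List.head?_map, Option.mem_def, Option.map_eq_some_iff] at hy
      obtain ⟨x', hx', rfl⟩ := hx
      obtain ⟨y', hy', rfl⟩ := hy
      exact hcyc x' hx' y' hy'
    · rw [← twist_pow_prd hu h1 h0 p hL]
      exact (hconj p).trans (MonoidHom.map_isConj (τ ^ p).toMonoidHom hbL)
  rw [prd]
  refine Subgroup.list_prod_mem _ fun g hg => ?_
  obtain ⟨⟨a, g⟩, ha, rfl⟩ := List.mem_map.mp hg
  rcases a with _ | _
  · exact Subgroup.subset_closure (Or.inr (by simpa using (hL.2 _ ha).1))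
  · have hz : g ∈ Subgroup.zpowers u := by
      obtain ⟨p, q, hpq, he⟩ := exists_eq_of_norm_le (fun p => (u ^ p)⁻¹ * g * u ^ p) b.norm
        (fun p => by
          refine le_trans ?_ (hbd p)
          refine List.single_le_sum (by simp) _ ?_
          rw [List.map_map, List.mem_map]
          exact ⟨_, ha, by simp [cjc]⟩)
      apply hcu (q - p) (by omega) g
      obtain ⟨d, rfl⟩ := Nat.exists_eq_add_of_lt hpq
      have h6 : p + d + 1 - p = d + 1 := by omega
      rw [h6]
      rw [add_assoc, add_comm, pow_add] at he
      have : g = (u ^ (d + 1))⁻¹ * g * u ^ (d + 1) := by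
        calc g = u ^ p * ((u ^ p)⁻¹ * g * u ^ p) * (u ^ p)⁻¹ := by group
          _ = u ^ p * ((u ^ (d + 1) * u ^ p)⁻¹ * g * (u ^ (d + 1) * u ^ p)) * (u ^ p)⁻¹ := by rw [he]
          _ = _ := by group
      calc g * u ^ (d + 1) = u ^ (d + 1) * ((u ^ (d + 1))⁻¹ * g * u ^ (d + 1)) := by group
        _ = _ := by rw [← this]
    have hle : Subgroup.zpowers u ≤ Subgroup.closure ({u} ∪ (KK c false : Set (FreeGroup α))) := by
      rw [Subgroup.zpowers_eq_closure]
      exact Subgroup.closure_mono Set.subset_union_left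
    exact hle hz

/-- The elements on which a partial conjugation agrees with the full conjugation. -/
theorem mem_KK_of_twist [Finite α] (hu1 : u ≠ 1) {w : FreeGroup α} (hw : τ w = u⁻¹ * w * u) :
    w ∈ KK c true := by
  have hwp : ∀ p : ℕ, (τ ^ p) w = (u ^ p)⁻¹ * w * u ^ p := by
    intro p
    induction p with
    | zero => simp
    | succ p ih =>
      rw [pow_succ', MulAut.mul_apply, ih, map_mul, map_mul, map_inv, map_pow, hw, h1 u hu, pow_succ]
      group
  obtain ⟨s, hs, t, ht, L, hL, h2, h3, rfl⟩ := exists_strip c w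
  by_cases hn : L = []
  · subst hn; simpa using mul_mem hs ht
  exfalso
  have key : ∀ p : ℕ, (u ^ p).norm ≤ (prd L).norm := by
    intro p
    have h4 := hwp p
    rw [map_mul, map_mul, twist_pow_true hu h1 h0 p hs, twist_pow_true hu h1 h0 p ht,
      twist_pow_prd hu h1 h0 p hL] at h4
    have h5 : u ^ p * prd (L.map (cjc (u ^ p))) * (u ^ p)⁻¹ = prd L := by
      calc _ = s⁻¹ * (u ^ p * ((u ^ p)⁻¹ * s * u ^ p * prd (L.map (cjc (u ^ p))) *
            ((u ^ p)⁻¹ * t * u ^ p)) * (u ^ p)⁻¹) * t⁻¹ := by group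
        _ = _ := by rw [h4]; group
    have h6 := alt_conj (alt_cjc (pow_mem hu p) hL) (fun y hy => by
        rw [List.head?_map, Option.mem_def, Option.map_eq_some_iff] at hy
        obtain ⟨y', hy', rfl⟩ := hy
        exact h2 y' hy') (fun y hy => by
        rw [List.getLast?_map, Option.mem_def, Option.map_eq_some_iff] at hy
        obtain ⟨y', hy', rfl⟩ := hy
        exact h3 y' hy') (by simpa using hn) (pow_mem hu p) (inv_mem (pow_mem hu p))
    rw [h5] at h6
    omega
  obtain ⟨p, q, hpq, he⟩ := exists_eq_of_norm_le (fun p => u ^ p) _ key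
  apply pow_ne_one_of_free hu1 (q := q - p) (by omega)
  rw [pow_sub _ hpq.le, ← he, mul_inv_cancel]

end twist

end alt

section height
variable {α : Type*} [DecidableEq α] (χ : FreeGroup α →* Multiplicative ℤ)

/-- All prefixes of the word have height at most `C`. -/
def Bdd (C : ℕ) (L : List (α × Bool)) : Prop :=
  ∀ P, P <+: L → (Multiplicative.toAdd (χ (FreeGroup.mk P))).natAbs ≤ C

variable {χ}

lemma bdd_append {C : ℕ} {L M : List (α × Bool)} (hL : Bdd χ C L) (h1 : χ (FreeGroup.mk L) = 1)
    (hM : Bdd χ C M) : Bdd χ C (L ++ M) := by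
  rintro P ⟨T, hP⟩
  rcases List.append_eq_append_iff.mp hP with ⟨A, hA, -⟩ | ⟨A, rfl, hB⟩
  · exact hL P ⟨A, hA.symm⟩
  · have := hM A ⟨T, hB.symm⟩
    rwa [← FreeGroup.mul_mk, map_mul, h1, one_mul]

lemma Bdd.step {C : ℕ} {L M : List (α × Bool)} (h : FreeGroup.Red.Step L M) (hL : Bdd χ C L) :
    Bdd χ C M := by
  obtain @⟨L₁, L₂, x, b⟩ := h
  rintro P ⟨T, hP⟩
  rcases List.append_eq_append_iff.mp hP with ⟨A, rfl, -⟩ | ⟨A, rfl, hB⟩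
  · exact hL P (by simp)
  · have := hL (L₁ ++ (x, b) :: (x, !b) :: A) ⟨T, by simp [hB]⟩
    have h2 : FreeGroup.mk (L₁ ++ (x, b) :: (x, !b) :: A) = FreeGroup.mk (L₁ ++ A) :=
      Quot.sound FreeGroup.Red.Step.not
    rwa [h2] at this

lemma Bdd.red {C : ℕ} {L M : List (α × Bool)} (h : FreeGroup.Red L M) (hL : Bdd χ C L) :
    Bdd χ C M := by
  induction h with
  | refl => exact hL
  | tail _ h ih => exact ih.step h

lemma exists_bdd (L : List (α × Bool)) : ∃ C, Bdd χ C L := by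
  refine ⟨((L.inits.map fun P => (Multiplicative.toAdd (χ (FreeGroup.mk P))).natAbs)).sum, ?_⟩
  intro P hP
  apply List.single_le_sum (by simp)
  exact List.mem_map.mpr ⟨P, by simpa using hP, rfl⟩

lemma Bdd.mono {C D : ℕ} (h : C ≤ D) {L : List (α × Bool)} (hL : Bdd χ C L) : Bdd χ D L :=
  fun P hP => (hL P hP).trans h

/-- A finitely generated subgroup in the kernel has bounded heights. -/
lemma exists_bdd_of_fg {M : Subgroup (FreeGroup α)} (hM : M.FG) (h1 : ∀ m ∈ M, χ m = 1) :
    ∃ C, ∀ m ∈ M, Bdd χ C m.toWord := by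
  rw [Subgroup.fg_iff_submonoid_fg] at hM
  obtain ⟨S, hS⟩ := hM
  choose B hB using fun w : FreeGroup α => exists_bdd (χ := χ) w.toWord
  refine ⟨∑ w ∈ S, B w, fun m hm => ?_⟩
  have hm' : m ∈ Submonoid.closure (S : Set (FreeGroup α)) := by rw [hS]; exact hm
  have key : χ m = 1 ∧ Bdd χ (∑ w ∈ S, B w) m.toWord := by
    clear hm
    induction hm' using Submonoid.closure_induction with
    | mem x hx =>
      refine ⟨h1 x ?_, (hB x).mono (Finset.single_le_sum (f := B) (by simp) hx)⟩
      change x ∈ M.toSubmonoid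
      rw [← hS]; exact Submonoid.subset_closure hx
    | one => exact ⟨by simp, fun P hP => by
        rw [FreeGroup.toWord_one, List.prefix_nil] at hP
        subst hP; simp [← FreeGroup.one_eq_mk]⟩
    | mul x y _ _ hx hy =>
      refine ⟨by rw [map_mul, hx.1, hy.1, one_mul], ?_⟩
      rw [FreeGroup.toWord_mul]
      exact (bdd_append hx.2 (by rw [FreeGroup.mk_toWord]; exact hx.1) hy.2).red
        FreeGroup.reduce.red
  exact key.2

/-- A finitely generated normal subgroup of a free group on which a nonzero height vanishes is
trivial. -/
theorem eq_one_of_fg_normal {M : Subgroup (FreeGroup α)} [M.Normal] (hM : M.FG)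
    (h1 : ∀ m ∈ M, χ m = 1) (hχ : χ ≠ 1) {m : FreeGroup α} (hm : m ∈ M) : m = 1 := by
  obtain ⟨x, hx⟩ : ∃ x, χ (FreeGroup.of x) ≠ 1 := by
    by_contra! h
    exact hχ (FreeGroup.ext_hom _ _ fun x => by simpa using h x)
  obtain ⟨C, hC⟩ := exists_bdd_of_fg hM h1
  obtain ⟨s, hs, t, ht, L, hL, h2, h3, rfl⟩ := exists_strip (fun y => decide (y = x)) m
  rw [KK_single] at hs ht
  obtain ⟨i, rfl⟩ := hs
  obtain ⟨j, rfl⟩ := ht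
  simp only at hm ⊢
  by_cases hn : L = []
  · subst hn
    have := h1 _ hm
    simp only [prd_nil, mul_one, ← zpow_add, map_zpow] at this ⊢
    have h5 : i + j = 0 := by
      by_contra h
      apply hx
      rw [← toAdd_eq_zero]
      have h6 := congrArg Multiplicative.toAdd this
      rw [toAdd_zpow, smul_eq_mul, toAdd_one] at h6
      exact (mul_eq_zero.mp h6).resolve_left h
    rw [h5, zpow_zero]
  exfalso
  set n : ℤ := C + 1 with hn'
  have hm2 : FreeGroup.of x ^ n * prd L * FreeGroup.of x ^ (j + i - n) ∈ M := by
    have := Subgroup.Normal.conj_mem ‹M.Normal› _ hm (FreeGroup.of x ^ (n - i))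
    convert this using 1
    rw [← zpow_neg, show FreeGroup.of x ^ n = FreeGroup.of x ^ (n - i) * FreeGroup.of x ^ i by
      rw [← zpow_add]; congr 1; ring,
      show FreeGroup.of x ^ (j + i - n) = FreeGroup.of x ^ j * FreeGroup.of x ^ (-(n - i)) by
      rw [← zpow_add]; congr 1; ring]
    simp only [mul_assoc]
  have hmem : ∀ l : ℤ, FreeGroup.of x ^ l ∈ KK (fun y => decide (y = x)) true := by
    intro l; rw [KK_single]; exact ⟨l, rfl⟩
  have h6 := alt_conj hL h2 h3 hn (hmem n) (hmem (j + i - n))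
  have h7 : (FreeGroup.of x ^ n * prd L * FreeGroup.of x ^ (j + i - n)).toWord =
      (FreeGroup.of x ^ n).toWord ++ (prd L * FreeGroup.of x ^ (j + i - n)).toWord := by
    rw [mul_assoc]
    apply (FreeGroup.toWord_mul_sublist _ _).eq_of_length_le
    have h8 := FreeGroup.norm_mul_le (prd L) (FreeGroup.of x ^ (j + i - n))
    rw [List.length_append]
    rw [mul_assoc] at h6
    simp only [FreeGroup.norm] at h6 h8
    omega
  have h9 := hC _ hm2 (FreeGroup.of x ^ n).toWord (by rw [h7]; simp)
  rw [FreeGroup.mk_toWord, map_zpow, toAdd_zpow, smul_eq_mul, Int.natAbs_mul] at h9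
  have h10 : 1 ≤ (Multiplicative.toAdd (χ (FreeGroup.of x))).natAbs := by
    rw [Nat.one_le_iff_ne_zero, Ne, Int.natAbs_eq_zero]
    exact fun h => hx (by simpa using h)
  have h11 : n.natAbs = C + 1 := by omega
  rw [h11] at h9
  nlinarith

end height
end BraidHol

namespace BraidHol

/-- The exponent sum of a letter. -/
def ex (m i : ℕ) : FG m →* Multiplicative ℤ :=
  FG.lift m fun j => if j = i then Multiplicative.ofAdd 1 else 1

lemma ex_self {m i : ℕ} (h : i < m) : ex m i (xg m i) = Multiplicative.ofAdd 1 := by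
  rw [ex, FG.lift_xg _ h, if_pos rfl]

lemma ex_of_ne {m i j : ℕ} (h : j ≠ i) : ex m i (xg m j) = 1 := by
  by_cases hj : j < m
  · rw [ex, FG.lift_xg _ hj, if_neg h]
  · rw [xg, dif_neg hj, map_one]

lemma eq_zero_of_ofAdd_zpow {a : ℤ} (h : (Multiplicative.ofAdd (1 : ℤ)) ^ a = 1) : a = 0 := by
  have := congrArg Multiplicative.toAdd h
  simpa using this

lemma selfCent_xg {m i : ℕ} (h : i < m) : SelfCent (xg m i) := by
  rw [xg_of_lt h]; exact selfCent_of _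

lemma SelfCent.mem_of_comm {G : Type*} [Group G] {u w : G} (h : SelfCent u) (hw : w * u = u * w) :
    w ∈ Subgroup.zpowers u := h 1 one_pos w (by simpa using hw)

/-- The transvection multiplying one letter by another. -/
def tvAut {m i j : ℕ} (hi : i < m) (hj : j < m) (hij : i ≠ j) : MulAut (FG m) :=
  MonoidHom.toMulEquiv
    (FG.lift m fun a => if a = i then xg m i * xg m j else xg m a)
    (FG.lift m fun a => if a = i then xg m i * (xg m j)⁻¹ else xg m a)
    (FG.hom_ext fun a ha => by
      by_cases h : a = i
      · subst h
        simp [FG.lift_xg _ hi, FG.lift_xg _ hj, hij.symm]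
      · simp [FG.lift_xg _ ha, h])
    (FG.hom_ext fun a ha => by
      by_cases h : a = i
      · subst h
        simp [FG.lift_xg _ hi, FG.lift_xg _ hj, hij.symm]
      · simp [FG.lift_xg _ ha, h])

lemma tvAut_self {m i j : ℕ} (hi : i < m) (hj : j < m) (hij : i ≠ j) :
    tvAut hi hj hij (xg m i) = xg m i * xg m j := by
  change FG.lift m (fun a => if a = i then xg m i * xg m j else xg m a) (xg m i) = _
  rw [FG.lift_xg _ hi, if_pos rfl]

lemma selfCent_xg_mul_xg {m i j : ℕ} (hi : i < m) (hj : j < m) (hij : i ≠ j) :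
    SelfCent (xg m i * xg m j) := by
  rw [← tvAut_self hi hj hij]
  exact (selfCent_xg hi).map _

lemma FG.exists_not_commute {m : ℕ} (hm : 2 ≤ m) {f : FG m} (h : ∀ g, f * g = g * f) : f = 1 := by
  obtain ⟨i, hi⟩ := (selfCent_xg (show 0 < m by omega)).mem_of_comm (h _)
  obtain ⟨j, hj⟩ := (selfCent_xg (show 1 < m by omega)).mem_of_comm (h _)
  simp only at hi hj
  have h1 := congrArg (ex m 0) (hi.trans hj.symm)
  rw [map_zpow, map_zpow, ex_self (by omega), ex_of_ne (by omega), one_zpow] at h1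
  rw [← hi, eq_zero_of_ofAdd_zpow h1, zpow_zero]

/-- Colouring two adjacent letters. -/
def pc (m j : ℕ) (x : Fin m) : Bool := decide (x.1 = j ∨ x.1 = j + 1)

lemma KK_pc_true_le {m j : ℕ} {H : Subgroup (FG m)} (h : xg m j ∈ H) (h' : xg m (j + 1) ∈ H) :
    KK (pc m j) true ≤ H := by
  rw [KK, Subgroup.closure_le]
  rintro _ ⟨⟨a, ha⟩, h1, rfl⟩
  rw [Set.mem_ofPred_eq, pc, decide_eq_true_eq] at h1
  rw [← xg_of_lt ha]
  rcases h1 with h1 | h1 <;> simp only at h1 <;> subst h1 <;> assumption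

lemma KK_pc_false_le {m j : ℕ} {H : Subgroup (FG m)}
    (h : ∀ i < m, i ≠ j → i ≠ j + 1 → xg m i ∈ H) : KK (pc m j) false ≤ H := by
  rw [KK, Subgroup.closure_le]
  rintro _ ⟨⟨a, ha⟩, h1, rfl⟩
  rw [Set.mem_ofPred_eq, pc, decide_eq_false_iff_not] at h1
  rw [← xg_of_lt ha]
  exact h a ha (fun h2 => h1 (Or.inl h2)) fun h2 => h1 (Or.inr h2)

lemma xg_mem_KK_pc {m j i : ℕ} (hi : i < m) (h : i = j ∨ i = j + 1) :
    xg m i ∈ KK (pc m j) true := by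
  rw [xg_of_lt hi]
  convert of_mem_KK (c := pc m j) ⟨i, hi⟩
  simp [pc, h]

section twist
variable {k j : ℕ} (h : j < k)
include h

lemma art_sg_sq_true {g : FG (k + 1)} (hg : g ∈ KK (pc (k + 1) j) true) :
    art k (sg k j ^ 2) g =
      (xg (k + 1) j * xg (k + 1) (j + 1))⁻¹ * g * (xg (k + 1) j * xg (k + 1) (j + 1)) := by
  let φ : FG (k + 1) →* FG (k + 1) := (art k (sg k j ^ 2)).toMonoidHom
  let ψ : FG (k + 1) →* FG (k + 1) :=
    (MulAut.conj (xg (k + 1) j * xg (k + 1) (j + 1))⁻¹).toMonoidHom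
  have key : KK (pc (k + 1) j) true ≤ φ.eqLocus ψ := by
    apply KK_pc_true_le
    · change art k (sg k j ^ 2) _ = MulAut.conj _ _
      rw [map_pow, pow_two, MulAut.mul_apply, art_self h, art_succ h, MulAut.conj_apply]
      group
    · change art k (sg k j ^ 2) _ = MulAut.conj _ _
      rw [map_pow, pow_two, MulAut.mul_apply, art_succ h, map_mul, map_mul, map_inv, art_self h,
        art_succ h, MulAut.conj_apply]
      group
  have h1 : φ g = ψ g := key hg
  change art k (sg k j ^ 2) g = MulAut.conj _ _ at h1
  rw [h1, MulAut.conj_apply, inv_inv]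

lemma art_sg_sq_false {g : FG (k + 1)} (hg : g ∈ KK (pc (k + 1) j) false) :
    art k (sg k j ^ 2) g = g := by
  let φ : FG (k + 1) →* FG (k + 1) := (art k (sg k j ^ 2)).toMonoidHom
  have key : KK (pc (k + 1) j) false ≤ φ.eqLocus (MonoidHom.id _) := by
    apply KK_pc_false_le
    intro i hi h1 h2
    change art k (sg k j ^ 2) _ = xg (k + 1) i
    rw [map_pow, pow_two, MulAut.mul_apply, art_of_ne h hi h1 h2, art_of_ne h hi h1 h2]
  exact key hg

lemma ex_art_sg_sq (χ : FG (k + 1) →* Multiplicative ℤ) (g : FG (k + 1)) :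
    χ (art k (sg k j ^ 2) g) = χ g := by
  let φ : FG (k + 1) →* FG (k + 1) := (art k (sg k j ^ 2)).toMonoidHom
  suffices χ.comp φ = χ from DFunLike.congr_fun this g
  refine FG.hom_ext fun i hi => ?_
  change χ (art k (sg k j ^ 2) _) = _
  by_cases h1 : i = j ∨ i = j + 1
  · rw [art_sg_sq_true h (xg_mem_KK_pc hi h1)]
    rw [map_mul, map_mul, map_inv, mul_right_comm, inv_mul_cancel, one_mul]
  · rw [map_pow, pow_two, MulAut.mul_apply, art_of_ne h hi (by omega) (by omega),
      art_of_ne h hi (by omega) (by omega)]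

end twist
end BraidHol

namespace BraidHol

/-- Automorphisms of the free group which act trivially on its abelianization and commute with the
braid group up to inner automorphisms. -/
structure Good (k : ℕ) (α : MulAut (FG (k + 1))) : Prop where
  ab : ∀ (χ : FG (k + 1) →* Multiplicative ℤ) g, χ (α g) = χ g
  cj : ∀ i < k, ∃ f, ∀ x, α (art k (sg k i) x) = f * art k (sg k i) (α x) * f⁻¹

namespace Good
variable {k : ℕ} {α : MulAut (FG (k + 1))} (hα : Good k α)
include hα

lemma comm (b : Br k) : ∃ f, ∀ x, α (art k b x) = f * art k b (α x) * f⁻¹ := by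
  let H : Subgroup (Br k) :=
    { carrier := {b | ∃ f, ∀ x, α (art k b x) = f * art k b (α x) * f⁻¹}
      one_mem' := ⟨1, by simp⟩
      mul_mem' := by
        rintro a b ⟨f, hf⟩ ⟨g, hg⟩
        refine ⟨f * art k a g, fun x => ?_⟩
        rw [map_mul, MulAut.mul_apply, hf, hg, MulAut.mul_apply]
        simp only [map_mul, map_inv]
        group
      inv_mem' := by
        rintro a ⟨f, hf⟩
        refine ⟨(art k a)⁻¹ f⁻¹, fun x => ?_⟩
        have h1 := hf ((art k a)⁻¹ x)
        rw [MulAut.apply_inv_self] at h1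
        apply (art k a).injective
        rw [map_inv, map_mul, map_mul, map_inv (art k a), MulAut.apply_inv_self,
          MulAut.apply_inv_self, h1]
        group }
  exact Br.mem_of_sg H (fun i hi => hα.cj i hi) b

lemma conj_twist {j : ℕ} (h : ∃ g, art k (sg k j ^ 2) (xg (k + 1) 0) =
    g * xg (k + 1) 0 * g⁻¹) :
    IsConj (α (xg (k + 1) 0)) (art k (sg k j ^ 2) (α (xg (k + 1) 0))) := by
  obtain ⟨g, hg⟩ := h
  obtain ⟨f, hf⟩ := hα.comm (sg k j ^ 2)
  have h1 := hf (xg (k + 1) 0)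
  rw [hg] at h1
  rw [isConj_iff]
  refine ⟨f⁻¹ * α g, ?_⟩
  calc _ = f⁻¹ * α (g * xg (k + 1) 0 * g⁻¹) * f := by simp only [map_mul, map_inv]; group
    _ = _ := by rw [h1]; group

lemma isConj_zero (hk : 2 ≤ k) : IsConj (α (xg (k + 1) 0)) (xg (k + 1) 0) := by
  have hχ : ∀ {χ : FG (k + 1) →* Multiplicative ℤ} {b'},
      IsConj (α (xg (k + 1) 0)) b' → χ b' = χ (xg (k + 1) 0) := by
    intro χ b' h
    rw [← hα.ab χ (xg (k + 1) 0), ← isConj_iff_eq]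
    exact (χ.map_isConj h).symm
  obtain ⟨b₁, hb₁, h1⟩ : ∃ b₁, IsConj (α (xg (k + 1) 0)) b₁ ∧ b₁ ∈ KK (pc (k + 1) 0) true := by
    have h0 : 0 < k := by omega
    have h01 : xg (k + 1) 0 * xg (k + 1) (0 + 1) ∈ KK (pc (k + 1) 0) true :=
      mul_mem (xg_mem_KK_pc (by omega) (by simp)) (xg_mem_KK_pc (by omega) (by simp))
    obtain ⟨b₁, hb₁, h | h⟩ := exists_conj_of_twist h01 (fun g hg => art_sg_sq_true h0 hg)
      (fun g hg => art_sg_sq_false h0 hg) (selfCent_xg_mul_xg (by omega) (by omega) (by omega))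
      (hα.conj_twist ⟨_, by
        rw [art_sg_sq_true h0 (xg_mem_KK_pc (by omega) (by simp)), inv_mul_eq_iff_eq_mul.symm]
        rw [inv_mul_eq_iff_eq_mul]
        nth_rw 2 [← inv_inv (xg (k + 1) 0 * xg (k + 1) (0 + 1))]⟩)
    · exact ⟨b₁, hb₁, h⟩
    exfalso
    have h3 : Subgroup.closure ({xg (k + 1) 0 * xg (k + 1) (0 + 1)} ∪
        (KK (pc (k + 1) 0) false : Set (FG (k + 1)))) ≤ (ex (k + 1) 0 / ex (k + 1) 1).ker := by
      rw [Subgroup.closure_le, Set.union_subset_iff, Set.singleton_subset_iff]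
      refine ⟨?_, KK_pc_false_le fun i hi h3 h4 => ?_⟩
      · rw [SetLike.mem_coe, MonoidHom.mem_ker, MonoidHom.div_apply, map_mul, map_mul,
          ex_self (by omega), ex_of_ne (by omega), ex_of_ne (by omega), ex_self (by omega)]
        simp
      · rw [MonoidHom.mem_ker, MonoidHom.div_apply, ex_of_ne (by omega), ex_of_ne (by omega)]
        simp
    have h4 := h3 h
    rw [MonoidHom.mem_ker, hχ hb₁, MonoidHom.div_apply, ex_self (by omega), ex_of_ne (by omega),
      div_one] at h4
    simp at h4
  obtain ⟨b₂, hb₂, h2⟩ : ∃ b₂, IsConj (α (xg (k + 1) 0)) b₂ ∧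
      b₂ ∈ Subgroup.closure ({xg (k + 1) 1 * xg (k + 1) (1 + 1)} ∪
        (KK (pc (k + 1) 1) false : Set (FG (k + 1)))) := by
    have h0 : 1 < k := by omega
    have h01 : xg (k + 1) 1 * xg (k + 1) (1 + 1) ∈ KK (pc (k + 1) 1) true :=
      mul_mem (xg_mem_KK_pc (by omega) (by simp)) (xg_mem_KK_pc (by omega) (by simp))
    obtain ⟨b₁, hb₁, h | h⟩ := exists_conj_of_twist h01 (fun g hg => art_sg_sq_true h0 hg)
      (fun g hg => art_sg_sq_false h0 hg) (selfCent_xg_mul_xg (by omega) (by omega) (by omega))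
      (hα.conj_twist ⟨1, by
        rw [map_pow, pow_two, MulAut.mul_apply, art_of_ne h0 (by omega) (by omega) (by omega),
          art_of_ne h0 (by omega) (by omega) (by omega)]
        simp⟩)
    · exfalso
      have h3 : KK (pc (k + 1) 1) true ≤ (ex (k + 1) 0).ker :=
        KK_pc_true_le (by rw [MonoidHom.mem_ker, ex_of_ne (by omega)])
          (by rw [MonoidHom.mem_ker, ex_of_ne (by omega)])
      have h4 := h3 h
      rw [MonoidHom.mem_ker, hχ hb₁, ex_self (by omega)] at h4
      simp at h4
    · exact ⟨b₁, hb₁, h⟩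
  let μ : FG (k + 1) →* FG (k + 1) := FG.lift (k + 1) fun i =>
    if i = 1 then 1 else if i = 2 then xg (k + 1) 1 * xg (k + 1) 2 else xg (k + 1) i
  have hμ2 : μ b₂ = b₂ := by
    have h3 : Subgroup.closure ({xg (k + 1) 1 * xg (k + 1) (1 + 1)} ∪
        (KK (pc (k + 1) 1) false : Set (FG (k + 1)))) ≤ μ.eqLocus (MonoidHom.id _) := by
      rw [Subgroup.closure_le, Set.union_subset_iff, Set.singleton_subset_iff]
      refine ⟨?_, KK_pc_false_le fun i hi h3 h4 => ?_⟩
      · change μ _ = xg (k + 1) 1 * xg (k + 1) (1 + 1)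
        rw [map_mul, FG.lift_xg _ (by omega), FG.lift_xg _ (by omega)]
        simp
      · change μ _ = xg (k + 1) i
        rw [FG.lift_xg _ hi, if_neg h3, if_neg h4]
    exact h3 h2
  obtain ⟨a, ha⟩ : μ b₁ ∈ Subgroup.zpowers (xg (k + 1) 0) := by
    have h3 : KK (pc (k + 1) 0) true ≤ (Subgroup.zpowers (xg (k + 1) 0)).comap μ := by
      apply KK_pc_true_le
      · rw [Subgroup.mem_comap, FG.lift_xg _ (by omega)]
        exact ⟨1, by simp⟩
      · rw [Subgroup.mem_comap, FG.lift_xg _ (by omega)]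
        exact ⟨0, by simp⟩
    exact h3 h1
  have h5 : IsConj (α (xg (k + 1) 0)) (xg (k + 1) 0 ^ a) := by
    refine hb₂.trans ?_
    have := μ.map_isConj (hb₂.symm.trans hb₁)
    rw [hμ2] at this
    simp only at ha
    rwa [ha]
  have h6 := hχ (χ := ex (k + 1) 0) h5
  rw [map_zpow, ex_self (by omega)] at h6
  have h7 : a = 1 := by simpa using congrArg Multiplicative.toAdd h6
  rwa [h7, zpow_one] at h5

lemma pair (hk : 2 ≤ k) : ∃ h₀ h₁, α (xg (k + 1) 0) = h₀ * xg (k + 1) 0 * h₀⁻¹ ∧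
    α (xg (k + 1) 1) = h₁ * xg (k + 1) 1 * h₁⁻¹ ∧ h₀⁻¹ * h₁ ∈ KK (pc (k + 1) 0) true := by
  obtain ⟨h₀, h0⟩ := isConj_iff.mp (hα.isConj_zero hk).symm
  have hk0 : 0 < k := by omega
  obtain ⟨f₀, hf₀⟩ := hα.comm (sg k 0)
  have h1 := hf₀ (xg (k + 1) 0)
  rw [art_self hk0, ← h0] at h1
  simp only [map_mul, map_inv, art_self hk0, zero_add] at h1
  set h₁ := f₀ * art k (sg k 0) h₀ with hh₁
  have h1' : α (xg (k + 1) 1) = h₁ * xg (k + 1) 1 * h₁⁻¹ := by rw [h1, hh₁]; group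
  refine ⟨h₀, h₁, h0.symm, h1', ?_⟩
  set u := xg (k + 1) 0 * xg (k + 1) (0 + 1) with hu
  have hu0 : u ∈ KK (pc (k + 1) 0) true :=
      mul_mem (xg_mem_KK_pc (by omega) (by simp)) (xg_mem_KK_pc (by omega) (by simp))
  have hu1 : u ≠ 1 := by
    intro h
    have := congrArg (ex (k + 1) 0) h
    rw [hu, map_mul, ex_self (by omega), ex_of_ne (by omega), map_one (ex (k + 1) 0)] at this
    simp at this
  obtain ⟨f, hf⟩ := hα.comm (sg k 0 ^ 2)
  set τ := art k (sg k 0 ^ 2) with hτ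
  have key : ∀ x h, SelfCent x → τ x = u⁻¹ * x * u → α x = h * x * h⁻¹ →
      h⁻¹ * (α u * f) * τ h * u⁻¹ ∈ Subgroup.zpowers x := by
    intro x h hx hτx hαx
    apply hx.mem_of_comm
    have h2 := hf x
    have h3 : α (u⁻¹ * x * u) = (α u)⁻¹ * α x * α u := by simp only [map_mul, map_inv]
    have h4 : τ (h * x * h⁻¹) = τ h * τ x * (τ h)⁻¹ := by simp only [map_mul, map_inv]
    rw [hτx, h3, hαx, h4, hτx] at h2
    calc _ = h⁻¹ * α u * (f * (τ h * (u⁻¹ * x * u) * (τ h)⁻¹) * f⁻¹) * f * τ h * u⁻¹ := by group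
      _ = _ := by rw [← h2]; group
  obtain ⟨a, ha⟩ := key _ _ (selfCent_xg (by omega))
    (art_sg_sq_true hk0 (xg_mem_KK_pc (by omega) (by simp))) h0.symm
  obtain ⟨b, hb⟩ := key _ _ (selfCent_xg (by omega))
    (art_sg_sq_true hk0 (xg_mem_KK_pc (by omega) (by simp))) h1'
  simp only at ha hb
  have hχ : ∀ (χ : FG (k + 1) →* Multiplicative ℤ) h, χ (h⁻¹ * (α u * f) * τ h * u⁻¹) = χ f := by
    intro χ h
    have h3 := ex_art_sg_sq hk0 χ h
    rw [map_mul, map_mul, map_mul, map_mul, hα.ab, map_inv, map_inv, ← hτ] at *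
    rw [h3]
    rw [mul_comm (χ h)⁻¹, mul_assoc (χ u * χ f), inv_mul_cancel, mul_one, mul_comm (χ u),
      mul_inv_cancel_right]
  have h00 := congrArg (ex (k + 1) 0) ha
  have h01 := congrArg (ex (k + 1) 0) hb
  have h10 := congrArg (ex (k + 1) 1) ha
  have h11 := congrArg (ex (k + 1) 1) hb
  rw [hχ, map_zpow, ex_self (by omega)] at h00 h11
  rw [hχ, map_zpow, ex_of_ne (by omega), one_zpow] at h01 h10
  have ha0 := eq_zero_of_ofAdd_zpow (h00.trans h01.symm)
  have hb0 := eq_zero_of_ofAdd_zpow (h11.trans h10.symm)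
  rw [ha0, zpow_zero] at ha
  rw [hb0, zpow_zero] at hb
  refine mem_KK_of_twist hu0 (fun g hg => art_sg_sq_true hk0 hg)
      (fun g hg => art_sg_sq_false hk0 hg) hu1 ?_
  rw [← hτ, map_mul, map_inv]
  have e0 : τ h₀ = (α u * f)⁻¹ * h₀ * (h₀⁻¹ * (α u * f) * τ h₀ * u⁻¹) * u := by group
  have e1 : τ h₁ = (α u * f)⁻¹ * h₁ * (h₁⁻¹ * (α u * f) * τ h₁ * u⁻¹) * u := by group
  rw [e0, e1, ← ha, ← hb]
  group

lemma pair_of (hk : 2 ≤ k) {β : Br k} {a b : ℕ} (ha : art k β (xg (k + 1) 0) = xg (k + 1) a)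
    (hb : art k β (xg (k + 1) 1) = xg (k + 1) b) :
    ∃ h₀ h₁, α (xg (k + 1) a) = h₀ * xg (k + 1) a * h₀⁻¹ ∧
    α (xg (k + 1) b) = h₁ * xg (k + 1) b * h₁⁻¹ ∧
    h₀⁻¹ * h₁ ∈ Subgroup.closure {xg (k + 1) a, xg (k + 1) b} := by
  obtain ⟨h₀, h₁, h0, h1, h2⟩ := hα.pair hk
  obtain ⟨f, hf⟩ := hα.comm β
  refine ⟨f * art k β h₀, f * art k β h₁, ?_, ?_, ?_⟩
  · rw [← ha, hf, h0, map_mul, map_mul, map_inv]; group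
  · rw [← hb, hf, h1, map_mul, map_mul, map_inv]; group
  · have h3 : KK (pc (k + 1) 0) true ≤ (Subgroup.closure {xg (k + 1) a, xg (k + 1) b}).comap
        (art k β).toMonoidHom := by
      apply KK_pc_true_le
      · change art k β (xg (k + 1) 0) ∈ Subgroup.closure {xg (k + 1) a, xg (k + 1) b}
        rw [ha]; exact Subgroup.subset_closure (by simp)
      · change art k β (xg (k + 1) (0 + 1)) ∈ Subgroup.closure {xg (k + 1) a, xg (k + 1) b}
        rw [hb]; exact Subgroup.subset_closure (by simp)
    have h4 : art k β (h₀⁻¹ * h₁) ∈ Subgroup.closure {xg (k + 1) a, xg (k + 1) b} := h3 h2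
    convert h4 using 1
    rw [map_mul, map_inv]; group

end Good

lemma exists_art_fix {k j : ℕ} (h1 : 1 ≤ j) (hj : j ≤ k) : ∃ β : Br k,
    art k β (xg (k + 1) 0) = xg (k + 1) 0 ∧ art k β (xg (k + 1) 1) = xg (k + 1) j := by
  induction j, h1 using Nat.le_induction with
  | base => exact ⟨1, by simp, by simp⟩
  | succ j h1 ih =>
    obtain ⟨β, h2, h3⟩ := ih (by omega)
    refine ⟨sg k j * β, ?_, ?_⟩
    · rw [map_mul, MulAut.mul_apply, h2, art_of_ne (by omega) (by omega) (by omega) (by omega)]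
    · rw [map_mul, MulAut.mul_apply, h3, art_self (by omega)]

/-- Killing a letter. -/
def kil (m i : ℕ) : FG m →* FG m := FG.lift m fun a => if a = i then 1 else xg m a

lemma kil_self {m i : ℕ} (h : i < m) : kil m i (xg m i) = 1 := by
  rw [kil, FG.lift_xg _ h, if_pos rfl]

lemma kil_of_ne {m i a : ℕ} (h : a < m) (ha : a ≠ i) : kil m i (xg m a) = xg m a := by
  rw [kil, FG.lift_xg _ h, if_neg ha]

lemma kil_pair_left {m a b : ℕ} (ha : a < m) (hb : b < m) (hab : a ≠ b) {w : FG m}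
    (hw : w ∈ Subgroup.closure {xg m a, xg m b}) : kil m b w ∈ Subgroup.zpowers (xg m a) := by
  have : Subgroup.closure {xg m a, xg m b} ≤ (Subgroup.zpowers (xg m a)).comap (kil m b) := by
    rw [Subgroup.closure_le]
    rintro _ (rfl | rfl)
    · rw [SetLike.mem_coe, Subgroup.mem_comap, kil_of_ne ha hab]; exact ⟨1, by simp⟩
    · rw [SetLike.mem_coe, Subgroup.mem_comap, kil_self hb]; exact one_mem _
  exact this hw

lemma kil_pair {m a b i : ℕ} (ha : a < m) (hb : b < m) (hai : a ≠ i) (hbi : b ≠ i) {w : FG m}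
    (hw : w ∈ Subgroup.closure {xg m a, xg m b}) : kil m i w = w := by
  have : Subgroup.closure {xg m a, xg m b} ≤ (kil m i).eqLocus (MonoidHom.id _) := by
    rw [Subgroup.closure_le]
    rintro _ (rfl | rfl)
    · exact kil_of_ne ha hai
    · exact kil_of_ne hb hbi
  exact this hw

/-- Such automorphisms are inner when there are at least three letters. -/
theorem Good.inner {k : ℕ} (hk : 2 ≤ k) {α : MulAut (FG (k + 1))} (hα : Good k α) :
    ∃ h, ∀ x, α x = h * x * h⁻¹ := by
  obtain ⟨h₀, h0⟩ := isConj_iff.mp (hα.isConj_zero hk).symm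
  have cen : ∀ {i : ℕ} {h h' : FG (k + 1)}, i < k + 1 →
      h * xg (k + 1) i * h⁻¹ = h' * xg (k + 1) i * h'⁻¹ →
      ∃ a : ℤ, h' = h * xg (k + 1) i ^ a := by
    intro i h h' hi he
    obtain ⟨a, ha⟩ := (selfCent_xg hi).mem_of_comm (w := h⁻¹ * h') (by
      calc _ = h⁻¹ * (h' * xg (k + 1) i * h'⁻¹) * h' := by group
        _ = _ := by rw [← he]; group)
    exact ⟨a, by simp only at ha; rw [ha]; group⟩
  have hw : ∀ j, 1 ≤ j → j < k + 1 → ∃ w ∈ Subgroup.closure {xg (k + 1) 0, xg (k + 1) j},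
      α (xg (k + 1) j) = h₀ * w * xg (k + 1) j * (h₀ * w)⁻¹ := by
    intro j h1 hj
    obtain ⟨β, hb0, hb1⟩ := exists_art_fix h1 (show j ≤ k by omega)
    obtain ⟨h, h', e0, e1, e2⟩ := hα.pair_of hk hb0 hb1
    rw [← h0] at e0
    obtain ⟨a, rfl⟩ := cen (by omega) e0
    refine ⟨h₀⁻¹ * h', ?_, by rw [e1]; group⟩
    have : h₀⁻¹ * h' = xg (k + 1) 0 ^ a * ((h₀ * xg (k + 1) 0 ^ a)⁻¹ * h') := by group
    rw [this]
    exact mul_mem (zpow_mem (Subgroup.subset_closure (by simp)) _) e2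
  obtain ⟨w₁, hw1, e1⟩ := hw 1 le_rfl (by omega)
  have key : ∀ j, 2 ≤ j → j < k + 1 → ∃ p q r : ℤ, w₁ = xg (k + 1) 0 ^ p * xg (k + 1) 1 ^ q ∧
      α (xg (k + 1) j) = h₀ * (xg (k + 1) 0 ^ p * xg (k + 1) j ^ r) * xg (k + 1) j *
        (h₀ * (xg (k + 1) 0 ^ p * xg (k + 1) j ^ r))⁻¹ := by
    intro j h2 hj
    obtain ⟨w, hwj, ej⟩ := hw j (by omega) hj
    obtain ⟨β, hb0, hb1⟩ := exists_art_fix (show 1 ≤ j by omega) (show j ≤ k by omega)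
    obtain ⟨h, h', f0, f1, f2⟩ := hα.pair_of hk (β := sg k 0 * β) (a := 1) (b := j)
      (by rw [map_mul, MulAut.mul_apply, hb0, art_self (by omega)])
      (by rw [map_mul, MulAut.mul_apply, hb1,
            art_of_ne (by omega) (by omega) (by omega) (by omega)])
    rw [e1] at f0
    rw [ej] at f1
    obtain ⟨a, rfl⟩ := cen (by omega) f0
    obtain ⟨b, rfl⟩ := cen (by omega) f1
    have f3 : w₁⁻¹ * w ∈ Subgroup.closure {xg (k + 1) 1, xg (k + 1) j} := by
      have : w₁⁻¹ * w = xg (k + 1) 1 ^ a * ((h₀ * w₁ * xg (k + 1) 1 ^ a)⁻¹ *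
        (h₀ * w * xg (k + 1) j ^ b)) * xg (k + 1) j ^ (-b) := by group
      rw [this]
      exact mul_mem (mul_mem (zpow_mem (Subgroup.subset_closure (by simp)) _) f2)
        (zpow_mem (Subgroup.subset_closure (by simp)) _)
    obtain ⟨p, hp⟩ := kil_pair_left (by omega) (by omega) (by omega) hwj
    obtain ⟨q, hq⟩ := kil_pair_left (by omega) (by omega) (by omega) f3
    rw [map_mul, map_inv, kil_pair (by omega) (by omega) (by omega) (by omega) hw1] at hq
    simp only at hp hq
    rw [← hp] at hq
    have hw1' : w₁ = xg (k + 1) 0 ^ p * xg (k + 1) 1 ^ (-q) := by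
      rw [zpow_neg, hq]; group
    rw [Set.pair_comm] at f3
    obtain ⟨r, hr⟩ := kil_pair_left (by omega) (by omega) (by omega) f3
    rw [map_mul, map_inv, kil_pair (by omega) (by omega) (by omega) (by omega) hwj, hw1',
      map_mul, map_zpow, map_zpow, kil_self (by omega), kil_of_ne (by omega) (by omega),
      one_zpow, mul_one] at hr
    simp only at hr
    refine ⟨p, -q, r, hw1', ?_⟩
    rw [hr, ej]; group
  obtain ⟨p, q, -, hp, -⟩ := key 2 le_rfl (by omega)
  refine ⟨h₀ * xg (k + 1) 0 ^ p, fun x => ?_⟩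
  have : α = MulAut.conj (h₀ * xg (k + 1) 0 ^ p) := by
    refine FG.mulAut_ext fun j hj => ?_
    rw [MulAut.conj_apply]
    rcases (show j = 0 ∨ j = 1 ∨ 2 ≤ j by omega) with rfl | rfl | h2
    · rw [← h0]; group
    · rw [e1, hp]; group
    · obtain ⟨p', q', r, hp', hj'⟩ := key j h2 hj
      have h3 := congrArg (ex (k + 1) 0) (hp.symm.trans hp')
      simp only [map_mul, map_zpow, ex_self (show 0 < k + 1 by omega),
        ex_of_ne (show 1 ≠ 0 by omega), one_zpow, mul_one] at h3
      have h4 : p = p' := by simpa using congrArg Multiplicative.toAdd h3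
      rw [hj', h4]; group
  rw [this, MulAut.conj_apply]

end BraidHol

namespace BraidHol

instance zz_normal (k : ℕ) : (Subgroup.zpowers (zz k)).Normal := by
  constructor
  rintro _ ⟨n, rfl⟩ g
  refine ⟨n, ?_⟩
  have := ((zz_commute k g).zpow_left n).eq
  simp only [← this, mul_inv_cancel_right]

/-- The braid group modulo the full twist. -/
abbrev Bb (k : ℕ) := Br k ⧸ Subgroup.zpowers (zz k)

/-- The quotient map. -/
def bq (k : ℕ) : Br k →* Bb k := QuotientGroup.mk' _

section Bb
variable {k : ℕ}

lemma bq_surj (g : Bb k) : ∃ x, bq k x = g := QuotientGroup.mk'_surjective _ g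

lemma bq_eq_one {x : Br k} : bq k x = 1 ↔ ∃ n : ℤ, x = zz k ^ n := by
  rw [bq, ← MonoidHom.mem_ker, QuotientGroup.ker_mk', Subgroup.mem_zpowers_iff]
  simp only [eq_comm]

lemma bq_eq {x y : Br k} : bq k x = bq k y ↔ ∃ n : ℤ, x = y * zz k ^ n := by
  rw [eq_comm, ← inv_mul_eq_one, ← map_inv, ← map_mul, bq_eq_one]
  simp only [inv_mul_eq_iff_eq_mul]

@[simp] lemma bq_zz : bq k (zz k) = 1 := bq_eq_one.mpr ⟨1, by simp⟩

/-- The permutation of an element of the quotient. -/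
def pb (k : ℕ) : Bb k →* Equiv.Perm ℕ :=
  QuotientGroup.lift _ (prm k) (by rintro _ ⟨n, rfl⟩; simp [prm_zz])

@[simp] lemma pb_bq (x : Br k) : pb k (bq k x) = prm k x := rfl

lemma Bb.mem_of_sg (H : Subgroup (Bb k)) (h : ∀ i < k, bq k (sg k i) ∈ H) (g : Bb k) : g ∈ H := by
  obtain ⟨x, rfl⟩ := bq_surj g
  exact Br.mem_of_sg (H.comap (bq k)) h x

lemma Bb.mem_of_pb_eq_one (H : Subgroup (Bb k))
    (hH : ∀ β, β * bq k (sg k 0) ^ 2 * β⁻¹ ∈ H) {g : Bb k} (hg : pb k g = 1) : g ∈ H := by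
  obtain ⟨x, rfl⟩ := bq_surj g
  refine mem_of_prm_eq_one (H.comap (bq k)) (fun β => ?_) hg
  simpa using hH (bq k β)

/-- Differences of crossing numbers on the quotient. -/
noncomputable def dlk (g : Bb k) (a b : ℕ) : ℤ :=
  crs k (Function.surjInv bq_surj g) a b - crs k (Function.surjInv bq_surj g) 0 1

lemma dlk_bq (hk : 1 ≤ k) (x : Br k) {a b : ℕ} (ha : a ≤ k) (hb : b ≤ k) (hab : a ≠ b) :
    dlk (bq k x) a b = crs k x a b - crs k x 0 1 := by
  obtain ⟨n, hn⟩ := bq_eq.mp (Function.surjInv_eq bq_surj (bq k x))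
  rw [dlk, hn, crs_mul_zz_zpow _ _ ha hb hab, crs_mul_zz_zpow _ _ (by omega) hk (by omega)]
  ring

lemma dlk_mul (hk : 1 ≤ k) (g : Bb k) {h : Bb k} (hh : pb k h = 1) {a b : ℕ} (ha : a ≤ k)
    (hb : b ≤ k) (hab : a ≠ b) : dlk (g * h) a b = dlk g a b + dlk h a b := by
  obtain ⟨x, rfl⟩ := bq_surj g
  obtain ⟨y, rfl⟩ := bq_surj h
  rw [pb_bq] at hh
  rw [← map_mul, dlk_bq hk _ ha hb hab, dlk_bq hk _ ha hb hab, dlk_bq hk _ ha hb hab, crs_mul,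
    crs_mul, hh]
  simp only [Equiv.Perm.one_apply]
  ring

lemma dlk_symm (g : Bb k) (a b : ℕ) : dlk g a b = dlk g b a := by rw [dlk, dlk, crs_symm _ a b]

lemma dlk_one {a b : ℕ} (hk : 1 ≤ k) (ha : a ≤ k) (hb : b ≤ k) (hab : a ≠ b) :
    dlk (1 : Bb k) a b = 0 := by
  rw [← map_one (bq k), dlk_bq hk _ ha hb hab]; simp

lemma dlk_zero_one (g : Bb k) : dlk g 0 1 = 0 := sub_self _

lemma pb_le (g : Bb k) {i : ℕ} (h : i ≤ k) : pb k g i ≤ k := by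
  obtain ⟨x, rfl⟩ := bq_surj g
  exact prm_le x h

lemma pb_inv_le (g : Bb k) {i : ℕ} (h : i ≤ k) : (pb k g)⁻¹ i ≤ k := by
  rw [← map_inv]; exact pb_le _ h

lemma dlk_conj (hk : 1 ≤ k) {g : Bb k} (hg : pb k g = 1) (h : Bb k) {a b : ℕ} (ha : a ≤ k)
    (hb : b ≤ k) (hab : a ≠ b) : dlk (h * g * h⁻¹) a b =
      dlk g ((pb k h)⁻¹ a) ((pb k h)⁻¹ b) - dlk g ((pb k h)⁻¹ 0) ((pb k h)⁻¹ 1) := by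
  have hi : ∀ a b, a ≠ b → (pb k h)⁻¹ a ≠ (pb k h)⁻¹ b := fun a b h' => by simpa using h'
  have h1 := pb_inv_le h ha
  have h2 := pb_inv_le h hb
  have h3 := pb_inv_le h (Nat.zero_le k)
  have h4 := pb_inv_le h hk
  have h5 := hi _ _ hab
  have h6 := hi 0 1 (by omega)
  obtain ⟨x, rfl⟩ := bq_surj g
  obtain ⟨y, rfl⟩ := bq_surj h
  rw [pb_bq] at *
  rw [← map_mul, ← map_inv, ← map_mul, dlk_bq hk _ ha hb hab, crs_conj hg, crs_conj hg,
    dlk_bq hk _ h1 h2 h5, dlk_bq hk _ h3 h4 h6]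
  ring

/-- The semidirect product mapping onto the stabiliser of the last point. -/
def jg (k : ℕ) : Gam k →* Bb (k + 1) := (bq (k + 1)).comp (iot k)

lemma jg_eq_one {γ : Gam k} : jg k γ = 1 ↔
    ∃ n : ℤ, γ = (SemidirectProduct.inr (zz k) * SemidirectProduct.inl (xinf k)) ^ n := by
  rw [jg, MonoidHom.comp_apply, bq_eq_one]
  simp only [← iot_zz, ← map_zpow, iot_injective.eq_iff]

lemma pb_jg (γ : Gam k) : pb (k + 1) (jg k γ) = prm k γ.right := prm_iot γ

lemma dlk_jg (hk : 1 ≤ k) (γ : Gam k) {a b : ℕ} (ha : a ≤ k) (hb : b ≤ k) (hab : a ≠ b) :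
    dlk (jg k γ) a b = dlk (bq k γ.right) a b := by
  rw [dlk_bq hk _ ha hb hab, jg, MonoidHom.comp_apply, dlk_bq (by omega) _ (by omega) (by omega) hab,
    crs_iot _ ha hb, crs_iot _ (by omega) hk]

/-- The stabiliser of the last point. -/
def Sb (k : ℕ) : Subgroup (Bb (k + 1)) := (jg k).range

lemma mem_Sb {g : Bb (k + 1)} : g ∈ Sb k ↔ pb (k + 1) g (k + 1) = k + 1 := by
  constructor
  · rintro ⟨γ, rfl⟩
    rw [pb_jg, prm_of_gt _ (by omega)]
  · intro h
    obtain ⟨x, rfl⟩ := bq_surj g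
    exact ⟨ret k ⟨x, h⟩, congrArg (bq (k + 1)) (iot_ret ⟨x, h⟩)⟩

lemma mem_Sb_of_pb {g : Bb (k + 1)} (h : pb (k + 1) g = 1) : g ∈ Sb k := by
  rw [mem_Sb, h]; rfl

lemma zz_mul_xinf_zpow_right (n : ℤ) :
    ((SemidirectProduct.inr (zz k) * SemidirectProduct.inl (xinf k) : Gam k) ^ n).right = zz k ^ n := by
  rw [← SemidirectProduct.rightHom_eq_right, map_zpow]; simp

/-- Forgetting the last strand. -/
noncomputable def pS (k : ℕ) : Sb k →* Bb k :=
  (jg k).rangeRestrict.liftOfSurjective (jg k).rangeRestrict_surjective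
    ⟨(bq k).comp SemidirectProduct.rightHom, by
      intro γ hγ
      rw [MonoidHom.ker_rangeRestrict, MonoidHom.mem_ker, jg_eq_one] at hγ
      obtain ⟨n, rfl⟩ := hγ
      rw [MonoidHom.mem_ker, MonoidHom.comp_apply, SemidirectProduct.rightHom_eq_right,
        zz_mul_xinf_zpow_right, map_zpow, bq_zz, one_zpow]⟩

lemma jg_mem (γ : Gam k) : jg k γ ∈ Sb k := ⟨γ, rfl⟩

lemma pS_jg (γ : Gam k) : pS k ⟨jg k γ, jg_mem γ⟩ = bq k γ.right :=
  (jg k).rangeRestrict.liftOfRightInverse_comp_apply _ _ _ γ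

lemma pb_pS (s : Sb k) : pb k (pS k s) = pb (k + 1) s := by
  obtain ⟨_, γ, rfl⟩ := s
  rw [pS_jg, pb_bq, pb_jg]

lemma dlk_pS (hk : 1 ≤ k) (s : Sb k) {a b : ℕ} (ha : a ≤ k) (hb : b ≤ k) (hab : a ≠ b) :
    dlk (pS k s) a b = dlk (s : Bb (k + 1)) a b := by
  obtain ⟨_, γ, rfl⟩ := s
  rw [pS_jg, dlk_jg hk _ ha hb hab]

/-- The free kernel. -/
def jF (k : ℕ) : FG (k + 1) →* Bb (k + 1) := (jg k).comp SemidirectProduct.inl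

lemma jF_mem (f : FG (k + 1)) : jF k f ∈ Sb k := jg_mem _

lemma jF_injective (hk : 1 ≤ k) : Function.Injective (jF k) := by
  rw [injective_iff_map_eq_one]
  intro f hf
  obtain ⟨n, hn⟩ := jg_eq_one.mp hf
  have h := congrArg SemidirectProduct.right hn
  rw [zz_mul_xinf_zpow_right, SemidirectProduct.right_inl, eq_comm] at h
  rw [zz_zpow_eq_one hk h, zpow_zero] at hn
  exact SemidirectProduct.inl_injective (by rw [hn, map_one])

lemma pb_jF (f : FG (k + 1)) : pb (k + 1) (jF k f) = 1 := by
  rw [jF, MonoidHom.comp_apply, pb_jg]; simp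

lemma pS_eq_one {s : Sb k} : pS k s = 1 ↔ ∃ f, jF k f = s := by
  constructor
  · obtain ⟨_, γ, rfl⟩ := s
    rw [pS_jg, bq_eq_one]
    rintro ⟨n, hn⟩
    set ω : Gam k := SemidirectProduct.inr (zz k) * SemidirectProduct.inl (xinf k)
    have h1 : (γ * ω ^ (-n)).right = 1 := by
      rw [SemidirectProduct.mul_right, hn, zz_mul_xinf_zpow_right, zpow_neg, mul_inv_cancel]
    refine ⟨(γ * ω ^ (-n)).left, ?_⟩
    have h2 := SemidirectProduct.inl_left_mul_inr_right (γ * ω ^ (-n))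
    rw [h1, map_one, mul_one] at h2
    rw [jF, MonoidHom.comp_apply, h2, map_mul, jg_eq_one.mpr ⟨-n, rfl⟩, mul_one]
  · rintro ⟨f, hf⟩
    have : s = ⟨jg k (SemidirectProduct.inl f), jg_mem _⟩ := Subtype.ext hf.symm
    rw [this, pS_jg]; simp

lemma pS_surj (b : Br k) : pS k ⟨jg k (SemidirectProduct.inr b), jg_mem _⟩ = bq k b := by
  rw [pS_jg]; simp

/-- Only the identity is pure on two strands modulo the full twist. -/
lemma eq_one_of_pb_one {g : Bb 1} (hg : pb 1 g = 1) : g = 1 := by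
  have : ∀ x : Br 1, ∃ n : ℤ, x = sg 1 0 ^ n := fun x => by
    obtain ⟨n, hn⟩ := Br.mem_of_sg (Subgroup.zpowers (sg 1 0)) (fun i hi => by
      obtain rfl : i = 0 := by omega
      exact Subgroup.mem_zpowers _) x
    exact ⟨n, hn.symm⟩
  have hc : ∀ x y : Br 1, x * y = y * x := fun x y => by
    obtain ⟨n, rfl⟩ := this x
    obtain ⟨m, rfl⟩ := this y
    rw [← zpow_add, ← zpow_add, add_comm]
  have hz : zz 1 = sg 1 0 ^ 2 := by simp [zz, dl, del_succ]
  have := Bb.mem_of_pb_eq_one (k := 1) ⊥ (fun β => by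
    obtain ⟨x, rfl⟩ := bq_surj β
    rw [← map_pow, ← map_inv, ← map_mul, ← map_mul, hc x, mul_inv_cancel_right, ← hz, bq_zz]
    exact one_mem _) hg
  simpa using this

lemma pure_center (hk : 1 ≤ k) {x : Bb k} (hx : pb k x = 1)
    (h : ∀ y, pb k y = 1 → x * y = y * x) : x = 1 := by
  induction k, hk using Nat.le_induction with
  | base => exact eq_one_of_pb_one hx
  | succ k hk ih =>
    have h1 : pS k ⟨x, mem_Sb_of_pb hx⟩ = 1 := by
      refine ih (by rw [pb_pS]; exact hx) fun y hy => ?_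
      obtain ⟨b, rfl⟩ := bq_surj y
      have h3 := h (jg k (SemidirectProduct.inr b)) (by rw [pb_jg]; exact hy)
      have h2 : (⟨x, mem_Sb_of_pb hx⟩ : Sb k) * ⟨jg k (SemidirectProduct.inr b), jg_mem _⟩ =
        ⟨jg k (SemidirectProduct.inr b), jg_mem _⟩ * ⟨x, mem_Sb_of_pb hx⟩ := Subtype.ext h3
      rw [← pS_surj, ← map_mul, h2, map_mul]
    obtain ⟨f, hf⟩ := pS_eq_one.mp h1
    change jF k f = x at hf
    rw [← hf, FG.exists_not_commute (show 2 ≤ k + 1 by omega) (f := f) (fun g => ?_), map_one]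
    refine jF_injective hk ?_
    rw [map_mul, map_mul, hf]
    exact h _ (pb_jF g)

lemma prm_eq_one_of_comm (hk : 2 ≤ k) {x : Br k}
    (h : ∀ i < k, prm k x * Equiv.swap i (i + 1) = Equiv.swap i (i + 1) * prm k x) :
    prm k x = 1 := by
  have h1 : ∀ i < k, ∀ a, a = i ∨ a = i + 1 → prm k x a = i ∨ prm k x a = i + 1 := by
    intro i hi a ha
    by_contra hc
    push Not at hc
    have := Equiv.congr_fun (h i hi) a
    simp only [Equiv.Perm.mul_apply] at this
    rw [Equiv.swap_apply_of_ne_of_ne hc.1 hc.2, (prm k x).injective.eq_iff] at this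
    rcases ha with rfl | rfl <;> simp at this
  have h2 : ∀ i ≤ k, prm k x i = i := by
    intro i hi
    induction i with
    | zero =>
      have e0 := h1 0 (by omega) 0 (by omega)
      have e1 := h1 0 (by omega) 1 (by omega)
      have e2 := h1 1 (by omega) 1 (by omega)
      have e3 : prm k x 0 ≠ prm k x 1 := fun h => by simpa using (prm k x).injective h
      omega
    | succ i ih =>
      have e1 := h1 i (by omega) (i + 1) (by omega)
      have e3 : prm k x i ≠ prm k x (i + 1) := fun h => by simpa using (prm k x).injective h
      have := ih (by omega)
      omega
  ext i
  by_cases hi : i ≤ k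
  · exact h2 i hi
  · exact prm_of_gt _ (by omega)

lemma mem_center_iff (hk : 2 ≤ k) {x : Br k} :
    x ∈ Subgroup.center (Br k) ↔ ∃ n : ℤ, x = zz k ^ n := by
  constructor
  · intro hx
    rw [Subgroup.mem_center_iff] at hx
    refine bq_eq_one.mp (pure_center (by omega) ?_ fun y _ => ?_)
    · exact prm_eq_one_of_comm hk fun i hi => by rw [← prm_sg hi, ← map_mul, ← map_mul, hx]
    · obtain ⟨y, rfl⟩ := bq_surj y
      rw [← map_mul, ← map_mul, hx]
  · rintro ⟨n, rfl⟩
    rw [Subgroup.mem_center_iff]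
    exact fun g => ((zz_commute k g).zpow_left n).eq.symm

lemma pb_eq_one_of_comm (hk : 2 ≤ k) {x : Bb k}
    (h : ∀ y, pb k (x * y) = pb k (y * x)) : pb k x = 1 := by
  obtain ⟨x, rfl⟩ := bq_surj x
  refine prm_eq_one_of_comm hk fun i hi => ?_
  have := h (bq k (sg k i))
  rw [← map_mul, ← map_mul, pb_bq, pb_bq, map_mul, map_mul, prm_sg hi] at this
  exact this

end Bb
end BraidHol

namespace BraidHol

section index
variable {A T : Type*} [Group A]

lemma finiteIndex_of_finite_valued (I : Subgroup A) [Finite T] (f : A → T)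
    (h : ∀ a b, f a = f b → a * b⁻¹ ∈ I) : I.FiniteIndex := by
  have hinj : Function.Injective fun q : A ⧸ I => f (Quotient.out q)⁻¹ := by
    intro p q hpq
    have := h _ _ hpq
    rw [inv_inv, ← QuotientGroup.eq] at this
    simpa using this
  have := Finite.of_injective _ hinj
  exact Subgroup.finiteIndex_of_finite_quotient

/-- A subgroup is of finite index if a function with finitely many values on a subgroup of finite
index separates its cosets. -/
lemma finiteIndex_of_finite_image {H : Subgroup A} (hH : H.FiniteIndex) (I : Subgroup A)
    (f : A → T) {S : Set T} (hS : S.Finite) (hf : ∀ a ∈ H, f a ∈ S)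
    (h : ∀ a ∈ H, ∀ b ∈ H, f a = f b → a * b⁻¹ ∈ I) : I.FiniteIndex := by
  have hfin : Finite (A ⧸ H) := inferInstance
  have hS' : Finite S := hS
  have hr : ∀ a : A, a * Quotient.out ((a⁻¹ : A) : A ⧸ H) ∈ H := by
    intro a
    have : ((a⁻¹ : A) : A ⧸ H) = (Quotient.out ((a⁻¹ : A) : A ⧸ H) : A) := by simp
    rw [QuotientGroup.eq, inv_inv] at this
    exact this
  refine finiteIndex_of_finite_valued (T := (A ⧸ H) × S) I
    (fun a => (((a⁻¹ : A) : A ⧸ H), ⟨_, hf _ (hr a)⟩)) fun a b hab => ?_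
  rw [Prod.mk.injEq, Subtype.mk.injEq] at hab
  have := h _ (hr a) _ (hr b) hab.2
  rw [hab.1] at this
  convert this using 1
  group

end index

variable {k : ℕ}

variable (k) in
/-- The automorphisms compatible with the map to permutations. -/
def AA1 : Subgroup (MulAut (Bb k)) where
  carrier := {θ | ∀ g, pb k (θ g) = pb k g}
  one_mem' := fun g => rfl
  mul_mem' := fun {a b} ha hb g => by rw [MulAut.mul_apply, ha, hb]
  inv_mem' := fun {a} ha g => by rw [← ha (a⁻¹ g), MulAut.apply_inv_self]

lemma pb_of_gt (g : Bb k) {i : ℕ} (h : k < i) : pb k g i = i := by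
  obtain ⟨x, rfl⟩ := bq_surj g
  exact prm_of_gt x h

lemma finiteIndex_AA1 : (AA1 k).FiniteIndex := by
  refine finiteIndex_of_finite_valued (T := Fin k → Fin (k + 1) → Fin (k + 1)) _
    (fun θ i a => ⟨pb k (θ (bq k (sg k i))) a, Nat.lt_succ_of_le (pb_le _ (Nat.le_of_lt_succ a.2))⟩)
    fun θ θ' h => ?_
  have key : ∀ g, pb k (θ g) = pb k (θ' g) := by
    refine fun g => Bb.mem_of_sg (((pb k).comp θ.toMonoidHom).eqLocus
      ((pb k).comp θ'.toMonoidHom)) (fun i hi => ?_) g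
    change pb k (θ (bq k (sg k i))) = pb k (θ' (bq k (sg k i)))
    ext a
    by_cases ha : a < k + 1
    · have := congrFun (congrFun h ⟨i, hi⟩) ⟨a, ha⟩
      simpa using this
    · rw [pb_of_gt _ (by omega), pb_of_gt _ (by omega)]
  intro g
  rw [MulAut.mul_apply, key, MulAut.apply_inv_self]

variable (k) in
/-- The automorphisms which moreover preserve linking numbers. -/
def AA2 : Subgroup (MulAut (Bb k)) where
  carrier := {θ | θ ∈ AA1 k ∧ ∀ g, pb k g = 1 → ∀ a b, a ≤ k → b ≤ k → a ≠ b →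
    dlk (θ g) a b = dlk g a b}
  one_mem' := ⟨one_mem _, fun g _ a b _ _ _ => rfl⟩
  mul_mem' := fun {θ θ'} h h' => ⟨mul_mem h.1 h'.1, fun g hg a b ha hb hab => by
    rw [MulAut.mul_apply, h.2 _ (by rw [h'.1, hg]) a b ha hb hab, h'.2 g hg a b ha hb hab]⟩
  inv_mem' := fun {θ} h => ⟨inv_mem h.1, fun g hg a b ha hb hab => by
    rw [← h.2 (θ⁻¹ g) (by rw [(inv_mem h.1 : θ⁻¹ ∈ AA1 k) g, hg]) a b ha hb hab,
      MulAut.apply_inv_self]⟩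

section linking
variable {θ : MulAut (Bb k)} (hθ : θ ∈ AA1 k)
include hθ

/-- The image of the first pure generator determines all linking numbers. -/
lemma dlk_map_conj (hk : 1 ≤ k) (β : Bb k) {a b : ℕ} (ha : a ≤ k) (hb : b ≤ k) (hab : a ≠ b) :
    dlk (θ (β * bq k (sg k 0) ^ 2 * β⁻¹)) a b =
      dlk (θ (bq k (sg k 0) ^ 2)) ((pb k β)⁻¹ a) ((pb k β)⁻¹ b) -
      dlk (θ (bq k (sg k 0) ^ 2)) ((pb k β)⁻¹ 0) ((pb k β)⁻¹ 1) := by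
  rw [map_mul, map_mul, map_inv, dlk_conj hk _ _ ha hb hab, hθ]
  rw [hθ, ← map_pow, pb_bq, prm_sg_sq (by omega)]

lemma dlk_map_swap (hk : 1 ≤ k) {i : ℕ} (hi : i < k) (hi1 : i ≠ 1) {a b : ℕ} (ha : a ≤ k)
    (hb : b ≤ k) (hab : a ≠ b) :
    dlk (θ (bq k (sg k 0) ^ 2)) (Equiv.swap i (i + 1) a) (Equiv.swap i (i + 1) b) =
      dlk (θ (bq k (sg k 0) ^ 2)) a b := by
  have h := dlk_map_conj hθ hk (bq k (sg k i)) ha hb hab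
  have h1 : bq k (sg k i) * bq k (sg k 0) ^ 2 * (bq k (sg k i))⁻¹ = bq k (sg k 0) ^ 2 := by
    rw [mul_inv_eq_iff_eq_mul, ← map_pow, ← map_mul, ← map_mul]
    congr 1
    rcases Nat.eq_zero_or_pos i with rfl | h0
    · rw [pow_two, mul_assoc]
    · exact ((sg_comm (show 0 + 2 ≤ i by omega)).pow_left 2).eq.symm
  rw [h1, pb_bq, prm_sg hi, Equiv.swap_inv] at h
  rw [h]
  have h2 : dlk (θ (bq k (sg k 0) ^ 2)) (Equiv.swap i (i + 1) 0) (Equiv.swap i (i + 1) 1) = 0 := by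
    rcases Nat.eq_zero_or_pos i with rfl | h0
    · rw [Equiv.swap_apply_left, Equiv.swap_apply_right, dlk_symm, dlk_zero_one]
    · rw [Equiv.swap_apply_of_ne_of_ne (by omega) (by omega),
        Equiv.swap_apply_of_ne_of_ne (by omega) (by omega), dlk_zero_one]
  rw [h2, sub_zero]

end linking

/-- A symmetric function of pairs of strands depending only on the intersection with `{0, 1}`. -/
def Lh (b c : ℤ) (i j : ℕ) : ℤ := if i ≤ 1 then (if j ≤ 1 then 0 else b) else (if j ≤ 1 then b else c)

lemma dlk_map_eq (hk : 3 ≤ k) {θ : MulAut (Bb k)} (hθ : θ ∈ AA1 k) {i j : ℕ} (hi : i ≤ k)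
    (hj : j ≤ k) (hij : i ≠ j) : dlk (θ (bq k (sg k 0) ^ 2)) i j =
      Lh (dlk (θ (bq k (sg k 0) ^ 2)) 0 2) (dlk (θ (bq k (sg k 0) ^ 2)) 2 3) i j := by
  have hs := fun {i} (hi : i < k) (hi1 : i ≠ 1) {a b} ha hb hab =>
    dlk_map_swap hθ (by omega) hi hi1 (a := a) (b := b) ha hb hab
  have hsym := dlk_symm (θ (bq k (sg k 0) ^ 2))
  have h01 := dlk_zero_one (θ (bq k (sg k 0) ^ 2))
  generalize dlk (θ (bq k (sg k 0) ^ 2)) = L at *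
  have h0 : ∀ j, 2 ≤ j → j ≤ k → L 0 j = L 0 2 := by
    intro j h2 hj
    induction j, h2 using Nat.le_induction with
    | base => rfl
    | succ j h2 ih =>
      rw [← ih (by omega), ← hs (show j < k by omega) (by omega) (show 0 ≤ k by omega)
        (show j ≤ k by omega) (by omega), Equiv.swap_apply_left,
        Equiv.swap_apply_of_ne_of_ne (by omega) (by omega)]
  have h1 : ∀ j, 2 ≤ j → j ≤ k → L 1 j = L 0 2 := by
    intro j h2 hj
    rw [← h0 j h2 hj, ← hs (show 0 < k by omega) (by omega) (show 0 ≤ k by omega) hj (by omega),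
      Equiv.swap_apply_left, Equiv.swap_apply_of_ne_of_ne (by omega) (by omega)]
  have h2 : ∀ j, 3 ≤ j → j ≤ k → L 2 j = L 2 3 := by
    intro j h2 hj
    induction j, h2 using Nat.le_induction with
    | base => rfl
    | succ j h2 ih =>
      rw [← ih (by omega), ← hs (show j < k by omega) (by omega) (show 2 ≤ k by omega)
        (show j ≤ k by omega) (by omega), Equiv.swap_apply_left,
        Equiv.swap_apply_of_ne_of_ne (by omega) (by omega)]
  have h3 : ∀ i, 2 ≤ i → ∀ j, i < j → j ≤ k → L i j = L 2 3 := by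
    intro i hi
    induction i, hi using Nat.le_induction with
    | base => exact h2
    | succ i hi ih =>
      intro j hij hj
      rw [← ih j (by omega) hj, ← hs (show i < k by omega) (by omega) (show i ≤ k by omega)
        hj (by omega), Equiv.swap_apply_left,
        Equiv.swap_apply_of_ne_of_ne (by omega) (by omega)]
  have key : ∀ i j, i < j → j ≤ k → L i j = Lh (L 0 2) (L 2 3) i j := by
    intro i j hij hj
    rw [Lh]
    rcases (show i = 0 ∨ i = 1 ∨ 2 ≤ i by omega) with rfl | rfl | hi
    · rcases (show j = 1 ∨ 2 ≤ j by omega) with rfl | hj2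
      · simpa using h01
      · rw [if_pos (by omega), if_neg (by omega), h0 j hj2 hj]
    · rw [if_pos (by omega), if_neg (by omega), h1 j (by omega) hj]
    · rw [if_neg (by omega), if_neg (by omega), h3 i hi j hij hj]
  rcases lt_or_gt_of_ne hij with h | h
  · exact key i j h hj
  · rw [hsym, key j i h hi, Lh, Lh]
    split_ifs <;> rfl

lemma dlk_map_conj_eq (hk : 3 ≤ k) {θ : MulAut (Bb k)} (hθ : θ ∈ AA1 k) (β : Bb k) {i j : ℕ}
    (hi : i ≤ k) (hj : j ≤ k) (hij : i ≠ j) :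
    dlk (θ (β * bq k (sg k 0) ^ 2 * β⁻¹)) i j =
      Lh (dlk (θ (bq k (sg k 0) ^ 2)) 0 2) (dlk (θ (bq k (sg k 0) ^ 2)) 2 3)
        ((pb k β)⁻¹ i) ((pb k β)⁻¹ j) -
      dlk (θ (bq k (sg k 0) ^ 2)) ((pb k β)⁻¹ 0) ((pb k β)⁻¹ 1) := by
  rw [dlk_map_conj hθ (by omega) β hi hj hij,
    dlk_map_eq hk hθ (pb_inv_le _ hi) (pb_inv_le _ hj) ((Equiv.injective _).ne hij)]

lemma dlk_sg_sq (hk : 3 ≤ k) : dlk (bq k (sg k 0) ^ 2) 0 2 = -2 ∧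
    dlk (bq k (sg k 0) ^ 2) 2 3 = -2 := by
  rw [← map_pow, dlk_bq (by omega) _ (by omega) (by omega) (by omega),
    dlk_bq (by omega) _ (by omega) (by omega) (by omega)]
  simp [crs_sg_sq (show 0 < k by omega), pairInd]

lemma dlk_conj_eq (hk : 3 ≤ k) (β : Bb k) {i j : ℕ} (hi : i ≤ k) (hj : j ≤ k) (hij : i ≠ j) :
    dlk (β * bq k (sg k 0) ^ 2 * β⁻¹) i j = Lh (-2) (-2) ((pb k β)⁻¹ i) ((pb k β)⁻¹ j) -
      dlk (bq k (sg k 0) ^ 2) ((pb k β)⁻¹ 0) ((pb k β)⁻¹ 1) := by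
  have := dlk_map_conj_eq hk (one_mem (AA1 k)) β hi hj hij
  simp only [MulAut.one_apply] at this
  rwa [(dlk_sg_sq hk).1, (dlk_sg_sq hk).2] at this

lemma pb_sg_conj (hk : 1 ≤ k) (β : Bb k) : pb k (β * bq k (sg k 0) ^ 2 * β⁻¹) = 1 := by
  rw [map_mul, map_mul, ← map_pow, pb_bq, prm_sg_sq (by omega), mul_one, map_inv, mul_inv_cancel]

lemma pure_eq_zero (hk : 1 ≤ k) {Φ : Bb k → ℤ}
    (hΦ : ∀ g h, pb k g = 1 → pb k h = 1 → Φ (g * h) = Φ g + Φ h)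
    (hgen : ∀ β, Φ (β * bq k (sg k 0) ^ 2 * β⁻¹) = 0) {g : Bb k} (hg : pb k g = 1) : Φ g = 0 := by
  have h1 : Φ 1 = 0 := by
    have := hΦ 1 1 (map_one _) (map_one _)
    rw [mul_one] at this
    omega
  refine (Bb.mem_of_pb_eq_one
    { carrier := {g | pb k g = 1 ∧ Φ g = 0}
      one_mem' := ⟨map_one _, h1⟩
      mul_mem' := fun {a b} ha hb => ⟨by rw [map_mul, ha.1, hb.1, one_mul], by
        rw [hΦ _ _ ha.1 hb.1, ha.2, hb.2, add_zero]⟩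
      inv_mem' := fun {a} ha => ⟨by rw [map_inv, ha.1, inv_one], by
        have := hΦ a a⁻¹ ha.1 (by rw [map_inv, ha.1, inv_one])
        rw [mul_inv_cancel, h1, ha.2, zero_add] at this
        exact this.symm⟩ } (fun β => ⟨pb_sg_conj hk β, hgen β⟩) hg).2

lemma pure_scale (hk : 1 ≤ k) {θ : MulAut (Bb k)} (hθ : θ ∈ AA1 k) {Φ : Bb k → ℤ}
    (hΦ : ∀ g h, pb k g = 1 → pb k h = 1 → Φ (g * h) = Φ g + Φ h) (c : ℤ)
    (hgen : ∀ β, 2 * Φ (θ (β * bq k (sg k 0) ^ 2 * β⁻¹)) = c * Φ (β * bq k (sg k 0) ^ 2 * β⁻¹))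
    {g : Bb k} (hg : pb k g = 1) : 2 * Φ (θ g) = c * Φ g := by
  rw [← sub_eq_zero]
  refine pure_eq_zero hk (Φ := fun g => 2 * Φ (θ g) - c * Φ g) (fun g h hg hh => ?_)
    (fun β => sub_eq_zero.mpr (hgen β)) hg
  rw [map_mul, hΦ _ _ (by rw [hθ, hg]) (by rw [hθ, hh]), hΦ _ _ hg hh]
  ring

/-- A scaling factor of an automorphism and its inverse is bounded. -/
lemma abs_scale_le (hk : 1 ≤ k) {θ : MulAut (Bb k)} (hθ : θ ∈ AA1 k) {Φ : Bb k → ℤ}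
    (hΦ : ∀ g h, pb k g = 1 → pb k h = 1 → Φ (g * h) = Φ g + Φ h) (c : MulAut (Bb k) → ℤ)
    (hgen : ∀ θ ∈ AA1 k, ∀ β, 2 * Φ (θ (β * bq k (sg k 0) ^ 2 * β⁻¹)) =
      c θ * Φ (β * bq k (sg k 0) ^ 2 * β⁻¹))
    {g : Bb k} (hg : pb k g = 1) (hg0 : Φ g ≠ 0) : |c θ| ≤ 4 := by
  have h1 := pure_scale hk hθ hΦ (c θ) (hgen θ hθ) (g := θ⁻¹ g)
    (by rw [(inv_mem hθ : θ⁻¹ ∈ AA1 k), hg])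
  have h2 := pure_scale hk (inv_mem hθ) hΦ (c θ⁻¹) (hgen _ (inv_mem hθ)) hg
  rw [MulAut.apply_inv_self] at h1
  have h3 : c θ * c θ⁻¹ = 4 := by
    apply mul_right_cancel₀ hg0
    calc c θ * c θ⁻¹ * Φ g = c θ * (c θ⁻¹ * Φ g) := by ring
      _ = 2 * (2 * Φ g) := by rw [← h2, h1]; ring
      _ = 4 * Φ g := by ring
  exact Int.le_of_dvd (by norm_num) ((abs_dvd _ _).mpr ⟨_, h3.symm⟩)

lemma Lh_square (b c : ℤ) (u v w x : ℕ) :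
    2 * (Lh b c u v - Lh b c v w + Lh b c w x - Lh b c x u) =
      (c - 2 * b) * (Lh (-2) (-2) u v - Lh (-2) (-2) v w + Lh (-2) (-2) w x
        - Lh (-2) (-2) x u) := by
  unfold Lh
  split_ifs <;> ring

lemma sum_Lh_sub (b c : ℤ) (n : ℕ) (p : Equiv.Perm ℕ) (hp : ∀ i, i < n + 2 ↔ p i < n + 2) :
    ∑ j ∈ Finset.range n, (Lh b c (p 0) (p (j + 2)) - Lh b c (p 1) (p (j + 2))) =
      if p 0 ≤ 1 then (if p 1 ≤ 1 then 0 else (n - 2) * b - (n - 1) * c)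
      else if p 1 ≤ 1 then -((n - 2) * b - (n - 1) * c) else 0 := by
  have hne : p 0 ≠ p 1 := p.injective.ne (by omega)
  have hsum : ∀ F : ℕ → ℤ, ∑ j ∈ Finset.range (n + 2), F j =
      ∑ j ∈ Finset.range n, F (j + 2) + F 1 + F 0 := fun F => by
    rw [Finset.sum_range_succ' F (n + 1), Finset.sum_range_succ']
  have h1 := hsum fun j => Lh b c (p 0) (p j) - Lh b c (p 1) (p j)
  have h2 : ∑ j ∈ Finset.range (n + 2), (Lh b c (p 0) (p j) - Lh b c (p 1) (p j)) =
      ∑ j ∈ Finset.range (n + 2), (Lh b c (p 0) j - Lh b c (p 1) j) :=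
    Finset.sum_equiv p (by simpa using hp) (fun _ _ => rfl)
  have h3 := hsum fun j => Lh b c (p 0) j - Lh b c (p 1) j
  have h4 : ∀ u j, Lh b c u (j + 2) = Lh b c u 2 := fun u j => by simp [Lh]
  simp only [h4, Finset.sum_const, Finset.card_range, nsmul_eq_mul] at h3
  rw [h2, h3] at h1
  rw [← sub_eq_iff_eq_add, ← sub_eq_iff_eq_add] at h1
  rw [← h1]
  simp only [Lh]
  split_ifs <;> first | omega | ring

/-- An alternating sum of linking numbers around a square. -/
noncomputable def sqr (g : Bb k) : ℤ := dlk g 0 1 - dlk g 1 2 + dlk g 2 3 - dlk g 3 0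

/-- The difference of the linking numbers of the first two strands with all others. -/
noncomputable def dst {n : ℕ} (g : Bb (n + 1)) : ℤ :=
  ∑ j ∈ Finset.range n, (dlk g 0 (j + 2) - dlk g 1 (j + 2))

lemma sqr_map (hk : 3 ≤ k) {θ : MulAut (Bb k)} (hθ : θ ∈ AA1 k) (β : Bb k) :
    2 * sqr (θ (β * bq k (sg k 0) ^ 2 * β⁻¹)) =
      (dlk (θ (bq k (sg k 0) ^ 2)) 2 3 - 2 * dlk (θ (bq k (sg k 0) ^ 2)) 0 2) *
        sqr (β * bq k (sg k 0) ^ 2 * β⁻¹) := by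
  have h := Lh_square (dlk (θ (bq k (sg k 0) ^ 2)) 0 2) (dlk (θ (bq k (sg k 0) ^ 2)) 2 3)
    ((pb k β)⁻¹ 0) ((pb k β)⁻¹ 1) ((pb k β)⁻¹ 2) ((pb k β)⁻¹ 3)
  simp only [sqr]
  rw [dlk_map_conj_eq hk hθ β (show 0 ≤ k by omega) (show 1 ≤ k by omega) (by omega),
    dlk_map_conj_eq hk hθ β (show 1 ≤ k by omega) (show 2 ≤ k by omega) (by omega),
    dlk_map_conj_eq hk hθ β (show 2 ≤ k by omega) (show 3 ≤ k by omega) (by omega),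
    dlk_map_conj_eq hk hθ β (show 3 ≤ k by omega) (show 0 ≤ k by omega) (by omega),
    dlk_conj_eq hk β (show 0 ≤ k by omega) (show 1 ≤ k by omega) (by omega),
    dlk_conj_eq hk β (show 1 ≤ k by omega) (show 2 ≤ k by omega) (by omega),
    dlk_conj_eq hk β (show 2 ≤ k by omega) (show 3 ≤ k by omega) (by omega),
    dlk_conj_eq hk β (show 3 ≤ k by omega) (show 0 ≤ k by omega) (by omega)]
  linear_combination h

lemma dst_eq_of {n : ℕ} {g : Bb (n + 1)} {b c d : ℤ} {p : Equiv.Perm ℕ}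
    (h : ∀ {i j}, i ≤ n + 1 → j ≤ n + 1 → i ≠ j → dlk g i j = Lh b c (p i) (p j) - d) :
    dst g = ∑ j ∈ Finset.range n, (Lh b c (p 0) (p (j + 2)) - Lh b c (p 1) (p (j + 2))) := by
  refine Finset.sum_congr rfl fun j hj => ?_
  have := Finset.mem_range.mp hj
  rw [h (by omega) (by omega) (by omega), h (by omega) (by omega) (by omega)]
  ring

lemma pb_inv_lt_iff (β : Bb k) (i : ℕ) : i < k + 1 ↔ (pb k β)⁻¹ i < k + 1 := by
  constructor
  · intro h
    have := pb_inv_le β (show i ≤ k by omega)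
    omega
  · intro h
    have := pb_le β (show (pb k β)⁻¹ i ≤ k by omega)
    rw [← Equiv.Perm.mul_apply, mul_inv_cancel, Equiv.Perm.one_apply] at this
    omega

lemma dst_map {n : ℕ} (hn : 2 ≤ n) {θ : MulAut (Bb (n + 1))} (hθ : θ ∈ AA1 (n + 1))
    (β : Bb (n + 1)) :
    2 * dst (θ (β * bq (n + 1) (sg (n + 1) 0) ^ 2 * β⁻¹)) =
      ((n - 2) * dlk (θ (bq (n + 1) (sg (n + 1) 0) ^ 2)) 0 2 -
        (n - 1) * dlk (θ (bq (n + 1) (sg (n + 1) 0) ^ 2)) 2 3) *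
        dst (β * bq (n + 1) (sg (n + 1) 0) ^ 2 * β⁻¹) := by
  rw [dst_eq_of (dlk_map_conj_eq (by omega) hθ β), dst_eq_of (dlk_conj_eq (by omega) β),
    sum_Lh_sub _ _ _ _ (pb_inv_lt_iff β), sum_Lh_sub _ _ _ _ (pb_inv_lt_iff β)]
  split_ifs <;> ring

lemma sqr_mul (hk : 3 ≤ k) (g h : Bb k) (hh : pb k h = 1) : sqr (g * h) = sqr g + sqr h := by
  simp only [sqr]
  rw [dlk_mul (by omega) g hh (show 0 ≤ k by omega) (show 1 ≤ k by omega) (by omega),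
    dlk_mul (by omega) g hh (show 1 ≤ k by omega) (show 2 ≤ k by omega) (by omega),
    dlk_mul (by omega) g hh (show 2 ≤ k by omega) (show 3 ≤ k by omega) (by omega),
    dlk_mul (by omega) g hh (show 3 ≤ k by omega) (show 0 ≤ k by omega) (by omega)]
  ring

lemma dst_mul {n : ℕ} (g h : Bb (n + 1)) (hh : pb (n + 1) h = 1) :
    dst (g * h) = dst g + dst h := by
  simp only [dst]
  rw [← Finset.sum_add_distrib]
  refine Finset.sum_congr rfl fun j hj => ?_
  have := Finset.mem_range.mp hj
  rw [dlk_mul (by omega) g hh (by omega) (by omega) (by omega),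
    dlk_mul (by omega) g hh (by omega) (by omega) (by omega)]
  ring

lemma abs_dlk_le {n : ℕ} (hn : 2 ≤ n) {θ : MulAut (Bb (n + 1))} (hθ : θ ∈ AA1 (n + 1)) :
    |dlk (θ (bq (n + 1) (sg (n + 1) 0) ^ 2)) 0 2| ≤ 4 ∧
    |dlk (θ (bq (n + 1) (sg (n + 1) 0) ^ 2)) 2 3| ≤ 12 := by
  have h1 := abs_scale_le (by omega) hθ (fun g h _ hh => sqr_mul (by omega) g h hh) _
    (fun θ hθ β => sqr_map (by omega) hθ β) (pb_sg_conj (by omega) 1) (by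
      simp only [sqr]
      rw [dlk_conj_eq (by omega) _ (show 0 ≤ n + 1 by omega) (show 1 ≤ n + 1 by omega) (by omega),
        dlk_conj_eq (by omega) _ (show 1 ≤ n + 1 by omega) (show 2 ≤ n + 1 by omega) (by omega),
        dlk_conj_eq (by omega) _ (show 2 ≤ n + 1 by omega) (show 3 ≤ n + 1 by omega) (by omega),
        dlk_conj_eq (by omega) _ (show 3 ≤ n + 1 by omega) (show 0 ≤ n + 1 by omega) (by omega)]
      simp [Lh, dlk_zero_one])
  obtain ⟨β, hβ0, hβ1⟩ := exists_prm_eq (k := n + 1) (a := 0) (b := 2) (by omega) (by omega)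
    (by omega)
  have hp0 : (pb (n + 1) (bq (n + 1) β))⁻¹ 0 = 0 := by
    rw [Equiv.Perm.inv_eq_iff_eq, pb_bq, hβ0]
  have hp2 : (pb (n + 1) (bq (n + 1) β))⁻¹ 2 = 1 := by
    rw [Equiv.Perm.inv_eq_iff_eq, pb_bq, hβ1]
  have hp1 : ¬ (pb (n + 1) (bq (n + 1) β))⁻¹ 1 ≤ 1 := by
    intro h
    rcases Nat.le_one_iff_eq_zero_or_eq_one.mp h with h | h
    · exact absurd (Equiv.injective _ (h.trans hp0.symm)) (by omega)
    · exact absurd (Equiv.injective _ (h.trans hp2.symm)) (by omega)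
  have h2 := abs_scale_le (by omega) hθ (fun g h _ hh => dst_mul g h hh) _
    (fun θ hθ β => dst_map hn hθ β) (pb_sg_conj (by omega) (bq (n + 1) β)) (by
      rw [dst_eq_of (dlk_conj_eq (by omega) _), sum_Lh_sub _ _ _ _ (pb_inv_lt_iff _), hp0,
        if_pos (by omega), if_neg hp1]
      have : ((n : ℤ) - 2) * -2 - (n - 1) * -2 = 2 := by ring
      rw [this]
      norm_num)
  generalize dlk (θ (bq (n + 1) (sg (n + 1) 0) ^ 2)) 0 2 = b at *
  generalize dlk (θ (bq (n + 1) (sg (n + 1) 0) ^ 2)) 2 3 = c at *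
  obtain ⟨n, rfl⟩ := Nat.exists_eq_add_of_le hn
  push_cast at h2
  rw [abs_le] at h1 h2
  have hb : |b| ≤ 4 := by
    rw [abs_le]
    constructor <;> nlinarith [h1.1, h1.2, h2.1, h2.2]
  refine ⟨hb, ?_⟩
  rw [abs_le] at hb ⊢
  constructor <;> linarith [h1.1, h1.2, hb.1, hb.2]

lemma finiteIndex_AA2 (hk : 3 ≤ k) : (AA2 k).FiniteIndex := by
  obtain ⟨n, rfl⟩ : ∃ n, k = n + 1 := ⟨k - 1, by omega⟩
  refine finiteIndex_of_finite_image finiteIndex_AA1 _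
    (fun θ => (dlk (θ (bq (n + 1) (sg (n + 1) 0) ^ 2)) 0 2,
      dlk (θ (bq (n + 1) (sg (n + 1) 0) ^ 2)) 2 3))
    ((Set.finite_Icc (-4 : ℤ) 4).prod (Set.finite_Icc (-12 : ℤ) 12))
    (fun θ hθ => ?_) fun θ hθ θ' hθ' h => ⟨mul_mem hθ (inv_mem hθ'), fun g hg a b ha hb hab => ?_⟩
  · have := abs_dlk_le (by omega) hθ
    exact ⟨abs_le.mp this.1, abs_le.mp this.2⟩
  · rw [Prod.mk.injEq] at h
    have key : ∀ g, pb (n + 1) g = 1 → dlk (θ g) a b - dlk (θ' g) a b = 0 := by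
      intro g hg
      refine pure_eq_zero (by omega) (Φ := fun g => dlk (θ g) a b - dlk (θ' g) a b)
        (fun g h hg hh => ?_) (fun β => ?_) hg
      · rw [map_mul, map_mul, dlk_mul (by omega) _ (by rw [hθ, hh]) ha hb hab,
          dlk_mul (by omega) _ (by rw [hθ', hh]) ha hb hab]
        ring
      · have h01 : (pb (n + 1) β)⁻¹ 0 ≠ (pb (n + 1) β)⁻¹ 1 := (Equiv.injective _).ne (by omega)
        rw [dlk_map_conj_eq hk hθ β ha hb hab, dlk_map_conj_eq hk hθ' β ha hb hab, h.1, h.2,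
          dlk_map_eq hk hθ (pb_inv_le _ (by omega)) (pb_inv_le _ (by omega)) h01,
          dlk_map_eq hk hθ' (pb_inv_le _ (by omega)) (pb_inv_le _ (by omega)) h01, h.1, h.2,
          sub_self]
    have := key (θ'⁻¹ g) (by rw [(inv_mem hθ' : θ'⁻¹ ∈ AA1 (n + 1)), hg])
    rw [MulAut.apply_inv_self, sub_eq_zero] at this
    exact this

end BraidHol

namespace BraidHol

section fg
variable {G H : Type*} [Group G] [Group H]

lemma fg_map {K : Subgroup G} (hK : K.FG) (f : G →* H) : (K.map f).FG := by
  rw [← Group.fg_iff_subgroup_fg] at *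
  exact Group.fg_of_surjective (f.subgroupMap_surjective K)

lemma fg_of_map {K : Subgroup G} {f : G →* H} (hf : Function.Injective f) (h : (K.map f).FG) :
    K.FG := by
  rw [← Group.fg_iff_subgroup_fg] at *
  exact Group.fg_of_surjective (f := (K.equivMapOfInjective f hf).symm.toMonoidHom)
    (K.equivMapOfInjective f hf).symm.surjective

end fg

variable {k : ℕ}

/-- The linking number with the last strand on the free kernel. -/
noncomputable def lkF (hk : 1 ≤ k) (i : ℕ) (hi : i ≤ k) : FG (k + 1) →* Multiplicative ℤ where
  toFun f := Multiplicative.ofAdd (dlk (jF k f) i (k + 1))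
  map_one' := by rw [map_one, dlk_one (by omega) (by omega) le_rfl (by omega)]; rfl
  map_mul' f g := by
    rw [map_mul, dlk_mul (by omega) _ (pb_jF g) (by omega) le_rfl (by omega), ofAdd_add]

lemma jF_xg {j : ℕ} (hj : j ≤ k) : jF k (xg (k + 1) j) = bq (k + 1) (xb k j) :=
  congrArg (bq (k + 1)) (iot_gx (by omega))

lemma lkF_eq (hk : 1 ≤ k) (i : ℕ) (hi : i ≤ k) (f : FG (k + 1)) :
    lkF hk i hi f = ex (k + 1) i f ^ 2 := by
  suffices h : lkF hk i hi = (powMonoidHom 2).comp (ex (k + 1) i) by rw [h]; rfl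
  refine FG.hom_ext fun j hj => ?_
  change Multiplicative.ofAdd (dlk (jF k (xg (k + 1) j)) i (k + 1)) = ex (k + 1) i (xg (k + 1) j) ^ 2
  rw [jF_xg (by omega), dlk_bq (by omega) _ (by omega) le_rfl (by omega), crs_xb (by omega),
    crs_xb (by omega)]
  by_cases h : j = i
  · subst h
    rw [ex_self (by omega), if_pos (by omega), if_neg (by omega)]
    rfl
  · rw [ex_of_ne h, if_neg (by omega), if_neg (by omega)]
    rfl

lemma dlk_jF (hk : 1 ≤ k) (f : FG (k + 1)) {a b : ℕ} (ha : a ≤ k) (hb : b ≤ k) (hab : a ≠ b) :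
    dlk (jF k f) a b = 0 := by
  rw [jF, MonoidHom.comp_apply, dlk_jg hk _ ha hb hab, SemidirectProduct.right_inl, map_one,
    dlk_one hk ha hb hab]

lemma pS_surjective : Function.Surjective (pS k) := fun g => by
  obtain ⟨b, rfl⟩ := bq_surj g
  exact ⟨_, pS_surj b⟩

lemma exists_jF_conj {g : Bb (k + 1)} (hg : g ∈ Sb k) (f : FG (k + 1)) :
    ∃ f', jF k f' = g * jF k f * g⁻¹ := by
  have h : pS k ⟨jF k f, jF_mem f⟩ = 1 := pS_eq_one.mpr ⟨f, rfl⟩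
  have h2 : pS k (⟨g, hg⟩ * ⟨jF k f, jF_mem f⟩ * ⟨g, hg⟩⁻¹) = 1 := by
    rw [map_mul, map_mul, h, mul_one, ← map_mul, mul_inv_cancel, map_one]
  exact pS_eq_one.mp h2

/-- Finitely generated subgroups of pure braids which are normal and have no linking. -/
structure Unlinked (M : Subgroup (Bb k)) : Prop where
  fg : M.FG
  pure : ∀ m ∈ M, pb k m = 1
  conj : ∀ m ∈ M, ∀ g, pb k g = 1 → g * m * g⁻¹ ∈ M

lemma exists_jF_of_unlinked (hk : 1 ≤ k)
    (ih : ∀ M : Subgroup (Bb k), Unlinked M →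
      (∀ m ∈ M, ∀ a b, a ≤ k → b ≤ k → a ≠ b → dlk m a b = 0) → ∀ m ∈ M, m = 1)
    {M : Subgroup (Bb (k + 1))} (hM : Unlinked M)
    (h0 : ∀ m ∈ M, ∀ a b, a ≤ k → b ≤ k → a ≠ b → dlk m a b = 0) {m : Bb (k + 1)} (hm : m ∈ M) :
    ∃ f, jF k f = m := by
  have hle : M ≤ Sb k := fun m hm => mem_Sb_of_pb (hM.pure m hm)
  suffices h : pS k ⟨m, hle hm⟩ = 1 from pS_eq_one.mp h
  refine ih ((M.subgroupOf (Sb k)).map (pS k))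
    ⟨fg_map (fg_of_map (Sb k).subtype_injective ?_) _, ?_, ?_⟩ ?_ _ ⟨⟨m, hle hm⟩, hm, rfl⟩
  · rw [Subgroup.subgroupOf_map_subtype, inf_eq_left.mpr hle]
    exact hM.fg
  · rintro _ ⟨s, hs, rfl⟩
    rw [pb_pS]
    exact hM.pure _ hs
  · rintro _ ⟨s, hs, rfl⟩ g hg
    obtain ⟨t, rfl⟩ := pS_surjective g
    rw [pb_pS] at hg
    exact ⟨t * s * t⁻¹, hM.conj _ hs _ hg, by simp⟩
  · rintro _ ⟨s, hs, rfl⟩ a b ha hb hab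
    rw [dlk_pS hk s ha hb hab]
    exact h0 _ hs a b ha hb hab

theorem Unlinked.eq_one (hk : 1 ≤ k) : ∀ M : Subgroup (Bb k), Unlinked M →
      (∀ m ∈ M, ∀ a b, a ≤ k → b ≤ k → a ≠ b → dlk m a b = 0) → ∀ m ∈ M, m = 1 := by
  induction k, hk using Nat.le_induction with
  | base => exact fun M hM _ m hm => eq_one_of_pb_one (hM.pure m hm)
  | succ k hk ih =>
    intro M hM h0 m hm
    have hF : ∀ m ∈ M, ∃ f, jF k f = m := fun m hm => exists_jF_of_unlinked hk ih hM
      (fun m hm a b ha hb hab => h0 m hm a b (by omega) (by omega) hab) hm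
    obtain ⟨f, rfl⟩ := hF m hm
    have hmap : (M.comap (jF k)).map (jF k) = M := by
      rw [Subgroup.map_comap_eq, inf_eq_right]
      exact fun m hm => hF m hm
    have hnor : (M.comap (jF k)).Normal := ⟨fun n hn g => by
      rw [Subgroup.mem_comap, map_mul, map_mul, map_inv]
      exact hM.conj _ hn _ (pb_jF g)⟩
    rw [eq_one_of_fg_normal (χ := lkF hk 0 (by omega)) (M := M.comap (jF k))
      (fg_of_map (jF_injective hk) (by rw [hmap]; exact hM.fg)) (fun f hf => ?_) (fun h => ?_) hm,
      map_one]
    · exact congrArg Multiplicative.ofAdd (h0 _ hf 0 (k + 1) (by omega) le_rfl (by omega))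
    · have := DFunLike.congr_fun h (xg (k + 1) 0)
      rw [lkF_eq, ex_self (by omega)] at this
      have h2 : (2 : ℤ) = 0 := congrArg Multiplicative.toAdd this
      omega

section aut
variable {θ : MulAut (Bb (k + 1))}

lemma exists_jF_map (hk : 1 ≤ k) (hθ : θ ∈ AA2 (k + 1)) (f : FG (k + 1)) :
    ∃ f', jF k f' = θ (jF k f) := by
  refine exists_jF_of_unlinked hk (Unlinked.eq_one hk) (M := (jF k).range.map θ.toMonoidHom)
    ⟨?_, ?_, ?_⟩ ?_ ⟨_, ⟨f, rfl⟩, rfl⟩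
  · rw [MonoidHom.range_eq_map]
    exact fg_map (fg_map ((Group.fg_def).mp inferInstance) _) _
  · rintro _ ⟨_, ⟨f, rfl⟩, rfl⟩
    exact (hθ.1 _).trans (pb_jF f)
  · rintro _ ⟨_, ⟨f, rfl⟩, rfl⟩ g hg
    obtain ⟨f', hf'⟩ := exists_jF_conj (mem_Sb_of_pb (g := θ⁻¹ g)
      (by rw [(inv_mem hθ.1 : θ⁻¹ ∈ AA1 (k + 1)), hg])) f
    refine ⟨_, ⟨f', rfl⟩, ?_⟩
    rw [hf']
    change θ _ = g * θ (jF k f) * g⁻¹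
    rw [map_mul, map_mul, map_inv, MulAut.apply_inv_self]
  · rintro _ ⟨_, ⟨f, rfl⟩, rfl⟩ a b ha hb hab
    exact (hθ.2 _ (pb_jF f) a b (by omega) (by omega) hab).trans (dlk_jF hk f ha hb hab)

lemma exists_aut_free (hk : 1 ≤ k) (hθ : θ ∈ AA2 (k + 1)) :
    ∃ α : MulAut (FG (k + 1)), ∀ f, jF k (α f) = θ (jF k f) := by
  choose a ha using exists_jF_map hk hθ
  choose b hb using exists_jF_map hk (inv_mem hθ)
  have inj := jF_injective hk
  exact ⟨{ toFun := a
           invFun := b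
           left_inv := fun f => inj (by rw [hb, ha, MulAut.inv_apply_self])
           right_inv := fun f => inj (by rw [ha, hb, MulAut.apply_inv_self])
           map_mul' := fun f g => inj (by simp only [map_mul, ha]) }, ha⟩

/-- The automorphism `η` is induced by `θ`. -/
def Induces (θ : MulAut (Bb (k + 1))) (η : MulAut (Bb k)) : Prop :=
  ∀ s s' : Sb k, (s' : Bb (k + 1)) = θ s → η (pS k s) = pS k s'

lemma map_mem_Sb (hθ : θ ∈ AA1 (k + 1)) {s : Bb (k + 1)} (hs : s ∈ Sb k) : θ s ∈ Sb k := by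
  rw [mem_Sb] at *
  rw [hθ, hs]

lemma Induces.mul {θ' : MulAut (Bb (k + 1))} {η η' : MulAut (Bb k)} (hθ' : θ' ∈ AA1 (k + 1))
    (h : Induces θ η) (h' : Induces θ' η') : Induces (θ * θ') (η * η') := by
  intro s s' hs
  rw [MulAut.mul_apply, h' s ⟨θ' s, map_mem_Sb hθ' s.2⟩ rfl]
  exact h _ _ hs

lemma Induces.inv {η : MulAut (Bb k)} (h : Induces θ η) : Induces θ⁻¹ η⁻¹ := by
  intro s s' hs
  rw [← h s' s (by rw [hs, MulAut.apply_inv_self]), MulAut.inv_apply_self]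

lemma exists_induced_hom (hk : 1 ≤ k) (hθ : θ ∈ AA2 (k + 1)) :
    ∃ η : Bb k →* Bb k, ∀ s : Sb k, η (pS k s) = pS k ⟨θ s, map_mem_Sb hθ.1 s.2⟩ := by
  let ψ : Sb k →* Bb k := (pS k).comp
    ((θ.toMonoidHom.comp (Sb k).subtype).codRestrict (Sb k) fun s => map_mem_Sb hθ.1 s.2)
  refine ⟨(pS k).liftOfSurjective pS_surjective ⟨ψ, fun s hs => ?_⟩, fun s => ?_⟩
  · obtain ⟨f, hf⟩ := pS_eq_one.mp hs
    obtain ⟨f', hf'⟩ := exists_jF_map hk hθ f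
    refine pS_eq_one.mpr ⟨f', ?_⟩
    rw [hf', hf]
    rfl
  · exact (pS k).liftOfRightInverse_comp_apply _ _ ⟨ψ, _⟩ s

lemma exists_induced (hk : 1 ≤ k) (hθ : θ ∈ AA2 (k + 1)) : ∃ η, Induces θ η := by
  obtain ⟨η, hη⟩ := exists_induced_hom hk hθ
  obtain ⟨η', hη'⟩ := exists_induced_hom hk (inv_mem hθ)
  refine ⟨MonoidHom.toMulEquiv η η' ?_ ?_, fun s s' hs => ?_⟩
  · refine MonoidHom.ext fun x => ?_
    obtain ⟨s, rfl⟩ := pS_surjective x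
    rw [MonoidHom.comp_apply, hη, hη']
    simp
  · refine MonoidHom.ext fun x => ?_
    obtain ⟨s, rfl⟩ := pS_surjective x
    rw [MonoidHom.comp_apply, hη', hη]
    simp
  · refine (hη s).trans (congrArg (pS k) (Subtype.ext hs.symm))

lemma conj_mem_AA2 (hk : 1 ≤ k) {g : Bb k} (hg : pb k g = 1) : MulAut.conj g ∈ AA2 k := by
  refine ⟨fun x => ?_, fun x hx a b ha hb hab => ?_⟩
  · rw [MulAut.conj_apply, map_mul, map_mul, map_inv, hg, one_mul, inv_one, mul_one]
  · rw [MulAut.conj_apply, dlk_conj hk hx _ ha hb hab, hg, inv_one]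
    simp [dlk_zero_one]

lemma induces_conj (s : Sb k) : Induces (MulAut.conj (s : Bb (k + 1))) (MulAut.conj (pS k s)) := by
  intro t t' ht
  rw [MulAut.conj_apply, ← map_mul, ← map_inv, ← map_mul]
  exact congrArg (pS k) (Subtype.ext (by rw [ht]; rfl))

lemma exists_eq_jF_mul (hθ : θ ∈ AA1 (k + 1)) (h1 : Induces θ 1) {s : Bb (k + 1)} (hs : s ∈ Sb k) :
    ∃ f, θ s = jF k f * s := by
  have h := h1 ⟨s, hs⟩ ⟨θ s, map_mem_Sb hθ hs⟩ rfl
  rw [MulAut.one_apply, eq_comm, ← mul_inv_eq_one, ← map_inv, ← map_mul] at h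
  obtain ⟨f, hf⟩ := pS_eq_one.mp h
  exact ⟨f, by rw [hf]; simp⟩

lemma eq_one_of_fixed (hk : 1 ≤ k) (hθ : θ ∈ AA2 (k + 1)) (h1 : Induces θ 1)
    (hF : ∀ f, θ (jF k f) = jF k f) : θ = 1 := by
  have hS : ∀ s ∈ Sb k, θ s = s := by
    intro s hs
    obtain ⟨f, hf⟩ := exists_eq_jF_mul hθ.1 h1 hs
    rw [hf, FG.exists_not_commute (show 2 ≤ k + 1 by omega) (f := f) (fun g => ?_), map_one, one_mul]
    obtain ⟨g', hg'⟩ := exists_jF_conj (inv_mem hs) g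
    rw [inv_inv] at hg'
    have hg : jF k g = s * jF k g' * s⁻¹ := by rw [hg']; group
    have h2 := hF g
    rw [hg, map_mul, map_mul, hF, map_inv, hf] at h2
    refine jF_injective hk ?_
    rw [map_mul, map_mul, hg]
    calc jF k f * (s * jF k g' * s⁻¹) = jF k f * s * jF k g' * (jF k f * s)⁻¹ * jF k f := by group
      _ = _ := by rw [h2]
  ext b
  rw [MulAut.one_apply, eq_comm, ← inv_mul_eq_one]
  have hp : pb (k + 1) (b⁻¹ * θ b) = 1 := by rw [map_mul, map_inv, hθ.1, inv_mul_cancel]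
  refine pure_center (by omega) hp fun y hy => ?_
  have h3 := hS (b * y * b⁻¹) (mem_Sb_of_pb (by
    rw [map_mul, map_mul, hy, mul_one, map_inv, mul_inv_cancel]))
  rw [map_mul, map_mul, map_inv, hS y (mem_Sb_of_pb hy)] at h3
  calc b⁻¹ * θ b * y = b⁻¹ * (θ b * y * (θ b)⁻¹) * θ b := by group
    _ = y * (b⁻¹ * θ b) := by rw [h3]; group

lemma FG.eq_prod_ex {m : ℕ} (χ : FG m →* Multiplicative ℤ) (f : FG m) :
    χ f = ∏ i ∈ Finset.range m, χ (xg m i) ^ (ex m i f).toAdd := by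
  let ψ : FG m →* Multiplicative ℤ :=
    ∏ i ∈ Finset.range m, (zpowersHom _ (χ (xg m i))).comp (ex m i)
  suffices h : χ = ψ by
    rw [h, MonoidHom.finsetProd_apply]
    rw [← h]
    rfl
  refine FG.hom_ext fun j hj => ?_
  rw [MonoidHom.finsetProd_apply, Finset.prod_eq_single j]
  · rw [MonoidHom.comp_apply, ex_self hj]
    simp
  · intro i _ hij
    rw [MonoidHom.comp_apply, ex_of_ne hij.symm, map_one]
  · intro h
    exact absurd (Finset.mem_range.mpr hj) h

lemma good_of_induces (hk : 1 ≤ k) (hθ : θ ∈ AA2 (k + 1)) (h1 : Induces θ 1)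
    {α : MulAut (FG (k + 1))} (hα : ∀ f, jF k (α f) = θ (jF k f)) : Good k α where
  ab χ g := by
    rw [FG.eq_prod_ex χ g, FG.eq_prod_ex]
    refine Finset.prod_congr rfl fun i hi => ?_
    have hi' : i ≤ k := by have := Finset.mem_range.mp hi; omega
    have h2 : lkF hk i hi' (α g) = lkF hk i hi' g := by
      refine congrArg Multiplicative.ofAdd ?_
      rw [hα, hθ.2 _ (pb_jF g) _ _ (by omega) le_rfl (by omega)]
    rw [lkF_eq, lkF_eq] at h2
    have h3 := congrArg Multiplicative.toAdd h2
    rw [toAdd_pow, toAdd_pow, smul_right_inj (by norm_num)] at h3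
    rw [h3]
  cj i hi := by
    set s : Bb (k + 1) := jg k (SemidirectProduct.inr (sg k i)) with hs
    obtain ⟨f, hf⟩ := exists_eq_jF_mul hθ.1 h1 (jg_mem (SemidirectProduct.inr (sg k i)))
    have hact : ∀ x, jF k (art k (sg k i) x) = s * jF k x * s⁻¹ := fun x => by
      rw [eq_mul_inv_iff_mul_eq, jF, MonoidHom.comp_apply, MonoidHom.comp_apply, hs, ← map_mul,
        ← map_mul, inr_mul_inl]
    refine ⟨f, fun x => jF_injective hk ?_⟩
    rw [hα, hact, map_mul, map_mul, map_mul, map_mul, map_inv, map_inv, hact, hα, hf, ← hs]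
    group

/-- An automorphism inducing an inner automorphism after forgetting a strand is inner. -/
lemma inner_of_induces (hk : 2 ≤ k) (hθ : θ ∈ AA2 (k + 1)) {c : Bb k}
    (hc : Induces θ (MulAut.conj c)) : θ ∈ (MulAut.conj : Bb (k + 1) →* MulAut (Bb (k + 1))).range := by
  have hk1 : 1 ≤ k := by omega
  have hcp : pb k c = 1 := by
    refine pb_eq_one_of_comm hk fun y => ?_
    obtain ⟨s, rfl⟩ := pS_surjective y
    have h := congrArg (pb k) (hc s ⟨θ s, map_mem_Sb hθ.1 s.2⟩ rfl)
    rw [pb_pS] at h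
    change _ = pb (k + 1) (θ s) at h
    rw [hθ.1, ← pb_pS, MulAut.conj_apply, map_mul, map_inv, mul_inv_eq_iff_eq_mul] at h
    rw [h, map_mul]
  obtain ⟨s, rfl⟩ := pS_surjective c
  have hs := conj_mem_AA2 (show 1 ≤ k + 1 by omega) ((pb_pS s).symm.trans hcp)
  have h1 := mul_mem (inv_mem hs) hθ
  have h1' := ((induces_conj s).inv).mul hθ.1 hc
  rw [inv_mul_cancel] at h1'
  obtain ⟨α, hα⟩ := exists_aut_free hk1 h1
  obtain ⟨h, hh⟩ := (good_of_induces hk1 h1 h1' hα).inner hk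
  have hF := conj_mem_AA2 (show 1 ≤ k + 1 by omega) (pb_jF h)
  have hF' : Induces (MulAut.conj (jF k h)) 1 := by
    have := induces_conj (⟨jF k h, jF_mem h⟩ : Sb k)
    rwa [pS_eq_one.mpr ⟨h, rfl⟩, map_one] at this
  have h2' := (hF'.inv).mul h1.1 h1'
  rw [inv_one, one_mul] at h2'
  have h3 := eq_one_of_fixed hk1 (mul_mem (inv_mem hF) h1) h2' fun f => by
    rw [MulAut.mul_apply, ← hα, hh, ← map_inv MulAut.conj, MulAut.conj_apply, map_mul (jF k),
      map_mul (jF k), map_inv (jF k)]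
    group
  rw [inv_mul_eq_one, eq_inv_mul_iff_mul_eq, ← map_mul] at h3
  exact ⟨_, h3⟩

end aut

/-- The step from `k` to `k + 1`. -/
theorem finiteIndex_conj_succ (hk : 2 ≤ k)
    (ih : (MulAut.conj : Bb k →* MulAut (Bb k)).range.FiniteIndex) :
    (MulAut.conj : Bb (k + 1) →* MulAut (Bb (k + 1))).range.FiniteIndex := by
  have hex : ∀ θ : MulAut (Bb (k + 1)), ∃ η : MulAut (Bb k), θ ∈ AA2 (k + 1) → Induces θ η := by
    intro θ
    by_cases hθ : θ ∈ AA2 (k + 1)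
    · exact (exists_induced (by omega) hθ).imp fun _ h _ => h
    · exact ⟨1, fun h => absurd h hθ⟩
  choose η hη using hex
  have : Finite (MulAut (Bb k) ⧸ (MulAut.conj : Bb k →* MulAut (Bb k)).range) := inferInstance
  refine finiteIndex_of_finite_image (finiteIndex_AA2 (by omega)) _
    (fun θ => (((η θ)⁻¹ : MulAut (Bb k)) :
      MulAut (Bb k) ⧸ (MulAut.conj : Bb k →* MulAut (Bb k)).range))
    (Set.finite_univ) (fun _ _ => Set.mem_univ _) fun θ hθ θ' hθ' h => ?_
  rw [QuotientGroup.eq, inv_inv] at h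
  obtain ⟨c, hc⟩ := h
  refine inner_of_induces hk (mul_mem hθ (inv_mem hθ')) (c := c) ?_
  rw [hc]
  exact (hη θ hθ).mul (inv_mem hθ'.1) ((hη θ' hθ').inv)

end BraidHol

namespace BraidHol

section modular
variable {G : Type*} [Group G]

/-- The element `t` or its inverse. -/
def tp (t : G) (s : Bool) : G := bif s then t else t⁻¹

/-- Positive words in `ε t` and `ε t⁻¹`. -/
def psw (ε t : G) (l : List Bool) : G := (l.map fun s => ε * tp t s).prod

/-- The element `ε` or the identity. -/
def ep (ε : G) (i : Bool) : G := bif i then ε else 1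

/-- Generators of orders two and three together with a length function growing along positive
words. -/
structure Modular (ε t : G) (N : G → ℕ) : Prop where
  ee : ε * ε = 1
  ttt : t * (t * t) = 1
  gen : ∀ H : Subgroup G, ε ∈ H → t ∈ H → ∀ g, g ∈ H
  left : ∀ g, N (ε * g) = N g
  right : ∀ g, N (g * ε) = N g
  N_one : N 1 = 2
  N_t : N t = 3
  length_add_two_le : ∀ l, l.length + 2 ≤ N (psw ε t l)

lemma psw_nil (ε t : G) : psw ε t [] = 1 := rfl

lemma psw_cons (ε t : G) (s : Bool) (l : List Bool) : psw ε t (s :: l) = ε * (tp t s * psw ε t l) := by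
  simp [psw, mul_assoc]

lemma psw_append (ε t : G) (l m : List Bool) : psw ε t (l ++ m) = psw ε t l * psw ε t m := by
  simp [psw]

lemma isConj_mul_swap (a b : G) : IsConj (a * b) (b * a) :=
  isConj_iff.mpr ⟨a⁻¹, by group⟩

lemma tp_inv (t : G) (s : Bool) : (tp t s)⁻¹ = tp t (!s) := by cases s <;> simp [tp]

lemma tp_mul_not (t : G) (s : Bool) (x : G) : tp t s * (tp t (!s) * x) = x := by
  rw [← tp_inv, mul_inv_cancel_left]

lemma pow_eq_one_of_isConj {g x : G} (hc : IsConj g x) {n : ℕ} (hg : g ^ n = 1) : x ^ n = 1 := by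
  obtain ⟨c, rfl⟩ := isConj_iff.mp hc
  rw [conj_pow, hg, mul_one, mul_inv_cancel]

namespace Modular
variable {ε t : G} {N : G → ℕ} (h : Modular ε t N)
include h

lemma ee_mul (x : G) : ε * (ε * x) = x := by rw [← mul_assoc, h.ee, one_mul]

lemma t_inv : t⁻¹ = t * t := inv_eq_of_mul_eq_one_right h.ttt

lemma e_inv : ε⁻¹ = ε := inv_eq_of_mul_eq_one_right h.ee

lemma ttt_mul (x : G) : t * (t * (t * x)) = x := by
  rw [← mul_assoc t t x, ← mul_assoc, h.ttt, one_mul]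

lemma tp_mul_self (s : Bool) (x : G) : tp t s * (tp t s * x) = tp t (!s) * x := by
  cases s <;> simp [tp, h.t_inv, mul_assoc, h.ttt_mul]

lemma mul_tp_step {x : G} (s : Bool) (hx : ∃ i l j, x = ep ε i * psw ε t l * ep ε j) :
    ∃ i l j, tp t s * x = ep ε i * psw ε t l * ep ε j := by
  obtain ⟨i, l, j, rfl⟩ := hx
  cases i with
  | false => exact ⟨true, s :: l, j, by simp [ep, psw_cons, h.ee_mul, mul_assoc]⟩
  | true =>
    rcases l with _ | ⟨e, l⟩
    · refine ⟨true, [s], !j, ?_⟩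
      cases j <;> simp [ep, psw_cons, psw_nil, h.ee_mul, h.ee]
    · by_cases hes : e = s
      · subst hes
        refine ⟨true, (!e) :: l, j, ?_⟩
        simp [ep, psw_cons, h.ee_mul, mul_assoc, h.tp_mul_self]
      · obtain rfl : e = !s := by cases e <;> cases s <;> simp_all
        refine ⟨false, l, j, ?_⟩
        simp [ep, psw_cons, h.ee_mul, mul_assoc, tp_mul_not]

lemma mul_e_step {x : G} (hx : ∃ i l j, x = ep ε i * psw ε t l * ep ε j) :
    ∃ i l j, ε * x = ep ε i * psw ε t l * ep ε j := by
  obtain ⟨i, l, j, rfl⟩ := hx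
  refine ⟨!i, l, j, ?_⟩
  cases i <;> simp [ep, h.ee_mul, mul_assoc]

lemma normal_form (g : G) : ∃ i l j, g = ep ε i * psw ε t l * ep ε j := by
  let P : G → Prop := fun x => ∃ i l j, x = ep ε i * psw ε t l * ep ε j
  have := h.gen
    { carrier := {g | ∀ x, P x → P (g * x) ∧ P (g⁻¹ * x)}
      one_mem' := fun x hx => by simpa using hx
      mul_mem' := fun {a b} ha hb x hx => by
        rw [mul_inv_rev, mul_assoc, mul_assoc]
        exact ⟨(ha _ (hb _ hx).1).1, (hb _ (ha _ hx).2).2⟩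
      inv_mem' := fun {a} ha x hx => by
        rw [inv_inv]
        exact (ha x hx).symm }
    (fun x hx => ⟨h.mul_e_step hx, by rw [h.e_inv]; exact h.mul_e_step hx⟩)
    (fun x hx => ⟨h.mul_tp_step true hx, h.mul_tp_step false hx⟩) g
  have h1 := (this 1 ⟨false, [], false, by simp [ep, psw_nil]⟩).1
  rwa [mul_one] at h1

lemma pow_psw_ne {l : List Bool} (hl : l ≠ []) {n : ℕ} (hn : 0 < n) : psw ε t l ^ n ≠ 1 := by
  intro h1
  have h2 : ∀ n : ℕ, ∃ m : List Bool, psw ε t l ^ n = psw ε t m ∧ n ≤ m.length := by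
    intro n
    induction n with
    | zero => exact ⟨[], by simp [psw_nil], le_rfl⟩
    | succ n ih =>
      obtain ⟨m, hm, hle⟩ := ih
      refine ⟨m ++ l, by rw [pow_succ, hm, psw_append], ?_⟩
      have := List.length_pos_iff.mpr hl
      rw [List.length_append]
      omega
  obtain ⟨m, hm, hle⟩ := h2 n
  have := h.length_add_two_le m
  rw [← hm, h1, h.N_one] at this
  omega

lemma t_ne : t ≠ 1 := fun h1 => by
  have := h.N_t
  rw [h1, h.N_one] at this
  omega

lemma e_ne : ε ≠ 1 := fun h1 =>
  h.pow_psw_ne (l := [true]) (by simp) (show 0 < 3 by omega) (by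
    simp [psw_cons, psw_nil, h1, tp, pow_succ, mul_assoc, h.ttt])

lemma conj_e_psw (l : List Bool) : ∃ x, (x = ε ∨ (∃ s, x = tp t s) ∨ ∃ m ≠ [], x = psw ε t m) ∧
    IsConj (ε * psw ε t l) x := by
  induction hn : l.length using Nat.strong_induction_on generalizing l with
  | _ n ih =>
    rcases l with _ | ⟨e, m'⟩
    · exact ⟨ε, Or.inl rfl, by rw [psw_nil, mul_one]⟩
    rcases List.eq_nil_or_concat m' with rfl | ⟨m, f, rfl⟩
    · exact ⟨tp t e, Or.inr (Or.inl ⟨e, rfl⟩), by rw [psw_cons, psw_nil, h.ee_mul, mul_one]⟩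
    rw [List.concat_eq_append] at hn ⊢
    have h1 : IsConj (ε * psw ε t (e :: (m ++ [f]))) (ε * (tp t f * (tp t e * psw ε t m))) := by
      have a1 := isConj_mul_swap (tp t e * psw ε t m * ε) (tp t f)
      have a2 := isConj_mul_swap (tp t f * (tp t e * psw ε t m)) ε
      simp only [mul_assoc] at a1 a2
      simp only [psw_cons, psw_append, psw_nil, h.ee_mul, mul_one]
      exact a1.trans a2
    by_cases hfe : e = f
    · subst hfe
      refine ⟨_, Or.inr (Or.inr ⟨(!e) :: m, by simp, rfl⟩), ?_⟩
      rwa [h.tp_mul_self, ← psw_cons] at h1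
    · obtain rfl : e = !f := by cases e <;> cases f <;> simp_all
      rw [tp_mul_not] at h1
      obtain ⟨x, hx, hc⟩ := ih m.length (by rw [← hn]; simp) m rfl
      exact ⟨x, hx, h1.trans hc⟩

lemma conj_std (g : G) : ∃ x, (x = 1 ∨ x = ε ∨ (∃ s, x = tp t s) ∨ ∃ m ≠ [], x = psw ε t m) ∧
    IsConj g x := by
  obtain ⟨i, l, j, rfl⟩ := h.normal_form g
  have h1 : IsConj (ep ε i * psw ε t l * ep ε j) (ep ε (xor i j) * psw ε t l) := by
    have h2 : ep ε (xor i j) * psw ε t l = ep ε j * (ep ε i * psw ε t l) := by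
      cases i <;> cases j <;> simp [ep, h.ee_mul]
    rw [h2]
    exact isConj_mul_swap _ _
  cases hij : xor i j with
  | false =>
    rw [hij] at h1
    rcases l with _ | ⟨e, l⟩
    · exact ⟨1, Or.inl rfl, by simpa [ep, psw_nil] using h1⟩
    · exact ⟨_, Or.inr (Or.inr (Or.inr ⟨e :: l, by simp, rfl⟩)), by simpa [ep] using h1⟩
  | true =>
    rw [hij] at h1
    obtain ⟨x, hx, hc⟩ := h.conj_e_psw l
    exact ⟨x, Or.inr hx, h1.trans hc⟩

lemma tp_pow_three (s : Bool) : tp t s ^ 3 = 1 := by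
  cases s <;> simp [tp, h.ttt, pow_succ, mul_assoc, h.t_inv]

lemma isConj_e {g : G} (hg : g ^ 2 = 1) (hg1 : g ≠ 1) : IsConj g ε := by
  obtain ⟨x, hx, hc⟩ := h.conj_std g
  have hx2 := pow_eq_one_of_isConj hc hg
  rcases hx with rfl | rfl | ⟨s, rfl⟩ | ⟨m, hm, rfl⟩
  · exact absurd (isConj_one_left.mp hc) hg1
  · exact hc
  · have h3 := h.tp_pow_three s
    rw [pow_succ, hx2, one_mul] at h3
    exact absurd (isConj_one_left.mp (h3 ▸ hc)) hg1
  · exact absurd hx2 (h.pow_psw_ne hm (by omega))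

lemma isConj_t {g : G} (hg : g ^ 3 = 1) (hg1 : g ≠ 1) : ∃ s, IsConj g (tp t s) := by
  obtain ⟨x, hx, hc⟩ := h.conj_std g
  have hx3 := pow_eq_one_of_isConj hc hg
  rcases hx with rfl | rfl | ⟨s, rfl⟩ | ⟨m, hm, rfl⟩
  · exact absurd (isConj_one_left.mp hc) hg1
  · rw [pow_succ, pow_two, h.ee, one_mul] at hx3
    exact absurd hx3 h.e_ne
  · exact ⟨s, hc⟩
  · exact absurd hx3 (h.pow_psw_ne hm (by omega))

lemma e_mul_psw_inv (l : List Bool) :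
    ε * (psw ε t l)⁻¹ = psw ε t (l.map not).reverse * ε := by
  induction l with
  | nil => simp [psw_nil]
  | cons e l ih =>
    rw [psw_cons, mul_inv_rev, mul_inv_rev, ← mul_assoc, ← mul_assoc, ih, tp_inv, h.e_inv,
      List.map_cons, List.reverse_cons, psw_append, psw_cons, psw_nil]
    simp only [mul_assoc, mul_one]

lemma conj_tp (l : List Bool) (s : Bool) : psw ε t l * ε * tp t s * (psw ε t l * ε)⁻¹ =
    psw ε t (l ++ s :: (l.map not).reverse) * ε := by
  rw [mul_inv_rev, h.e_inv, h.e_mul_psw_inv, psw_append, psw_cons]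
  simp only [mul_assoc]

variable {θ : MulAut G}

/-- Automorphisms fixing `ε` do not lengthen `t`. -/
lemma eq_nil_of_map (he : θ ε = ε) {l : List Bool} {s : Bool}
    (ht : θ t = psw ε t l * ε * tp t s * (psw ε t l * ε)⁻¹) : l = [] := by
  by_contra hl
  have hl' := List.length_pos_iff.mpr hl
  have h1 : ∀ e, ∃ m : List Bool, 3 ≤ m.length ∧ θ (tp t e) = psw ε t m * ε := by
    intro e
    have h2 : ∃ f, θ (tp t e) = psw ε t l * ε * tp t f * (psw ε t l * ε)⁻¹ := by
      cases e with
      | true => exact ⟨s, ht⟩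
      | false =>
        refine ⟨!s, ?_⟩
        change θ t⁻¹ = _
        rw [map_inv, ht, ← tp_inv]
        group
    obtain ⟨f, hf⟩ := h2
    refine ⟨_, ?_, hf.trans (h.conj_tp l f)⟩
    simp only [List.length_append, List.length_cons, List.length_reverse, List.length_map]
    omega
  have h2 : ∀ m, ∃ m' : List Bool, θ (psw ε t m) = ε * psw ε t m' * ε ∧ 3 * m.length ≤ m'.length := by
    intro m
    induction m with
    | nil => exact ⟨[], by simp [psw_nil, h.ee], le_rfl⟩
    | cons e m ih =>
      obtain ⟨m', hm, hle⟩ := ih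
      obtain ⟨p, hp, hpe⟩ := h1 e
      refine ⟨p ++ m', ?_, ?_⟩
      · rw [psw_cons, map_mul, map_mul, he, hm, hpe, psw_append]
        simp only [mul_assoc, h.ee_mul]
      · simp only [List.length_append, List.length_cons]
        omega
  obtain ⟨i, m, j, hm⟩ := h.normal_form (θ⁻¹ t)
  obtain ⟨m', hm', hle⟩ := h2 m
  have hep : ∀ i, θ (ep ε i) = ep ε i := fun i => by cases i <;> simp [ep, he]
  have hN : ∀ i g, N (ep ε i * g) = N g := fun i g => by cases i <;> simp [ep, h.left]
  have hN' : ∀ i g, N (g * ep ε i) = N g := fun i g => by cases i <;> simp [ep, h.right]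
  have h3 := congrArg N (congrArg θ hm)
  rw [MulAut.apply_inv_self, map_mul, map_mul, hep, hep, hm', hN', hN, h.right, h.left, h.N_t] at h3
  have h4 := h.length_add_two_le m'
  have h5 : m = [] := by
    rw [← List.length_eq_zero_iff]
    omega
  rw [h5, psw_nil, map_one] at hm'
  rw [← h.left, ← h.right, ← hm', h.N_one] at h3
  omega

lemma exists_conj_form (g : G) (s : Bool) : ∃ i l, g * tp t s * g⁻¹ =
    ep ε i * (psw ε t l * ε * tp t s * (psw ε t l * ε)⁻¹) * (ep ε i)⁻¹ := by
  obtain ⟨i, l, j, rfl⟩ := h.normal_form g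
  cases j with
  | true => exact ⟨i, l, by simp only [ep, cond_true]; group⟩
  | false =>
    rcases List.eq_nil_or_concat l with rfl | ⟨m, e, rfl⟩
    · refine ⟨!i, [], ?_⟩
      cases i <;> simp [ep, psw_nil, h.e_inv, mul_assoc, h.ee_mul, h.ee]
    · refine ⟨i, m, ?_⟩
      have hc : tp t e * tp t s * (tp t e)⁻¹ = tp t s := by
        cases e <;> cases s <;> simp [tp]
      nth_rw 2 [← hc]
      simp only [List.concat_eq_append, psw_append, psw_cons, psw_nil, ep, cond_false]
      group

lemma exists_conj_aut (θ : MulAut G) : ∃ (s : Bool) (c : G),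
    (MulAut.conj c * θ) ε = ε ∧ (MulAut.conj c * θ) t = tp t s := by
  obtain ⟨c, hc⟩ := isConj_iff.mp (h.isConj_e (g := θ ε)
    (by rw [← map_pow, pow_two, h.ee, map_one]) (by simpa using h.e_ne))
  obtain ⟨s, hs⟩ := h.isConj_t (g := θ t)
    (by rw [← map_pow, pow_succ, pow_two, mul_assoc, h.ttt, map_one]) (by simpa using h.t_ne)
  obtain ⟨d, hd⟩ := isConj_iff.mp hs.symm
  obtain ⟨i, l, hl⟩ := h.exists_conj_form (c * d) s
  have h1 : ∀ i, ep ε i * ε = ε * ep ε i := fun i => by cases i <;> simp [ep]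
  have he : (MulAut.conj ((ep ε i)⁻¹ * c) * θ) ε = ε := by
    rw [MulAut.mul_apply, MulAut.conj_apply]
    calc _ = (ep ε i)⁻¹ * (c * θ ε * c⁻¹) * ep ε i := by group
      _ = _ := by rw [hc, mul_assoc, ← h1, inv_mul_cancel_left]
  have ht : (MulAut.conj ((ep ε i)⁻¹ * c) * θ) t =
      psw ε t l * ε * tp t s * (psw ε t l * ε)⁻¹ := by
    rw [MulAut.mul_apply, MulAut.conj_apply, ← hd]
    calc _ = (ep ε i)⁻¹ * (c * d * tp t s * (c * d)⁻¹) * ep ε i := by group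
      _ = _ := by rw [hl]; group
  have hnil := h.eq_nil_of_map he ht
  refine ⟨s, ε * ((ep ε i)⁻¹ * c), ?_, ?_⟩
  · rw [map_mul, mul_assoc, MulAut.mul_apply, he, MulAut.conj_apply, mul_inv_cancel_right]
  · rw [map_mul, mul_assoc, MulAut.mul_apply, ht, hnil, MulAut.conj_apply, psw_nil, one_mul, h.e_inv]
    simp only [mul_assoc, h.ee_mul, h.ee, mul_one]

theorem finiteIndex_conj : (MulAut.conj : G →* MulAut G).range.FiniteIndex := by
  choose s c hc using h.exists_conj_aut
  refine finiteIndex_of_finite_valued _ s fun θ θ' hs => ?_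
  have h1 : MulAut.conj (c θ) * θ = MulAut.conj (c θ') * θ' := by
    ext g
    refine h.gen ((MulAut.conj (c θ) * θ).toMonoidHom.eqLocus
      (MulAut.conj (c θ') * θ').toMonoidHom) ?_ ?_ g
    · exact (hc θ).1.trans (hc θ').1.symm
    · exact (hc θ).2.trans ((hs ▸ (hc θ').2).symm)
  refine ⟨(c θ)⁻¹ * c θ', ?_⟩
  rw [map_mul, map_inv, eq_mul_inv_iff_mul_eq, mul_assoc, ← h1, inv_mul_cancel_left]

end Modular
end modular

end BraidHol

namespace BraidHol

open Matrix in
/-- The standard map from the braid group on three strands to integral matrices. -/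
def rsl : Br 2 →* SpecialLinearGroup (Fin 2) ℤ :=
  Br.lift (fun i => if i = 0 then ⟨!![1, -1; 0, 1], by simp⟩ else ⟨!![1, 0; 1, 1], by simp⟩)
    ⟨fun i hi => by
      obtain rfl : i = 0 := by omega
      refine Subtype.ext ?_
      change (!![1, -1; 0, 1] * !![1, 0; 1, 1] * !![1, -1; 0, 1] : Matrix _ _ ℤ) =
        !![1, 0; 1, 1] * !![1, -1; 0, 1] * !![1, 0; 1, 1]
      simp,
    fun i j _ _ => by omega⟩

lemma rsl_zero : (rsl (sg 2 0)).1 = !![1, -1; 0, 1] := by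
  rw [rsl, Br.lift_sg _ _ (by omega)]; rfl

lemma rsl_one : (rsl (sg 2 1)).1 = !![1, 0; 1, 1] := by
  rw [rsl, Br.lift_sg _ _ (by omega)]; rfl

/-- The sum of the absolute values of the entries. -/
def msum (A : Matrix (Fin 2) (Fin 2) ℤ) : ℕ :=
  (A 0 0).natAbs + (A 0 1).natAbs + (A 1 0).natAbs + (A 1 1).natAbs

/-- An element of order three modulo the centre. -/
def tbr : Br 2 := sg 2 0 * sg 2 1

/-- An element of order two modulo the centre. -/
def ebr : Br 2 := sg 2 0 * sg 2 1 * sg 2 0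

lemma zz_two : zz 2 = tbr * tbr * tbr := by
  simp [zz, dl, del_succ, tbr, pow_succ]

lemma ebr_mul_ebr : ebr * ebr = zz 2 := by
  have h := sg_braid (k := 2) (i := 0) (by omega)
  rw [zero_add] at h
  rw [zz_two]
  nth_rw 2 [ebr]
  rw [h, ebr, tbr]
  simp only [mul_assoc]

lemma rsl_ebr : (rsl ebr).1 = !![0, -1; 1, 0] := by
  rw [ebr, map_mul, map_mul, Matrix.SpecialLinearGroup.coe_mul, Matrix.SpecialLinearGroup.coe_mul]
  simp [rsl_zero, rsl_one]

lemma rsl_tbr : (rsl tbr).1 = !![0, -1; 1, 1] := by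
  rw [tbr, map_mul, Matrix.SpecialLinearGroup.coe_mul]
  simp [rsl_zero, rsl_one]

lemma rsl_zz : (rsl (zz 2)).1 = !![-1, 0; 0, -1] := by
  rw [← ebr_mul_ebr, map_mul, Matrix.SpecialLinearGroup.coe_mul]
  simp [rsl_ebr]

lemma msum_mul_zz (x : Br 2) : msum (rsl (x * zz 2)).1 = msum (rsl x).1 := by
  rw [map_mul, Matrix.SpecialLinearGroup.coe_mul, rsl_zz]
  simp [msum, Matrix.mul_apply, Fin.sum_univ_two]

lemma msum_mul_zz_zpow (x : Br 2) (n : ℤ) : msum (rsl (x * zz 2 ^ n)).1 = msum (rsl x).1 := by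
  induction n with
  | zero => simp
  | succ n ih => rw [zpow_add_one, ← mul_assoc, msum_mul_zz, ih]
  | pred n ih => rw [← msum_mul_zz, mul_assoc, ← zpow_add_one, sub_add_cancel, ih]

/-- The length function on the modular group. -/
noncomputable def bsum (g : Bb 2) : ℕ := msum (rsl (Function.surjInv bq_surj g)).1

lemma bsum_bq (x : Br 2) : bsum (bq 2 x) = msum (rsl x).1 := by
  obtain ⟨n, hn⟩ := bq_eq.mp (Function.surjInv_eq bq_surj (bq 2 x))
  rw [bsum, hn, msum_mul_zz_zpow]

lemma psw_eq (l : List Bool) : ∃ x, psw (bq 2 ebr) (bq 2 tbr) l = bq 2 x ∧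
    0 ≤ (rsl x).1 0 0 ∧ 0 ≤ (rsl x).1 0 1 ∧ 0 ≤ (rsl x).1 1 0 ∧ 0 ≤ (rsl x).1 1 1 ∧
    1 ≤ (rsl x).1 0 0 + (rsl x).1 0 1 ∧ 1 ≤ (rsl x).1 1 0 + (rsl x).1 1 1 ∧
    (l.length : ℤ) + 2 ≤
      (rsl x).1 0 0 + (rsl x).1 0 1 + ((rsl x).1 1 0 + (rsl x).1 1 1) := by
  induction l with
  | nil => exact ⟨1, by simp [psw_nil]⟩
  | cons s l ih =>
    obtain ⟨x, hx, h1, h2, h3, h4, h5, h6, h7⟩ := ih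
    cases s with
    | true =>
      have h : bq 2 (ebr * tbr) = bq 2 (sg 2 0)⁻¹ := by
        have h0 : ebr * tbr * sg 2 0 = zz 2 := by rw [← ebr_mul_ebr, mul_assoc]; rfl
        rw [map_inv, eq_inv_iff_mul_eq_one, ← map_mul, h0, bq_zz]
      refine ⟨(sg 2 0)⁻¹ * x, ?_, ?_⟩
      · rw [psw_cons, ← mul_assoc, hx, map_mul, ← h, map_mul]; rfl
      · rw [map_mul, map_inv, Matrix.SpecialLinearGroup.coe_mul,
          Matrix.SpecialLinearGroup.coe_inv, rsl_zero]
        simp [Matrix.mul_apply, Fin.sum_univ_two, Matrix.adjugate_fin_two]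
        lia
    | false =>
      have h : bq 2 (ebr * tbr⁻¹) = bq 2 (sg 2 1) := by
        have h := sg_braid (k := 2) (i := 0) (by omega)
        rw [ebr, h, tbr]
        simp
      refine ⟨sg 2 1 * x, ?_, ?_⟩
      · rw [psw_cons, ← mul_assoc, hx, map_mul, ← h, map_mul, map_inv]; rfl
      · rw [map_mul, Matrix.SpecialLinearGroup.coe_mul, rsl_one]
        simp [Matrix.mul_apply, Fin.sum_univ_two]
        lia

lemma modular_Bb_two : Modular (bq 2 ebr) (bq 2 tbr) bsum where
  ee := by rw [← map_mul, ebr_mul_ebr, bq_zz]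
  ttt := by rw [← map_mul, ← map_mul, ← mul_assoc, ← zz_two, bq_zz]
  gen := fun H he ht => by
    have h1 : bq 2 (sg 2 0) ∈ H := by
      have h : bq 2 (sg 2 0) = (bq 2 tbr)⁻¹ * bq 2 ebr := by
        rw [eq_inv_mul_iff_mul_eq, ← map_mul]; rfl
      rw [h]
      exact mul_mem (inv_mem ht) he
    have h2 : bq 2 (sg 2 1) ∈ H := by
      have h : bq 2 (sg 2 1) = (bq 2 (sg 2 0))⁻¹ * bq 2 tbr := by
        rw [eq_inv_mul_iff_mul_eq, ← map_mul]; rfl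
      rw [h]
      exact mul_mem (inv_mem h1) ht
    refine Bb.mem_of_sg H fun i hi => ?_
    interval_cases i
    exacts [h1, h2]
  left := fun g => by
    obtain ⟨x, rfl⟩ := bq_surj g
    rw [← map_mul, bsum_bq, bsum_bq, map_mul, Matrix.SpecialLinearGroup.coe_mul, rsl_ebr]
    simp [msum, Matrix.mul_apply, Fin.sum_univ_two]
    lia
  right := fun g => by
    obtain ⟨x, rfl⟩ := bq_surj g
    rw [← map_mul, bsum_bq, bsum_bq, map_mul, Matrix.SpecialLinearGroup.coe_mul, rsl_ebr]
    simp [msum, Matrix.mul_apply, Fin.sum_univ_two]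
    lia
  N_one := by
    rw [← map_one (bq 2), bsum_bq, map_one]
    simp [msum]
  N_t := by
    rw [bsum_bq, rsl_tbr]
    simp [msum]
  length_add_two_le := fun l => by
    obtain ⟨x, hx, h1, h2, h3, h4, h5, h6, h7⟩ := psw_eq l
    rw [hx, bsum_bq, msum]
    lia

theorem finiteIndex_conj_Bb {k : ℕ} (hk : 2 ≤ k) :
    (MulAut.conj : Bb k →* MulAut (Bb k)).range.FiniteIndex := by
  induction k, hk using Nat.le_induction with
  | base => exact modular_Bb_two.finiteIndex_conj
  | succ k hk ih => exact finiteIndex_conj_succ hk ih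

end BraidHol

namespace BraidHol

section aut
variable {k : ℕ}

/-- Automorphisms preserve the exponent sum up to sign. -/
lemma exists_esum_aut (hk : 1 ≤ k) (ψ : MulAut (Br k)) : ∃ a : ℤ, (a = 1 ∨ a = -1) ∧
    ∀ i < k, esum k (ψ (sg k i)) = Multiplicative.ofAdd a := by
  set a : ℤ := Multiplicative.toAdd (esum k (ψ (sg k 0))) with ha
  have h1 : ∀ i < k, esum k (ψ (sg k i)) = Multiplicative.ofAdd a := by
    intro i
    induction i with
    | zero => intro _; rw [ha, ofAdd_toAdd]
    | succ i ih =>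
      intro hi
      rw [← ih (by omega)]
      have h := congrArg (fun x => esum k (ψ x)) (sg_braid hi)
      simp only [map_mul] at h
      rw [mul_comm (esum k (ψ (sg k i))) (esum k (ψ (sg k (i + 1)))), mul_right_inj] at h
      exact h.symm
  refine ⟨a, ?_, h1⟩
  have h2 : (esum k).comp ψ.toMonoidHom = (zpowGroupHom a).comp (esum k) := by
    refine Br.hom_ext fun i hi => ?_
    change esum k (ψ (sg k i)) = esum k (sg k i) ^ a
    rw [h1 i hi, esum_sg hi, ← ofAdd_zsmul, smul_eq_mul, mul_one]
  have h3 := DFunLike.congr_fun h2 (ψ⁻¹ (sg k 0))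
  change esum k (ψ (ψ⁻¹ (sg k 0))) = esum k (ψ⁻¹ (sg k 0)) ^ a at h3
  rw [MulAut.apply_inv_self, esum_sg (by omega), ← ofAdd_toAdd (esum k (ψ⁻¹ (sg k 0))),
    ← ofAdd_zsmul, smul_eq_mul] at h3
  exact Int.isUnit_iff.mp (IsUnit.of_mul_eq_one _ (Multiplicative.ofAdd.injective h3).symm)

/-- An automorphism inducing the identity modulo the full twist is the identity. -/
lemma aut_eq_one_of_bq (hk : 2 ≤ k) {ψ : MulAut (Br k)} (h : ∀ b, bq k (ψ b) = bq k b) :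
    ψ = 1 := by
  obtain ⟨a, ha, hψ⟩ := exists_esum_aut (by omega) ψ
  have h1 : ∀ i < k, ψ (sg k i) = sg k i := by
    intro i hi
    obtain ⟨n, hn⟩ := bq_eq.mp (h (sg k i))
    have h2 := hψ i hi
    rw [hn, map_mul, map_zpow, esum_sg hi, esum_zz, ← ofAdd_zsmul, ← ofAdd_add] at h2
    have h3 := Multiplicative.ofAdd.injective h2
    rw [smul_eq_mul] at h3
    push_cast at h3
    have h4 : (6 : ℤ) ≤ k * (k + 1) := by
      have : (2 : ℤ) ≤ k := by exact_mod_cast hk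
      nlinarith
    have h5 : n = 0 := by
      by_contra hne
      rcases lt_or_gt_of_ne hne with hlt | hlt
      · have : n * (k * (k + 1) : ℤ) ≤ -6 := by nlinarith
        lia
      · have : 6 ≤ n * (k * (k + 1) : ℤ) := by nlinarith
        lia
    rw [hn, h5, zpow_zero, mul_one]
  have h2 : ψ.toMonoidHom = MonoidHom.id _ := Br.hom_ext h1
  ext b
  exact DFunLike.congr_fun h2 b

lemma zpowers_zz_eq (hk : 2 ≤ k) : Subgroup.zpowers (zz k) = Subgroup.center (Br k) := by
  ext x
  rw [mem_center_iff hk, Subgroup.mem_zpowers_iff]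
  simp only [eq_comm]

/-- The automorphism induced modulo the full twist. -/
def indAut (hk : 2 ≤ k) (φ : MulAut (Br k)) : MulAut (Bb k) :=
  QuotientGroup.congr _ _ φ (by
    rw [zpowers_zz_eq hk]
    exact Subgroup.characteristic_iff_map_eq.mp inferInstance φ)

lemma indAut_bq (hk : 2 ≤ k) (φ : MulAut (Br k)) (x : Br k) :
    indAut hk φ (bq k x) = bq k (φ x) := rfl

lemma finiteIndex_conj_of_two_le (hk : 2 ≤ k) :
    (MulAut.conj : Br k →* MulAut (Br k)).range.FiniteIndex := by
  have := finiteIndex_conj_Bb hk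
  have hfin : Finite (MulAut (Bb k) ⧸ (MulAut.conj : Bb k →* MulAut (Bb k)).range) := inferInstance
  refine finiteIndex_of_finite_valued _
    (fun φ => QuotientGroup.mk (s := (MulAut.conj : Bb k →* MulAut (Bb k)).range) (indAut hk φ)⁻¹)
    fun φ φ' h => ?_
  rw [QuotientGroup.eq, inv_inv] at h
  obtain ⟨g, hg⟩ := h
  obtain ⟨x, rfl⟩ := bq_surj g
  rw [eq_mul_inv_iff_mul_eq] at hg
  have h1 : (MulAut.conj x)⁻¹ * (φ * φ'⁻¹) = 1 := by
    refine aut_eq_one_of_bq hk fun b => ?_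
    have h2 := DFunLike.congr_fun hg (bq k (φ'⁻¹ b))
    rw [MulAut.mul_apply, indAut_bq, indAut_bq, MulAut.apply_inv_self, MulAut.conj_apply] at h2
    rw [MulAut.mul_apply, MulAut.mul_apply, ← map_inv, MulAut.conj_apply, map_mul, map_mul, ← h2,
      inv_inv, map_inv]
    group
  exact ⟨x, inv_mul_eq_one.mp h1⟩

lemma esum_one_injective : Function.Injective (esum 1) := by
  refine (injective_iff_map_eq_one _).mpr fun x hx => ?_
  obtain ⟨n, rfl⟩ := Br.mem_of_sg (Subgroup.zpowers (sg 1 0)) (fun i hi => by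
    obtain rfl : i = 0 := by omega
    exact Subgroup.mem_zpowers _) x
  change esum 1 (sg 1 0 ^ n) = 1 at hx
  rw [map_zpow, esum_sg (by omega), ← ofAdd_zsmul, ← ofAdd_zero] at hx
  have := Multiplicative.ofAdd.injective hx
  rw [smul_eq_mul, mul_one] at this
  rw [this]
  exact zpow_zero _

lemma finiteIndex_conj_one : (MulAut.conj : Br 1 →* MulAut (Br 1)).range.FiniteIndex := by
  refine finiteIndex_of_finite_valued _
    (fun φ => decide (esum 1 (φ (sg 1 0)) = Multiplicative.ofAdd 1)) fun φ φ' h => ?_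
  have h0 : φ = φ' := by
    obtain ⟨a, ha, h1⟩ := exists_esum_aut le_rfl φ
    obtain ⟨b, hb, h2⟩ := exists_esum_aut le_rfl φ'
    have h3 : φ.toMonoidHom = φ'.toMonoidHom := Br.hom_ext fun i hi => by
      obtain rfl : i = 0 := by omega
      refine esum_one_injective ?_
      change esum 1 (φ _) = esum 1 (φ' _)
      simp only [h1 0 hi, h2 0 hi, EmbeddingLike.apply_eq_iff_eq, decide_eq_decide] at h ⊢
      omega
    ext x
    exact DFunLike.congr_fun h3 x
  rw [h0, mul_inv_cancel]
  exact one_mem _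

/-- Inner automorphisms of the braid group are of finite index. -/
theorem finiteIndex_conj_Br (hk : 1 ≤ k) :
    (MulAut.conj : Br k →* MulAut (Br k)).range.FiniteIndex := by
  rcases hk.eq_or_lt with rfl | hk
  · exact finiteIndex_conj_one
  · exact finiteIndex_conj_of_two_le hk

end aut

end BraidHol

/-- **Corollary 2.** The holomorph `Hol(B_n)` of the braid group `B_n`, `n ≥ 2`, has a
faithful linear representation over a field of characteristic zero. -/
theorem holomorph_braid_linear (n : ℕ) (hn : 2 ≤ n) :
    ∃ (m : ℕ) (_ : 0 < m)
      (ρ : (BraidGroup n ⋊[MonoidHom.id (MulAut (BraidGroup n))]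
              MulAut (BraidGroup n)) →* GL (Fin m) ℂ),
      Function.Injective ρ := by
  obtain ⟨ρ, hρ⟩ := BraidHol.exists_faithful_end (n - 1)
  exact BraidHol.holomorph_linear ((Units.coeHom _).comp ρ)
    (BraidHol.finiteIndex_conj_Br (by omega)) (Units.val_injective.comp hρ)
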